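/- For every Lipschitz bounded open set Ω ⊂ ℝ² whose complement has at most one bounded connected component, F_{1/2}(Ω) = P(Ω) T(Ω)^{1/2} |Ω|^{-3/2} ≥ 3^{-1/2}. Moreover this bound is sharp: for rectangles R_n = (0, n) × (0, 1/n), F_{1/2}(R_n) → 3^{-1/2} as n → ∞. -/

import Mathlib

open MeasureTheory Metric Set Filter Topology Bornology ENNReal

noncomputable section

abbrev E2 := EuclideanSpace ℝ (Fin 2)

/-- divergence of a vector field on ℝ² -/
def divg (φ : E2 → E2) (x : E2) : ℝ := ∑ i, fderiv ℝ φ x (EuclideanSpace.single i 1) i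

/-- the set of admissible values in De Giorgi's definition of perimeter -/
def perimSet (Ω : Set E2) : Set ℝ :=
  {r | ∃ φ : E2 → E2, ContDiff ℝ 1 φ ∧ HasCompactSupport φ ∧ (∀ x, ‖φ x‖ ≤ 1) ∧
        r = ∫ x in Ω, divg φ x}

/-- De Giorgi perimeter -/
def perimeter (Ω : Set E2) : ℝ := sSup (perimSet Ω)

def HasFinitePerimeter (Ω : Set E2) : Prop := BddAbove (perimSet Ω)

/-- torsional rigidity via the variational formula -/
def torsion (Ω : Set E2) : ℝ :=
  sSup ({0} ∪ {r | ∃ u : E2 → ℝ, ContDiff ℝ 1 u ∧ HasCompactSupport u ∧ tsupport u ⊆ Ω ∧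
      (∫ x in Ω, ‖fderiv ℝ u x‖ ^ 2) ≠ 0 ∧
      r = (∫ x in Ω, u x) ^ 2 / ∫ x in Ω, ‖fderiv ℝ u x‖ ^ 2})

def inradius (Ω : Set E2) : ℝ := sSup ((fun x => infDist x (frontier Ω)) '' Ω)

def innerParallel (Ω : Set E2) (t : ℝ) : Set E2 := {x ∈ Ω | t < infDist x (frontier Ω)}

def boundedComponents (s : Set E2) : Set (Set E2) :=
  {C | ∃ x ∈ s, C = connectedComponentIn s x ∧ IsBounded C}

/-- `s` has at most `k` bounded connected components -/
def nBddCompLe (s : Set E2) (k : ℕ) : Prop :=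
  (boundedComponents s).Finite ∧ (boundedComponents s).ncard ≤ k

/-- the class 𝒜ₖ -/
def memA (k : ℕ) (Ω : Set E2) : Prop :=
  Ω.Nonempty ∧ IsOpen Ω ∧ IsBounded Ω ∧ nBddCompLe Ωᶜ k

/-- points of density `t` of `s` -/
def densityPts (s : Set E2) (t : ℝ≥0∞) : Set E2 :=
  {x | Tendsto (fun r => volume (s ∩ ball x r) / volume (ball x r)) (𝓝[>] (0:ℝ)) (𝓝 t)}

/-- area of the interior parallel set -/
def Afun (Ω : Set E2) (t : ℝ) : ℝ := (volume (innerParallel Ω t)).toReal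

/-- length of the interior parallel -/
def Lfun (Ω : Set E2) (t : ℝ) : ℝ :=
  (μH[1] ({x ∈ Ω | infDist x (frontier Ω) = t})).toReal

/-- a bounded open set with Lipschitz boundary -/
def IsLipschitzDomain (Ω : Set E2) : Prop :=
  ∀ x ∈ frontier Ω, ∃ (g : E2 ≃ₗᵢ[ℝ] E2) (f : ℝ → ℝ) (K : NNReal) (ε : ℝ),
    0 < ε ∧ LipschitzWith K f ∧
    Ω ∩ ball x ε = {y ∈ ball x ε | f ((g (y - x)) 0) < (g (y - x)) 1}

/-- the scale-free shape functional F_q -/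
def Fq (q : ℝ) (Ω : Set E2) : ℝ :=
  perimeter Ω * torsion Ω ^ q / (volume Ω).toReal ^ (2 * q + 1 / 2)

end

/-! ### Counting components of subsets of the line -/

/-- `S` is a finite subset of `A`, distinct points lying in different components of `A`. -/
def SepPts (A : Set ℝ) (S : Finset ℝ) : Prop :=
  (∀ y ∈ S, y ∈ A) ∧ ∀ y ∈ S, ∀ y' ∈ S, y < y' → ∃ z, y < z ∧ z < y' ∧ z ∉ A

/-- number of connected components of `A ⊆ ℝ` -/
noncomputable def ncomp (A : Set ℝ) : ℝ≥0∞ := ⨆ (S : Finset ℝ) (_ : SepPts A S), (S.card : ℝ≥0∞)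

lemma SepPts.card_le {A : Set ℝ} {S : Finset ℝ} (h : SepPts A S) : (S.card : ℝ≥0∞) ≤ ncomp A :=
  le_iSup₂_of_le S h le_rfl

lemma sep_empty (A : Set ℝ) : SepPts A ∅ := by constructor <;> simp

lemma ncomp_max {A : Set ℝ} (hA : ncomp A ≠ ∞) :
    ∃ S : Finset ℝ, SepPts A S ∧ (S.card : ℝ≥0∞) = ncomp A ∧ ∀ y ∈ A, ∃ s ∈ S, uIcc y s ⊆ A := by
  obtain ⟨N, hN⟩ := ENNReal.exists_nat_gt hA
  have hbd : ∀ S : Finset ℝ, SepPts A S → S.card ≤ N := by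
    intro S hS
    have := lt_of_le_of_lt hS.card_le hN
    exact_mod_cast this.le
  have hne : ∃ n, ∃ S : Finset ℝ, SepPts A S ∧ S.card = n := ⟨0, ∅, sep_empty A, rfl⟩
  classical
  set m := Nat.findGreatest (fun n => ∃ S : Finset ℝ, SepPts A S ∧ S.card = n) N with hm
  have hspec : ∃ S : Finset ℝ, SepPts A S ∧ S.card = m :=
    Nat.findGreatest_spec (P := fun n => ∃ S : Finset ℝ, SepPts A S ∧ S.card = n) (Nat.zero_le N)
      ⟨∅, sep_empty A, rfl⟩
  have hmax : ∀ S : Finset ℝ, SepPts A S → S.card ≤ m := fun S hS =>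
    Nat.le_findGreatest (P := fun n => ∃ S : Finset ℝ, SepPts A S ∧ S.card = n) (hbd S hS) ⟨S, hS, rfl⟩
  obtain ⟨S, hS, hc⟩ := hspec
  refine ⟨S, hS, ?_, ?_⟩
  · apply le_antisymm hS.card_le
    apply iSup₂_le
    intro S' hS'
    rw [hc]
    exact_mod_cast hmax S' hS'
  · intro y hy
    by_contra hcon
    push Not at hcon
    have key : ∀ s ∈ S, ∃ z, z ∉ A ∧ ((y < z ∧ z < s) ∨ (s < z ∧ z < y)) := by
      intro s hs
      obtain ⟨z, hz, hzA⟩ := Set.not_subset.1 (hcon s hs)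
      refine ⟨z, hzA, ?_⟩
      have h1 : z ≠ y := fun h => hzA (h ▸ hy)
      have h2 : z ≠ s := fun h => hzA (h ▸ hS.1 s hs)
      rcases mem_uIcc.1 hz with h | h
      · left; exact ⟨lt_of_le_of_ne h.1 h1.symm, lt_of_le_of_ne h.2 h2⟩
      · right; exact ⟨lt_of_le_of_ne h.1 h2.symm, lt_of_le_of_ne h.2 h1⟩
    have hyS : y ∉ S := by
      intro h
      obtain ⟨z, _, h | h⟩ := key y h
      · linarith [h.1, h.2]
      · linarith [h.1, h.2]
    have hins : SepPts A (insert y S) := by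
      constructor
      · intro x hx
        rcases Finset.mem_insert.1 hx with rfl | h
        · exact hy
        · exact hS.1 x h
      · intro a ha b hb hab
        rcases Finset.mem_insert.1 ha with rfl | ha1 <;> rcases Finset.mem_insert.1 hb with rfl | hb1
        · exact absurd hab (lt_irrefl _)
        · obtain ⟨z, hz, h | h⟩ := key b hb1
          · exact ⟨z, h.1, h.2, hz⟩
          · linarith [h.1, h.2]
        · obtain ⟨z, hz, h | h⟩ := key a ha1
          · linarith [h.1, h.2]
          · exact ⟨z, h.1, h.2, hz⟩
        · exact hS.2 a ha1 b hb1 hab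
    have := hmax _ hins
    rw [Finset.card_insert_of_notMem hyS] at this
    omega

lemma ncomp_shift_le (A : Set ℝ) (c : ℝ) : ncomp {y | y + c ∈ A} ≤ ncomp A := by
  classical
  apply iSup₂_le
  intro S hS
  have : SepPts A (S.image (fun y => y + c)) := by
    constructor
    · intro y hy
      obtain ⟨x, hx, rfl⟩ := Finset.mem_image.1 hy
      exact hS.1 x hx
    · intro y hy y' hy' h
      obtain ⟨x, hx, rfl⟩ := Finset.mem_image.1 hy
      obtain ⟨x', hx', rfl⟩ := Finset.mem_image.1 hy'
      obtain ⟨z, h1, h2, h3⟩ := hS.2 x hx x' hx' (by linarith)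
      exact ⟨z + c, by linarith, by linarith, h3⟩
  rw [← Finset.card_image_of_injective S (add_left_injective c)]
  exact this.card_le

lemma ncomp_shift (A : Set ℝ) (c : ℝ) : ncomp {y | y + c ∈ A} = ncomp A := by
  apply le_antisymm (ncomp_shift_le A c)
  have := ncomp_shift_le {y | y + c ∈ A} (-c)
  simpa using this

lemma ncomp_rat {A : Set ℝ} (hA : IsOpen A) :
    ncomp A = ⨆ (S : Finset ℚ) (_ : SepPts A (S.image (fun q : ℚ => (q : ℝ)))), (S.card : ℝ≥0∞) := by
  classical
  apply le_antisymm
  · apply iSup₂_le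
    intro S hS
    have hq : ∀ y ∈ S, ∃ q : ℚ, uIcc y (q : ℝ) ⊆ A := by
      intro y hy
      obtain ⟨ε, he, hb⟩ := Metric.isOpen_iff.1 hA y (hS.1 y hy)
      obtain ⟨q, h1, h2⟩ := exists_rat_btwn (show y < y + ε by linarith)
      refine ⟨q, fun z hz => hb ?_⟩
      rw [uIcc_of_le h1.le] at hz
      rw [mem_ball, Real.dist_eq, abs_lt]
      constructor <;> linarith [hz.1, hz.2]
    choose! f hf using hq
    have hmono : ∀ y ∈ S, ∀ y' ∈ S, y < y' → ∃ z, (f y : ℝ) < z ∧ z < f y' ∧ z ∉ A := by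
      intro y hy y' hy' hlt
      obtain ⟨z, h1, h2, h3⟩ := hS.2 y hy y' hy' hlt
      refine ⟨z, ?_, ?_, h3⟩
      · by_contra hh
        push Not at hh
        exact h3 (hf y hy (mem_uIcc.2 (Or.inl ⟨h1.le, hh⟩)))
      · by_contra hh
        push Not at hh
        exact h3 (hf y' hy' (mem_uIcc.2 (Or.inr ⟨hh, h2.le⟩)))
    have hinj : Set.InjOn f S := by
      intro y hy y' hy' h
      by_contra hne
      rcases lt_or_gt_of_ne hne with hl | hl
      · obtain ⟨z, h1, h2, _⟩ := hmono y hy y' hy' hl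
        rw [h] at h1; linarith
      · obtain ⟨z, h1, h2, _⟩ := hmono y' hy' y hy hl
        rw [h] at h2; linarith
    rw [← Finset.card_image_of_injOn hinj]
    refine le_iSup₂_of_le (S.image f) ?_ le_rfl
    constructor
    · intro x hx
      simp only [Finset.mem_image] at hx
      obtain ⟨q, ⟨y, hy, rfl⟩, rfl⟩ := hx
      exact hf y hy right_mem_uIcc
    · intro x hx x' hx' hlt
      simp only [Finset.mem_image] at hx hx'
      obtain ⟨q, ⟨y, hy, rfl⟩, rfl⟩ := hx
      obtain ⟨q, ⟨y', hy', rfl⟩, rfl⟩ := hx'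
      rcases lt_trichotomy y y' with h | h | h
      · exact hmono y hy y' hy' h
      · subst h; exact absurd hlt (lt_irrefl _)
      · obtain ⟨z, h1, h2, _⟩ := hmono y' hy' y hy h
        linarith
  · apply iSup₂_le
    intro S hS
    rw [← Finset.card_image_of_injective S Rat.cast_injective (β := ℝ)]
    exact hS.card_le

lemma measurable_ncomp {G : Set (ℝ × ℝ)} (hG : IsOpen G) :
    Measurable (fun x : ℝ => ncomp {y | (x, y) ∈ G}) := by
  classical
  have hsl : ∀ x : ℝ, IsOpen {y | (x, y) ∈ G} := fun x =>
    hG.preimage (f := fun y : ℝ => (x, y)) (by fun_prop)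
  simp_rw [ncomp_rat (hsl _)]
  refine Measurable.iSup fun S => ?_
  have hset : MeasurableSet {x : ℝ | SepPts {y | (x, y) ∈ G} (S.image (fun q : ℚ => (q : ℝ)))} := by
    have : {x : ℝ | SepPts {y | (x, y) ∈ G} (S.image (fun q : ℚ => (q : ℝ)))} =
        (⋂ y ∈ S.image (fun q : ℚ => (q : ℝ)), {x : ℝ | (x, y) ∈ G}) ∩
        (⋂ y ∈ S.image (fun q : ℚ => (q : ℝ)), ⋂ y' ∈ S.image (fun q : ℚ => (q : ℝ)),
          ({x : ℝ | (x, y) ∈ G}ᶜ ∪ {x : ℝ | (x, y') ∈ G}ᶜ ∪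
          (if y < y' then {x : ℝ | ∀ z ∈ Icc y y', (x, z) ∈ G}ᶜ else univ))) := by
      ext x
      simp only [SepPts, mem_ofPred_eq, mem_inter_iff, mem_iInter, mem_union, mem_compl_iff]
      constructor
      · rintro ⟨h1, h2⟩
        refine ⟨h1, fun y hy y' hy' => ?_⟩
        right
        split_ifs with hlt
        · obtain ⟨z, a, b, hz⟩ := h2 y hy y' hy' hlt
          intro hall
          exact hz (hall z ⟨a.le, b.le⟩)
        · trivial
      · rintro ⟨h1, h2⟩
        refine ⟨h1, fun y hy y' hy' hlt => ?_⟩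
        have := h2 y hy y' hy'
        rw [if_pos hlt] at this
        rcases this with (h | h) | h
        · exact absurd (h1 y hy) h
        · exact absurd (h1 y' hy') h
        · simp only [mem_compl_iff, mem_ofPred_eq, not_forall] at h
          obtain ⟨z, hz, hzG⟩ := h
          refine ⟨z, lt_of_le_of_ne hz.1 ?_, lt_of_le_of_ne hz.2 ?_, hzG⟩
          · rintro rfl; exact hzG (h1 _ hy)
          · rintro rfl; exact hzG (h1 _ hy')
    rw [this]
    have hop : ∀ y : ℝ, MeasurableSet {x : ℝ | (x, y) ∈ G} := fun y =>
      (hG.preimage (f := fun x : ℝ => (x, y)) (by fun_prop)).measurableSet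
    have hop2 : ∀ y y' : ℝ, IsOpen {x : ℝ | ∀ z ∈ Icc y y', (x, z) ∈ G} := by
      intro y y'
      rw [isOpen_iff_mem_nhds]
      intro x hx
      obtain ⟨u, v, hu, hv, hxu, hyv, huv⟩ := generalized_tube_lemma (isCompact_singleton (x := x))
        (isCompact_Icc (a := y) (b := y')) hG (by
          rintro ⟨a, b⟩ ⟨ha, hb⟩
          have h1 : a = x := ha
          subst h1
          exact hx b hb)
      filter_upwards [hu.mem_nhds (hxu rfl)] with w hw z hz
      exact huv ⟨hw, hyv hz⟩
    refine MeasurableSet.inter ?_ ?_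
    · exact Finset.measurableSet_biInter _ fun y _ => hop y
    · refine Finset.measurableSet_biInter _ fun y _ => Finset.measurableSet_biInter _ fun y' _ => ?_
      refine ((hop y).compl.union (hop y').compl).union ?_
      split_ifs
      · exact (hop2 y y').measurableSet.compl
      · exact MeasurableSet.univ
  have : (fun x : ℝ => ⨆ (_ : SepPts {y | (x, y) ∈ G} (S.image (fun q : ℚ => (q : ℝ)))), (S.card : ℝ≥0∞)) =
      Set.indicator {x : ℝ | SepPts {y | (x, y) ∈ G} (S.image (fun q : ℚ => (q : ℝ)))}
        (fun _ => (S.card : ℝ≥0∞)) := by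
    ext x
    by_cases h : SepPts {y | (x, y) ∈ G} (S.image (fun q : ℚ => (q : ℝ)))
    · rw [Set.indicator_of_mem (by exact h)]; simp [h]
    · rw [Set.indicator_of_notMem (by exact h)]; simp [h]
  rw [this]
  exact measurable_const.indicator hset

/-- erosion of a subset of the line by a segment of length `s` loses at most `s` per component -/
lemma volume_le_erode {A : Set ℝ} (hb : BddAbove A) {s : ℝ} (hs : 0 < s) :
    volume A ≤ volume {y | ∀ τ ∈ Icc (0:ℝ) 1, y + τ * s ∈ A} + ENNReal.ofReal s * ncomp A := by
  by_cases hA : ncomp A = ∞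
  · rw [hA, ENNReal.mul_top (by simpa using hs)]; simp
  obtain ⟨S, hS, hc, hrep⟩ := ncomp_max hA
  have hsub : A ⊆ {y | ∀ τ ∈ Icc (0:ℝ) 1, y + τ * s ∈ A} ∪
      ⋃ y ∈ S, Icc (sSup {x | uIcc x y ⊆ A} - s) (sSup {x | uIcc x y ⊆ A}) := by
    intro x hx
    obtain ⟨y, hy, hxy⟩ := hrep x hx
    by_cases hlt : x + s < sSup {x | uIcc x y ⊆ A}
    · left
      obtain ⟨w, hw, hxw⟩ := exists_lt_of_lt_csSup ⟨x, hxy⟩ hlt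
      intro τ hτ
      have h1 : uIcc x w ⊆ A := by
        refine (uIcc_subset_uIcc_union_uIcc (b := y)).trans (union_subset hxy ?_)
        rw [uIcc_comm]; exact hw
      apply h1
      rw [mem_uIcc]
      left
      constructor
      · nlinarith [hτ.1]
      · nlinarith [hτ.2]
    · right
      simp only [mem_iUnion]
      refine ⟨y, hy, by linarith, ?_⟩
      apply le_csSup _ hxy
      obtain ⟨B, hB⟩ := hb
      exact ⟨B, fun z hz => hB (hz left_mem_uIcc)⟩
  calc volume A ≤ _ := measure_mono hsub
    _ ≤ _ := measure_union_le _ _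
    _ ≤ _ := by
      gcongr
      refine (measure_biUnion_finset_le _ _).trans ?_
      have : ∀ x ∈ S, volume (Icc (sSup {x_1 | uIcc x_1 x ⊆ A} - s) (sSup {x_1 | uIcc x_1 x ⊆ A})) = ENNReal.ofReal s := by
        intro x _
        rw [Real.volume_Icc]
        congr 1
        ring
      rw [Finset.sum_congr rfl this, Finset.sum_const, nsmul_eq_mul, hc, mul_comm]

/-! ### The combinatorial core: erosion does not increase the number of components -/

/-- a locally constant function on `K`, vanishing far away and at one given point, vanishes. -/
def QProp {X : Type*} [NormedAddCommGroup X] (K : Set X) : Prop :=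
  ∃ h : X, ∀ F : X → ℝ, (∀ z ∈ K, ∀ᶠ z' in 𝓝[K] z, F z' = F z) →
    (∃ M : ℝ, ∀ z ∈ K, M < ‖z‖ → F z = 0) → F h = 0 → ∀ z ∈ K, F z = 0

lemma exists_kernel {α β : Type*} (V : Finset α) (E : Finset β) (m : α → β → ℝ)
    (h : V.card < E.card) :
    ∃ a : β → ℝ, (∃ e ∈ E, a e ≠ 0) ∧ ∀ v ∈ V, ∑ e ∈ E, m v e * a e = 0 := by
  classical
  let L : (E → ℝ) →ₗ[ℝ] (V → ℝ) := Matrix.mulVecLin (Matrix.of fun (v : V) (e : E) => m v e)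
  have hk : LinearMap.ker L ≠ ⊥ := LinearMap.ker_ne_bot_of_finrank_lt (by simpa using h)
  obtain ⟨b, hb, hb0⟩ := Submodule.exists_mem_ne_zero_of_ne_bot hk
  refine ⟨fun e => if he : e ∈ E then b ⟨e, he⟩ else 0, ?_, ?_⟩
  · obtain ⟨e, he⟩ := Function.ne_iff.1 hb0
    exact ⟨e, e.2, by simpa using he⟩
  · intro v hv
    have := congrFun (LinearMap.mem_ker.1 hb) ⟨v, hv⟩
    simp only [L, Matrix.mulVecLin_apply, Matrix.mulVec, dotProduct, Matrix.of_apply, Pi.zero_apply] at this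
    rw [← this, ← Finset.sum_coe_sort E]
    refine Finset.sum_congr rfl fun e _ => ?_
    simp

lemma core_count {G : Set (ℝ × ℝ)} (hb : IsBounded G) (hQ : QProp Gᶜ) (q : ℝ)
    (V E : Finset (ℤ × ℝ)) (rep : ℤ → ℝ → ℝ)
    (hrep : ∀ (k : ℤ) (y : ℝ), (q + k, y) ∈ G → (k, rep k y) ∈ V ∧
      ∀ z ∈ uIcc y (rep k y), (q + k, z) ∈ G)
    (hE : ∀ e ∈ E, ∀ τ ∈ Icc (0:ℝ) 1, (q + e.1 + τ, e.2) ∈ G)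
    (hsep : ∀ (k : ℤ) (t t' : ℝ), (k, t) ∈ E → (k, t') ∈ E → t < t' →
      ∃ z, t < z ∧ z < t' ∧ ∃ τ ∈ Icc (0:ℝ) 1, (q + k + τ, z) ∉ G) :
    E.card ≤ V.card := by
  classical
  by_contra hlt
  push Not at hlt
  have hE0 : ∀ e ∈ E, (q + (e.1 : ℝ), e.2) ∈ G := fun e he => by
    simpa using hE e he 0 ⟨le_rfl, zero_le_one⟩
  have hE1 : ∀ e ∈ E, (q + ((e.1 + 1 : ℤ) : ℝ), e.2) ∈ G := fun e he => by
    have := hE e he 1 ⟨zero_le_one, le_rfl⟩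
    push_cast
    rwa [← add_assoc]
  obtain ⟨e0, he0⟩ : E.Nonempty := Finset.card_pos.1 (by omega)
  have hv0 := (hrep _ _ (hE0 e0 he0)).1
  set v0 : ℤ × ℝ := (e0.1, rep e0.1 e0.2) with hv0def
  obtain ⟨h, hQ⟩ := hQ
  obtain ⟨B, hB⟩ := hb.exists_norm_le
  have hB' : ∀ x y : ℝ, (x, y) ∈ G → |x| ≤ B ∧ |y| ≤ B := by
    intro x y hxy
    have := hB _ hxy
    rw [Prod.norm_def] at this
    exact ⟨(le_max_left _ _).trans this, (le_max_right _ _).trans this⟩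
  let Pt : ℤ × ℝ → ℤ × ℝ := fun e => (e.1 + 1, rep (e.1 + 1) e.2)
  let Qt : ℤ × ℝ → ℤ × ℝ := fun e => (e.1, rep e.1 e.2)
  have hPt : ∀ e ∈ E, Pt e ∈ V := fun e he => (hrep _ _ (hE1 e he)).1
  have hQt : ∀ e ∈ E, Qt e ∈ V := fun e he => (hrep _ _ (hE0 e he)).1
  let dl : ℤ × ℝ → ℤ × ℝ → ℝ := fun v e =>
    (if Pt e = v then (1:ℝ) else 0) - (if Qt e = v then (1:ℝ) else 0)
  let cf : ℤ → ℝ → ℤ × ℝ → ℝ := fun k y e => if e.1 = k ∧ e.2 < y then (1:ℝ) else 0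
  obtain ⟨a, ⟨e1, he1, ha1⟩, hker⟩ := exists_kernel V E
    (fun v e => if v = v0 then cf ⌊h.1 - q⌋ h.2 e else dl v e) hlt
  let C : ℤ → ℝ → ℝ := fun k y => ∑ e ∈ E, cf k y e * a e
  let F : ℝ × ℝ → ℝ := fun z => C ⌊z.1 - q⌋ z.2
  have hFh : F h = 0 := by
    have := hker v0 hv0
    simpa using this
  have hsumdl : ∀ w : ℤ × ℝ → ℝ, ∑ v ∈ V, w v * ∑ e ∈ E, dl v e * a e =
      ∑ e ∈ E, (w (Pt e) - w (Qt e)) * a e := by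
    intro w
    simp_rw [Finset.mul_sum]
    rw [Finset.sum_comm]
    refine Finset.sum_congr rfl fun e he => ?_
    have : ∀ v ∈ V, w v * (dl v e * a e) =
        (if Pt e = v then w v * a e else 0) - (if Qt e = v then w v * a e else 0) := by
      intro v _
      simp only [dl]
      split_ifs <;> ring
    rw [Finset.sum_congr rfl this, Finset.sum_sub_distrib, Finset.sum_ite_eq, Finset.sum_ite_eq,
      if_pos (hPt e he), if_pos (hQt e he)]
    ring
  have hdl' : ∀ v ∈ V, v ≠ v0 → ∑ e ∈ E, dl v e * a e = 0 := by
    intro v hv hne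
    have := hker v hv
    simpa [hne] using this
  have hdl0 : ∑ e ∈ E, dl v0 e * a e = 0 := by
    have h1 := hsumdl (fun _ => 1)
    simp only [one_mul, sub_self, zero_mul, Finset.sum_const_zero] at h1
    rwa [Finset.sum_eq_single_of_mem v0 hv0 hdl'] at h1
  have hdl : ∀ v ∈ V, ∑ e ∈ E, dl v e * a e = 0 := by
    intro v hv
    by_cases hne : v = v0
    · rw [hne]; exact hdl0
    · exact hdl' v hv hne
  -- line equality
  have hside : ∀ (k : ℤ) (y t : ℝ), (q + k, y) ∉ G → (q + k, t) ∈ G → (rep k t < y ↔ t < y) := by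
    intro k y t hy ht
    have := (hrep k t ht).2
    constructor
    · intro hr
      by_contra hh
      push Not at hh
      exact hy (this y (mem_uIcc.2 (Or.inr ⟨hr.le, hh⟩)))
    · intro hr
      by_contra hh
      push Not at hh
      exact hy (this y (mem_uIcc.2 (Or.inl ⟨hr.le, hh⟩)))
  have hline : ∀ (k : ℤ) (y : ℝ), (q + k, y) ∉ G → C (k - 1) y = C k y := by
    intro k y hy
    have h1 := hsumdl (fun v => if v.1 = k ∧ v.2 < y then 1 else 0)
    rw [Finset.sum_eq_zero (fun v hv => by rw [hdl v hv, mul_zero])] at h1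
    rw [← sub_eq_zero, h1]
    simp only [C]
    rw [← Finset.sum_sub_distrib]
    refine Finset.sum_congr rfl fun e he => ?_
    rw [← sub_mul]
    congr 2
    · simp only [cf, Pt]
      by_cases hk : e.1 + 1 = k
      · have h2 := hside k y e.2 hy (by rw [← hk]; exact hE1 e he)
        have : e.1 = k - 1 := by omega
        simp only [hk]
        exact if_congr (by simp [this, h2]) rfl rfl
      · have : ¬ e.1 = k - 1 := by omega
        simp [this, hk]
    · simp only [cf, Qt]
      by_cases hk : e.1 = k
      · have h2 := hside k y e.2 hy (by rw [← hk]; exact hE0 e he)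
        exact if_congr (by simp [hk, h2]) rfl rfl
      · simp [hk]
  -- far behaviour
  have hbig : ∀ (k : ℤ) (y : ℝ), B < y → C k y = ∑ e ∈ E, if e.1 = k then a e else 0 := by
    intro k y hy
    refine Finset.sum_congr rfl fun e he => ?_
    have : e.2 < y := lt_of_le_of_lt ((le_abs_self _).trans (hB' _ _ (hE0 e he)).2) hy
    simp [cf, this]
  have hck : ∀ k : ℤ, (∑ e ∈ E, if e.1 = k then a e else 0) = 0 := by
    have hst : ∀ k : ℤ, (∑ e ∈ E, if e.1 = k - 1 then a e else 0) =
        ∑ e ∈ E, if e.1 = k then a e else 0 := by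
      intro k
      rw [← hbig (k-1) (B+1) (by linarith), ← hbig k (B+1) (by linarith)]
      apply hline
      intro hG
      have := (le_abs_self _).trans (hB' _ _ hG).2
      linarith
    have hn : ∀ (n : ℕ) (k : ℤ), (∑ e ∈ E, if e.1 = k - n then a e else 0) =
        ∑ e ∈ E, if e.1 = k then a e else 0 := by
      intro n
      induction n with
      | zero => intro k; simp
      | succ n ih =>
        intro k
        rw [← ih k, ← hst (k - n)]
        have : k - ((n + 1 : ℕ) : ℤ) = k - n - 1 := by push_cast; ring
        rw [this]
    intro k
    obtain ⟨m, hm⟩ : ∃ m : ℤ, ∀ e ∈ E, m < e.1 := by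
      refine ⟨⌊-B - q⌋ - 1, fun e he => ?_⟩
      have h1 := (abs_le.1 (hB' _ _ (hE0 e he)).1).1
      have : ⌊-B - q⌋ ≤ e.1 := by
        have h2 := Int.floor_le (-B - q)
        have : ((⌊-B - q⌋ : ℤ) : ℝ) ≤ (e.1 : ℝ) := by linarith
        exact_mod_cast this
      omega
    rw [← hn (k - m).toNat k]
    refine Finset.sum_eq_zero fun e he => ?_
    have := hm e he
    rw [if_neg]
    omega
  have hfar : ∃ M : ℝ, ∀ z ∈ Gᶜ, M < ‖z‖ → F z = 0 := by
    refine ⟨B, ?_⟩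
    rintro ⟨x, y⟩ - hz
    rw [Prod.norm_def, lt_max_iff] at hz
    simp only [Real.norm_eq_abs] at hz
    by_cases hx : B < |x|
    · refine Finset.sum_eq_zero fun e he => ?_
      have : ¬ e.1 = ⌊x - q⌋ := by
        intro hk
        have h1 := Int.floor_le (x - q)
        have h2 := Int.lt_floor_add_one (x - q)
        rw [← hk] at h1 h2
        have h3 := abs_le.1 (hB' _ _ (hE0 e he)).1
        have h4 := abs_le.1 (hB' _ _ (hE1 e he)).1
        push_cast at h4
        have : |x| ≤ B := abs_le.2 ⟨by linarith [h3.1], by linarith [h4.2]⟩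
        linarith
      simp [cf, this]
    · have hy : B < |y| := by tauto
      rcases lt_abs.1 hy with hy | hy
      · show C _ y = 0
        rw [hbig _ _ hy, hck]
      · refine Finset.sum_eq_zero fun e he => ?_
        have h1 := (abs_le.1 (hB' _ _ (hE0 e he)).2).1
        have : ¬ e.2 < y := by push Not; linarith
        simp [cf, this]
  -- locally constant
  have hCloc : ∀ (k : ℤ) (y y' : ℝ), (∀ e ∈ E, e.1 = k → e.2 ≠ y) →
      (∀ e ∈ E, e.2 ≠ y → (e.2 < y' ↔ e.2 < y)) → C k y' = C k y := by
    intro k y y' h1 h2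
    refine Finset.sum_congr rfl fun e he => ?_
    by_cases hk : e.1 = k
    · have h3 := h2 e he (h1 e he hk)
      simp only [cf]
      congr 1
      exact if_congr (by rw [h3]) rfl rfl
    · simp [cf, hk]
  have hFloc : ∀ z ∈ Gᶜ, ∀ᶠ z' in 𝓝[Gᶜ] z, F z' = F z := by
    rintro ⟨x, y⟩ hz
    apply Filter.Eventually.filter_mono nhdsWithin_le_nhds
    have hy : ∀ᶠ y' in 𝓝 y, ∀ e ∈ E, e.2 ≠ y → (e.2 < y' ↔ e.2 < y) := by
      rw [Filter.eventually_all_finset]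
      intro e _
      by_cases hey : e.2 = y
      · simp [hey]
      · rcases lt_or_gt_of_ne hey with hl | hl
        · filter_upwards [lt_mem_nhds hl] with y' hy' _
          exact ⟨fun _ => hl, fun _ => hy'⟩
        · filter_upwards [gt_mem_nhds hl] with y' hy' _
          exact ⟨fun hh => absurd hh (not_lt.2 hy'.le), fun hh => absurd hh (not_lt.2 hl.le)⟩
    have hx : ∀ᶠ x' in 𝓝 x, ⌊x' - q⌋ = ⌊x - q⌋ ∨ (x = q + ⌊x - q⌋ ∧ ⌊x' - q⌋ = ⌊x - q⌋ - 1) := by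
      have h1 := Int.floor_le (x - q)
      have h2 := Int.lt_floor_add_one (x - q)
      rcases h1.lt_or_eq with h1 | h1
      · have a1 : q + ⌊x - q⌋ < x := by linarith
        have a2 : x < q + ⌊x - q⌋ + 1 := by linarith
        filter_upwards [lt_mem_nhds a1, gt_mem_nhds a2] with x' b1 b2
        left
        rw [Int.floor_eq_iff]
        constructor <;> linarith
      · have a1 : q + ⌊x - q⌋ - 1 < x := by linarith
        have a2 : x < q + ⌊x - q⌋ + 1 := by linarith
        filter_upwards [lt_mem_nhds a1, gt_mem_nhds a2] with x' b1 b2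
        by_cases hx' : q + ⌊x - q⌋ ≤ x'
        · left
          rw [Int.floor_eq_iff]
          constructor <;> linarith
        · right
          push Not at hx'
          refine ⟨by linarith, ?_⟩
          rw [Int.floor_eq_iff]
          push_cast
          constructor <;> linarith
    have hxy := hx.prod_nhds hy
    filter_upwards [hxy] with z' hz'
    obtain ⟨h1, h2⟩ := hz'
    have hne : ∀ e ∈ E, e.1 = ⌊x - q⌋ → e.2 ≠ y := by
      intro e he hk hey
      apply hz
      have := hE e he (x - q - ⌊x - q⌋) ⟨by linarith [Int.floor_le (x - q)],
        by linarith [Int.lt_floor_add_one (x - q)]⟩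
      rw [hk, hey] at this
      convert this using 2
      ring
    show C ⌊z'.1 - q⌋ z'.2 = C ⌊x - q⌋ y
    rcases h1 with h1 | ⟨h1, h3⟩
    · rw [h1]
      exact hCloc _ _ _ hne h2
    · rw [h3, ← hline ⌊x - q⌋ y (by rw [← h1]; exact hz)]
      refine hCloc _ _ _ ?_ h2
      intro e he hk hey
      apply hz
      have := hE1 e he
      rw [hk, hey] at this
      convert this using 2
      rw [sub_add_cancel]
      exact h1
  have hF0 := hQ F hFloc hfar hFh
  have hC0 : ∀ (k : ℤ) (y τ : ℝ), τ ∈ Icc (0:ℝ) 1 → (q + k + τ, y) ∉ G → C k y = 0 := by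
    intro k y τ hτ hG
    have h1 := hF0 _ hG
    rcases hτ.2.lt_or_eq with h2 | h2
    · have : ⌊q + k + τ - q⌋ = k := by
        rw [Int.floor_eq_iff]
        constructor <;> linarith [hτ.1]
      simp only [F, this] at h1
      exact h1
    · subst h2
      have : ⌊q + k + 1 - q⌋ = k + 1 := by
        rw [Int.floor_eq_iff]
        push_cast
        constructor <;> linarith
      simp only [F, this] at h1
      rw [← h1]
      have := hline (k + 1) y (by push_cast; rwa [← add_assoc])
      rw [← this]
      congr 1
      ring
  obtain ⟨e2, he2, hmin⟩ := Finset.exists_min_image (E.filter (fun e => e.1 = e1.1 ∧ a e ≠ 0)) Prod.snd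
    ⟨e1, by simp [he1, ha1]⟩
  simp only [Finset.mem_filter] at he2 hmin
  obtain ⟨he2, hk2, ha2⟩ := he2
  have hy : ∃ y, e2.2 < y ∧ (∀ e ∈ E, e.1 = e2.1 → e.2 < y → e.2 ≤ e2.2) ∧
      ∃ τ ∈ Icc (0:ℝ) 1, (q + e2.1 + τ, y) ∉ G := by
    by_cases hnx : (E.filter (fun e => e.1 = e2.1 ∧ e2.2 < e.2)).Nonempty
    · obtain ⟨e3, he3, hmin3⟩ := Finset.exists_min_image _ Prod.snd hnx
      simp only [Finset.mem_filter] at he3 hmin3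
      obtain ⟨z, z1, z2, z3⟩ := hsep e2.1 e2.2 e3.2 he2 (by rw [← he3.2.1]; exact he3.1) he3.2.2
      refine ⟨z, z1, ?_, z3⟩
      intro e he hke hlt
      by_contra hh
      push Not at hh
      have := hmin3 e ⟨he, hke, hh⟩
      linarith
    · have hb2 : e2.2 ≤ B := (le_abs_self _).trans (hB' _ _ (hE0 e2 he2)).2
      refine ⟨B + 1, by linarith, ?_, 0, ⟨le_rfl, zero_le_one⟩, ?_⟩
      · intro e he hke _
        by_contra hh
        push Not at hh
        exact hnx ⟨e, by simp [he, hke, hh]⟩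
      · intro hG
        have := (le_abs_self _).trans (hB' _ _ hG).2
        linarith
  obtain ⟨y, hy1, hy2, τ, hτ, hyG⟩ := hy
  have := hC0 e2.1 y τ hτ hyG
  simp only [C] at this
  rw [Finset.sum_eq_single_of_mem e2 he2] at this
  · simp [cf, hy1, ha2] at this
  · intro e he hne
    by_cases hc : e.1 = e2.1 ∧ e.2 < y
    · have h1 := hy2 e he hc.1 hc.2
      have : a e = 0 := by
        by_contra hae
        have h2 := hmin e ⟨he, hc.1.trans hk2, hae⟩
        exact hne (Prod.ext hc.1 (le_antisymm h1 h2))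
      rw [this, mul_zero]
    · simp [cf, hc]

lemma core_tsum {G : Set (ℝ × ℝ)} (hb : IsBounded G) (hQ : QProp Gᶜ) (q : ℝ) :
    ∑' k : ℤ, ncomp {y | ∀ τ ∈ Icc (0:ℝ) 1, (q + k + τ, y) ∈ G} ≤
      ∑' k : ℤ, ncomp {y | (q + k, y) ∈ G} := by
  classical
  by_cases hinf : ∑' k : ℤ, ncomp {y | (q + k, y) ∈ G} = ∞
  · rw [hinf]; exact le_top
  have hfin : ∀ k : ℤ, ncomp {y | (q + k, y) ∈ G} ≠ ∞ := ENNReal.ne_top_of_tsum_ne_top hinf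
  have hm := fun k => ncomp_max (hfin k)
  choose S hS hSc hSr using hm
  choose! rep hrS hrI using hSr
  obtain ⟨B, hB⟩ := hb.exists_norm_le
  let J : Finset ℤ := Finset.Icc ⌊-B - q⌋ ⌈B - q⌉
  have hJ : ∀ (k : ℤ) (y : ℝ), (q + k, y) ∈ G → k ∈ J := by
    intro k y hky
    have := hB _ hky
    rw [Prod.norm_def] at this
    have h1 := abs_le.1 ((le_max_left _ _).trans this)
    simp only at h1
    rw [Finset.mem_Icc]
    constructor
    · have h2 := Int.floor_le (-B - q)
      have : ((⌊-B - q⌋ : ℤ) : ℝ) ≤ (k : ℝ) := by linarith [h1.1]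
      exact_mod_cast this
    · have h2 := Int.le_ceil (B - q)
      have : (k : ℝ) ≤ ((⌈B - q⌉ : ℤ) : ℝ) := by linarith [h1.2]
      exact_mod_cast this
  let toF : Finset ℤ → (ℤ → Finset ℝ) → Finset (ℤ × ℝ) := fun I T =>
    I.biUnion fun k => (T k).image fun t => (k, t)
  have hmem : ∀ I T (e : ℤ × ℝ), e ∈ toF I T ↔ e.1 ∈ I ∧ e.2 ∈ T e.1 := by
    intro I T e
    simp only [toF, Finset.mem_biUnion, Finset.mem_image]
    constructor
    · rintro ⟨k, hk, t, ht, rfl⟩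
      exact ⟨hk, ht⟩
    · rintro ⟨h1, h2⟩
      exact ⟨e.1, h1, e.2, h2, rfl⟩
  have hcard : ∀ I T, (toF I T).card = ∑ k ∈ I, (T k).card := by
    intro I T
    rw [Finset.card_biUnion]
    · refine Finset.sum_congr rfl fun k _ => ?_
      rw [Finset.card_image_of_injective]
      intro t t' h
      simpa using h
    · intro k _ k' _ hne
      rw [Function.onFun, Finset.disjoint_left]
      intro e he he'
      simp only [Finset.mem_image] at he he'
      obtain ⟨t, _, rfl⟩ := he
      obtain ⟨t', _, h⟩ := he'
      exact hne (by simpa using (congrArg Prod.fst h).symm)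
  have key : ∀ (I : Finset ℤ) (T : ℤ → Finset ℝ),
      (∀ k ∈ I, SepPts {y | ∀ τ ∈ Icc (0:ℝ) 1, (q + k + τ, y) ∈ G} (T k)) →
      ∑ k ∈ I, ((T k).card : ℝ≥0∞) ≤ ∑' k : ℤ, ncomp {y | (q + k, y) ∈ G} := by
    intro I T hT
    have h1 : (toF I T).card ≤ (toF J S).card := by
      refine core_count hb hQ q (toF J S) (toF I T) rep ?_ ?_ ?_
      · intro k y hky
        exact ⟨(hmem _ _ _).2 ⟨hJ k y hky, hrS k y hky⟩, fun z hz => hrI k y hky hz⟩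
      · intro e he
        rw [hmem] at he
        exact (hT e.1 he.1).1 e.2 he.2
      · intro k t t' ht ht' hlt
        rw [hmem] at ht ht'
        obtain ⟨z, z1, z2, z3⟩ := (hT k ht.1).2 t ht.2 t' ht'.2 hlt
        refine ⟨z, z1, z2, ?_⟩
        simp only [mem_ofPred_eq, not_forall] at z3
        obtain ⟨τ, hτ, hh⟩ := z3
        exact ⟨τ, hτ, hh⟩
    rw [hcard, hcard] at h1
    calc ∑ k ∈ I, ((T k).card : ℝ≥0∞) = ((∑ k ∈ I, (T k).card : ℕ) : ℝ≥0∞) := by push_cast; rfl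
      _ ≤ ((∑ k ∈ J, (S k).card : ℕ) : ℝ≥0∞) := by exact_mod_cast h1
      _ = ∑ k ∈ J, ncomp {y | (q + k, y) ∈ G} := by
        push_cast
        exact Finset.sum_congr rfl fun k _ => hSc k
      _ ≤ _ := ENNReal.sum_le_tsum J
  have hfinE : ∀ k : ℤ, ncomp {y | ∀ τ ∈ Icc (0:ℝ) 1, (q + k + τ, y) ∈ G} ≠ ∞ := by
    intro k
    refine ne_top_of_le_ne_top hinf ?_
    refine iSup₂_le fun T hT => ?_
    have := key {k} (fun _ => T) (by simpa using hT)
    simpa using this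
  have hm2 := fun k => ncomp_max (hfinE k)
  choose T hT hTc _ using hm2
  rw [ENNReal.tsum_eq_iSup_sum]
  refine iSup_le fun I => ?_
  have := key I T (fun k _ => hT k)
  calc _ = ∑ k ∈ I, ((T k).card : ℝ≥0∞) := Finset.sum_congr rfl fun k _ => (hTc k).symm
    _ ≤ _ := this

/-! ### Planar erosion -/

/-- rotation by a right angle (clockwise convention irrelevant) -/
noncomputable def perp (v : E2) : E2 := !₂[-v 1, v 0]

@[simp] lemma perp_zero (v : E2) : perp v 0 = - v 1 := rfl
@[simp] lemma perp_one (v : E2) : perp v 1 = v 0 := rfl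

lemma norm_sq_E2 (v : E2) : ‖v‖ ^ 2 = v 0 ^ 2 + v 1 ^ 2 := by
  rw [EuclideanSpace.norm_sq_eq]; simp

lemma unit_sq {v : E2} (hv : ‖v‖ = 1) : v 0 ^ 2 + v 1 ^ 2 = 1 := by
  rw [← norm_sq_E2, hv]; norm_num

/-- coordinates adapted to the direction `v` -/
noncomputable def phi (v : E2) (z : ℝ × ℝ) : E2 := z.1 • perp v + z.2 • v

lemma continuous_phi (v : E2) : Continuous (phi v) := by unfold phi; fun_prop

noncomputable def rotIso (v : E2) (hv : ‖v‖ = 1) : E2 →ₗᵢ[ℝ] E2 where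
  toFun x := x 0 • perp v + x 1 • v
  map_add' x y := by
    ext i; simp; ring
  map_smul' c x := by
    ext i; simp; ring
  norm_map' x := by
    have h := unit_sq hv
    have : ‖x 0 • perp v + x 1 • v‖ ^ 2 = ‖x‖ ^ 2 := by
      rw [norm_sq_E2, norm_sq_E2]
      simp only [PiLp.add_apply, PiLp.smul_apply, perp_zero, perp_one, smul_eq_mul]
      linear_combination (x 0 ^ 2 + x 1 ^ 2) * h
    exact (sq_eq_sq₀ (norm_nonneg _) (norm_nonneg _)).1 this

noncomputable def phiEquiv (v : E2) (hv : ‖v‖ = 1) : ℝ × ℝ ≃ᵐ E2 :=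
  (MeasurableEquiv.finTwoArrow.symm.trans (MeasurableEquiv.toLp 2 (Fin 2 → ℝ))).trans
    ((rotIso v hv).toLinearIsometryEquiv rfl).toHomeomorph.toMeasurableEquiv

lemma phiEquiv_apply (v : E2) (hv : ‖v‖ = 1) (z : ℝ × ℝ) : phiEquiv v hv z = phi v z := rfl

lemma phi_mp (v : E2) (hv : ‖v‖ = 1) : MeasurePreserving (phi v) (volume : Measure (ℝ × ℝ)) volume := by
  have h1 := (volume_preserving_finTwoArrow ℝ).symm
  have h2 := (EuclideanSpace.volume_preserving_symm_measurableEquiv_toLp (Fin 2)).symm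
  have h3 := ((rotIso v hv).toLinearIsometryEquiv rfl).measurePreserving
  exact (h3.comp h2).comp h1

lemma phi_emb (v : E2) (hv : ‖v‖ = 1) : MeasurableEmbedding (phi v) :=
  (phiEquiv v hv).measurableEmbedding

/-- integrated number of components of the slices of `Ω` in direction `v` -/
noncomputable def W (Ω : Set E2) (v : E2) : ℝ≥0∞ := ∫⁻ p : ℝ, ncomp {y : ℝ | p • perp v + y • v ∈ Ω}

/-- erosion by the segment `[0,u]` -/
def Er (Ω : Set E2) (u : E2) : Set E2 := {x | ∀ τ ∈ Icc (0:ℝ) 1, x + τ • u ∈ Ω}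

lemma Er_subset (Ω : Set E2) (u : E2) : Er Ω u ⊆ Ω := by
  intro x hx
  simpa using hx 0 ⟨le_rfl, zero_le_one⟩

lemma isOpen_Er {Ω : Set E2} (hΩ : IsOpen Ω) (u : E2) : IsOpen (Er Ω u) := by
  rw [isOpen_iff_mem_nhds]
  intro x hx
  have hG : IsOpen ((fun z : E2 × ℝ => z.1 + z.2 • u) ⁻¹' Ω) := hΩ.preimage (by fun_prop)
  obtain ⟨U, V, hU, hV, hxU, hyV, hUV⟩ := generalized_tube_lemma (isCompact_singleton (x := x))
    (isCompact_Icc (a := (0:ℝ)) (b := 1)) hG (by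
      rintro ⟨a, b⟩ ⟨ha, hb⟩
      have h1 : a = x := ha
      subst h1
      exact hx b hb)
  filter_upwards [hU.mem_nhds (hxU rfl)] with w hw z hz
  exact hUV (show (w, z) ∈ U ×ˢ V from ⟨hw, hyV hz⟩)

lemma volume_eq_slices {Ω : Set E2} (hΩ : MeasurableSet Ω) {v : E2} (hv : ‖v‖ = 1) :
    volume Ω = ∫⁻ p : ℝ, volume {y : ℝ | p • perp v + y • v ∈ Ω} := by
  rw [← (phi_mp v hv).measure_preimage hΩ.nullMeasurableSet, Measure.volume_eq_prod,
    Measure.prod_apply ((phi_mp v hv).measurable hΩ)]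
  rfl

lemma norm_le_phi_snd {v : E2} (hv : ‖v‖ = 1) (p y : ℝ) : |y| ≤ ‖p • perp v + y • v‖ := by
  have h := unit_sq hv
  rw [← sq_le_sq₀ (abs_nonneg _) (norm_nonneg _), norm_sq_E2, sq_abs]
  simp only [PiLp.add_apply, PiLp.smul_apply, perp_zero, perp_one, smul_eq_mul]
  nlinarith [sq_nonneg p]

lemma S1 {Ω : Set E2} (hΩ : IsOpen Ω) (hb : IsBounded Ω) {v : E2} (hv : ‖v‖ = 1) {s : ℝ} (hs : 0 < s) :
    volume Ω ≤ volume (Er Ω (s • v)) + ENNReal.ofReal s * W Ω v := by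
  rw [volume_eq_slices hΩ.measurableSet hv, volume_eq_slices (isOpen_Er hΩ _).measurableSet hv, W,
    ← lintegral_const_mul' _ _ ENNReal.ofReal_ne_top, ← lintegral_add_left]
  · apply lintegral_mono
    intro p
    refine (volume_le_erode ?_ hs).trans_eq ?_
    · obtain ⟨B, hB⟩ := hb.exists_norm_le
      exact ⟨B, fun y hy => (le_abs_self y).trans ((norm_le_phi_snd hv p y).trans (hB _ hy))⟩
    · congr 2
      ext y
      simp only [Er, mem_ofPred_eq]
      refine forall₂_congr fun τ _ => ?_
      rw [add_smul, smul_smul, add_assoc]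
  · have := measurable_measure_prodMk_left (ν := (volume : Measure ℝ))
      ((phi_mp v hv).measurable (isOpen_Er hΩ (s • v)).measurableSet)
    exact this

lemma lintegral_scale {f : ℝ → ℝ≥0∞} (hf : Measurable f) {α : ℝ} (hα : α ≠ 0) :
    ∫⁻ p, f p = ENNReal.ofReal |α| * ∫⁻ a, f (α * a) := by
  conv_lhs => rw [← Real.smul_map_volume_mul_left hα]
  rw [lintegral_smul_measure, lintegral_map hf (by fun_prop)]
  rfl

lemma lintegral_unit {f : ℝ → ℝ≥0∞} (hf : Measurable f) :
    ∫⁻ p, f p = ∫⁻ q in Ico (0:ℝ) 1, ∑' k : ℤ, f (q + k) := by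
  rw [lintegral_tsum (fun k : ℤ => (show Measurable (fun q : ℝ => f (q + (k:ℝ))) from hf.comp (measurable_id.add_const _)).aemeasurable)]
  rw [← setLIntegral_univ, ← iUnion_Ico_intCast ℝ, lintegral_iUnion]
  · congr 1
    ext k
    have h := (measurePreserving_add_right (volume : Measure ℝ) (k : ℝ)).setLIntegral_comp_preimage
      (s := Ico (k:ℝ) (k+1)) measurableSet_Ico hf
    rw [← h]
    congr 2
    ext x
    simp only [mem_preimage, mem_Ico]
    constructor
    · rintro ⟨h1, h2⟩; constructor <;> linarith
    · rintro ⟨h1, h2⟩; constructor <;> linarith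
  · intro k; exact measurableSet_Ico
  · exact pairwise_disjoint_Ico_intCast ℝ

lemma QProp_preimage {X Y : Type*} [NormedAddCommGroup X] [NormedSpace ℝ X] [NormedAddCommGroup Y]
    [NormedSpace ℝ Y] (L : X ≃L[ℝ] Y) {K : Set Y} (hK : QProp K) : QProp (L ⁻¹' K) := by
  obtain ⟨h, hK⟩ := hK
  refine ⟨L.symm h, fun F hF ⟨M, hM⟩ hh z hz => ?_⟩
  have := hK (F ∘ L.symm) ?_ ⟨‖(L : X →L[ℝ] Y)‖ * |M|, ?_⟩ hh (L z) hz
  · simpa using this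
  · intro y hy
    have h1 := hF (L.symm y) (by simpa using hy)
    have h2 : Tendsto L.symm (𝓝[K] y) (𝓝[L ⁻¹' K] (L.symm y)) := by
      apply ContinuousWithinAt.tendsto_nhdsWithin L.symm.continuous.continuousWithinAt
      intro w hw
      simpa using hw
    exact h2.eventually h1
  · intro y hy hlt
    apply hM _ (by simpa using hy)
    have h1 : ‖y‖ ≤ ‖(L : X →L[ℝ] Y)‖ * ‖L.symm y‖ := by
      have := (L : X →L[ℝ] Y).le_opNorm (L.symm y)
      simpa using this
    have h2 := lt_of_lt_of_le hlt h1
    exact (le_abs_self M).trans_lt (lt_of_mul_lt_mul_left h2 (norm_nonneg _))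

lemma const_of_preconn {X : Type*} [TopologicalSpace X] {C : Set X} (hC : IsPreconnected C) {F : X → ℝ}
    (hF : ∀ z ∈ C, ∀ᶠ z' in 𝓝[C] z, F z' = F z) {x y : X} (hx : x ∈ C) (hy : y ∈ C) : F x = F y := by
  have := isPreconnected_iff_preconnectedSpace.1 hC
  have hl : IsLocallyConstant (fun z : C => F z) := by
    rw [IsLocallyConstant.iff_eventually_eq]
    intro z
    have h1 := hF z z.2
    rw [nhdsWithin_eq_map_subtype_coe z.2] at h1
    exact h1
  exact hl.apply_eq_of_preconnectedSpace ⟨x, hx⟩ ⟨y, hy⟩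

lemma QProp_Er {Ω : Set E2} (hQ : QProp Ωᶜ) (u : E2) : QProp (Er Ω u)ᶜ := by
  obtain ⟨h, hQ⟩ := hQ
  refine ⟨h, fun F hF ⟨M, hM⟩ hh => ?_⟩
  have hsub : Ωᶜ ⊆ (Er Ω u)ᶜ := compl_subset_compl.2 (Er_subset Ω u)
  have h0 := hQ F (fun z hz => (hF z (hsub hz)).filter_mono (nhdsWithin_mono _ hsub))
    ⟨M, fun z hz => hM z (hsub hz)⟩ hh
  intro z hz
  simp only [Er, mem_compl_iff, mem_ofPred_eq, not_forall] at hz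
  obtain ⟨τ, hτ, hzτ⟩ := hz
  have hseg : ∀ σ ∈ Icc (0:ℝ) τ, z + σ • u ∈ (Er Ω u)ᶜ := by
    intro σ hσ hmem
    have := hmem (τ - σ) ⟨by linarith [hσ.2], by linarith [hσ.1, hτ.2]⟩
    rw [add_assoc, ← add_smul] at this
    simp only [add_sub_cancel] at this
    exact hzτ this
  have hconn : IsPreconnected ((fun σ : ℝ => z + σ • u) '' Icc 0 τ) :=
    isPreconnected_Icc.image _ (by fun_prop)
  have hsub2 : (fun σ : ℝ => z + σ • u) '' Icc 0 τ ⊆ (Er Ω u)ᶜ := by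
    rintro _ ⟨σ, hσ, rfl⟩; exact hseg σ hσ
  have := const_of_preconn hconn (F := F)
    (fun w hw => (hF w (hsub2 hw)).filter_mono (nhdsWithin_mono _ hsub2))
    (x := z) (y := z + τ • u) ⟨0, ⟨le_rfl, hτ.1⟩, by simp⟩ ⟨τ, ⟨hτ.1, le_rfl⟩, rfl⟩
  rw [this]
  exact h0 _ hzτ

/-- plane coordinates w.r.t. a pair of independent vectors -/
noncomputable def linPair (u v : E2) (h : u 0 * v 1 - u 1 * v 0 ≠ 0) : (ℝ × ℝ) ≃ₗ[ℝ] E2 where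
  toFun z := z.1 • u + z.2 • v
  map_add' x y := by simp only [Prod.fst_add, Prod.snd_add, add_smul]; abel
  map_smul' c x := by simp [smul_smul]
  invFun x := ((x 0 * v 1 - x 1 * v 0) / (u 0 * v 1 - u 1 * v 0),
    (u 0 * x 1 - u 1 * x 0) / (u 0 * v 1 - u 1 * v 0))
  left_inv z := by
    ext
    · simp only [PiLp.add_apply, PiLp.smul_apply, smul_eq_mul]
      rw [div_eq_iff h]; ring
    · simp only [PiLp.add_apply, PiLp.smul_apply, smul_eq_mul]
      rw [div_eq_iff h]; ring
  right_inv x := by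
    ext i
    fin_cases i
    · simp only [PiLp.add_apply, PiLp.smul_apply, smul_eq_mul, Fin.zero_eta]
      rw [div_mul_eq_mul_div, div_mul_eq_mul_div, ← add_div, div_eq_iff h]; ring
    · simp only [PiLp.add_apply, PiLp.smul_apply, smul_eq_mul, Fin.mk_one]
      rw [div_mul_eq_mul_div, div_mul_eq_mul_div, ← add_div, div_eq_iff h]; ring

lemma W_eq {Ω : Set E2} (hΩ : IsOpen Ω) {v u : E2} (hv : ‖v‖ = 1) (hc : u 0 * v 1 - u 1 * v 0 ≠ 0) :
    W Ω v = ENNReal.ofReal |u 0 * v 1 - u 1 * v 0| * ∫⁻ a : ℝ, ncomp {y : ℝ | a • u + y • v ∈ Ω} := by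
  have h := unit_sq hv
  set α := -(u 0 * v 1 - u 1 * v 0) with hα
  have hα0 : α ≠ 0 := neg_ne_zero.2 hc
  have hu : u = α • perp v + (u 0 * v 0 + u 1 * v 1) • v := by
    ext i
    fin_cases i
    · simp [hα]; linear_combination (- u 0) * h
    · simp [hα]; linear_combination (- u 1) * h
  have hG : IsOpen (phi v ⁻¹' Ω) := hΩ.preimage (continuous_phi v)
  have hm := measurable_ncomp hG
  have : W Ω v = ∫⁻ p : ℝ, ncomp {y | (p, y) ∈ phi v ⁻¹' Ω} := rfl
  rw [this, lintegral_scale hm hα0, hα, abs_neg]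
  congr 1
  apply lintegral_congr
  intro a
  rw [← ncomp_shift _ (a * (u 0 * v 0 + u 1 * v 1))]
  congr 1
  ext y
  simp only [mem_ofPred_eq, mem_preimage, phi]
  rw [← hα]
  have : a • u + y • v = (α * a) • perp v + (y + a * (u 0 * v 0 + u 1 * v 1)) • v := by
    conv_lhs => rw [hu]
    module
  rw [this]

set_option maxHeartbeats 1000000 in
lemma S2 {Ω : Set E2} (hΩ : IsOpen Ω) (hb : IsBounded Ω) (hQ : QProp Ωᶜ) {v u : E2} (hv : ‖v‖ = 1)
    (hc : u 0 * v 1 - u 1 * v 0 ≠ 0) : W (Er Ω u) v ≤ W Ω v := by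
  rw [W_eq hΩ hv hc, W_eq (isOpen_Er hΩ u) hv hc]
  refine mul_le_mul_right ?_ _
  obtain ⟨L, hL⟩ : ∃ L : (ℝ × ℝ) ≃L[ℝ] E2, ∀ a b : ℝ, L (a, b) = a • u + b • v :=
    ⟨(linPair u v hc).toContinuousLinearEquiv, fun a b => rfl⟩
  have hGo : IsOpen (L ⁻¹' Ω) := hΩ.preimage L.continuous
  have hGb : IsBounded (L ⁻¹' Ω) := by
    have : L ⁻¹' Ω = L.symm '' Ω := (L.symm.image_eq_preimage_symm Ω).symm
    rw [this]
    exact hb.image (L.symm : E2 →L[ℝ] ℝ × ℝ)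
  have hGQ : QProp (L ⁻¹' Ω)ᶜ := by
    rw [← preimage_compl]; exact QProp_preimage L hQ
  have hm1 := measurable_ncomp hGo
  have hm2 := measurable_ncomp ((isOpen_Er hΩ u).preimage L.continuous)
  have e1 : ∀ a, {y : ℝ | a • u + y • v ∈ Ω} = {y | (a, y) ∈ L ⁻¹' Ω} := fun a => by
    ext y; simp [hL]
  have e2 : ∀ a, {y : ℝ | a • u + y • v ∈ Er Ω u} = {y | (a, y) ∈ L ⁻¹' Er Ω u} := fun a => by
    ext y; simp [hL]
  simp_rw [e1, e2]
  rw [lintegral_unit hm1, lintegral_unit hm2]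
  apply lintegral_mono
  intro q
  refine le_trans (le_of_eq ?_) (core_tsum hGb hGQ q)
  refine tsum_congr fun k => congrArg ncomp ?_
  ext y
  simp only [mem_ofPred_eq, mem_preimage, Er, hL]
  refine forall₂_congr fun τ _ => ?_
  rw [add_smul _ τ, add_right_comm]

/-- iterated erosion -/
def ErN (Ω : Set E2) (u : ℕ → E2) : ℕ → Set E2
  | 0 => Ω
  | n + 1 => Er (ErN Ω u n) (u n)

lemma ErN_props {Ω : Set E2} (hΩ : IsOpen Ω) (hb : IsBounded Ω) (hQ : QProp Ωᶜ) (u : ℕ → E2) (n : ℕ) :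
    IsOpen (ErN Ω u n) ∧ IsBounded (ErN Ω u n) ∧ QProp (ErN Ω u n)ᶜ := by
  induction n with
  | zero => exact ⟨hΩ, hb, hQ⟩
  | succ n ih =>
    exact ⟨isOpen_Er ih.1 _, ih.2.1.subset (Er_subset _ _), QProp_Er ih.2.2 _⟩

lemma W_ErN {Ω : Set E2} (hΩ : IsOpen Ω) (hb : IsBounded Ω) (hQ : QProp Ωᶜ) (u : ℕ → E2) (n : ℕ)
    {v : E2} (hv : ‖v‖ = 1) (hc : ∀ j < n, u j 0 * v 1 - u j 1 * v 0 ≠ 0) :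
    W (ErN Ω u n) v ≤ W Ω v := by
  induction n with
  | zero => exact le_rfl
  | succ n ih =>
    obtain ⟨h1, h2, h3⟩ := ErN_props hΩ hb hQ u n
    exact (S2 h1 h2 h3 hv (hc n (Nat.lt_succ_self n))).trans (ih fun j hj => hc j (hj.trans (Nat.lt_succ_self n)))

lemma volume_ErN {Ω : Set E2} (hΩ : IsOpen Ω) (hb : IsBounded Ω) (hQ : QProp Ωᶜ) (v : ℕ → E2)
    (hv : ∀ i, ‖v i‖ = 1) {s : ℝ} (hs : 0 < s) (n : ℕ)
    (hc : ∀ i < n, ∀ j < i, v j 0 * v i 1 - v j 1 * v i 0 ≠ 0) :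
    volume Ω ≤ volume (ErN Ω (fun i => s • v i) n) +
      ∑ i ∈ Finset.range n, ENNReal.ofReal s * W Ω (v i) := by
  induction n with
  | zero => simp [ErN]
  | succ n ih =>
    obtain ⟨h1, h2, h3⟩ := ErN_props hΩ hb hQ (fun i => s • v i) n
    have h4 := S1 h1 h2 (hv n) hs
    have h5 : W (ErN Ω (fun i => s • v i) n) (v n) ≤ W Ω (v n) := by
      refine W_ErN hΩ hb hQ _ n (hv n) fun j hj => ?_
      have := hc n (Nat.lt_succ_self n) j hj
      have h6 : (s • v j) 0 * v n 1 - (s • v j) 1 * v n 0 = s * (v j 0 * v n 1 - v j 1 * v n 0) := by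
        simp only [PiLp.smul_apply, smul_eq_mul]; ring
      rw [h6]
      exact mul_ne_zero hs.ne' this
    refine (ih fun i hi => hc i (hi.trans (Nat.lt_succ_self n))).trans ?_
    rw [Finset.sum_range_succ, add_comm _ (ENNReal.ofReal s * W Ω (v n)), ← add_assoc]
    gcongr
    refine h4.trans ?_
    gcongr
    exact le_rfl

lemma mem_ErN {Ω : Set E2} (u : ℕ → E2) (n : ℕ) {x : E2} (hx : x ∈ ErN Ω u n) (τ : ℕ → ℝ)
    (hτ : ∀ i, τ i ∈ Icc (0:ℝ) 1) : x + ∑ i ∈ Finset.range n, τ i • u i ∈ Ω := by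
  induction n generalizing x with
  | zero => simpa [ErN] using hx
  | succ n ih =>
    have := ih (hx (τ n) (hτ n))
    rw [Finset.sum_range_succ, add_comm _ (τ n • u n), ← add_assoc]
    exact this

/-! ### Zonotopes approximating a disc -/

lemma integral_abs_cos (θ : ℝ) : ∫ x in (0:ℝ)..Real.pi, |Real.cos (θ - x)| = 2 := by
  have hper : Function.Periodic (fun x => |Real.cos x|) Real.pi := by
    intro x; simp [Real.cos_add_pi]
  have h1 : ∫ x in (0:ℝ)..Real.pi, |Real.cos (θ - x)| = ∫ x in (θ - Real.pi)..(θ - 0), |Real.cos x| :=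
    intervalIntegral.integral_comp_sub_left (fun x => |Real.cos x|) θ
  rw [h1]
  have h2 := hper.intervalIntegral_add_eq (θ - Real.pi) (-(Real.pi/2))
  rw [show θ - Real.pi + Real.pi = θ - 0 by ring] at h2
  rw [h2, show -(Real.pi/2) + Real.pi = Real.pi/2 by ring]
  have h3 : ∫ x in (-(Real.pi/2))..(Real.pi/2), |Real.cos x| = ∫ x in (-(Real.pi/2))..(Real.pi/2), Real.cos x := by
    apply intervalIntegral.integral_congr
    intro x hx
    rw [uIcc_of_le (by linarith [Real.pi_pos])] at hx
    exact abs_of_nonneg (Real.cos_nonneg_of_mem_Icc hx)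
  rw [h3, integral_cos]
  simp; norm_num

lemma riemann_cos (θ : ℝ) {m : ℕ} (hm : 0 < m) :
    |(∑ i ∈ Finset.range m, |Real.cos (θ - Real.pi * i / m)|) - 2 * m / Real.pi| ≤ Real.pi := by
  have hpi := Real.pi_pos
  have hm' : (0:ℝ) < m := by exact_mod_cast hm
  set δ := Real.pi / m with hδ
  have hδ0 : 0 < δ := by positivity
  have hintg : ∀ a b, IntervalIntegrable (fun x => |Real.cos (θ - x)|) volume a b := fun a b =>
    Continuous.intervalIntegrable (by fun_prop) _ _
  have hsum : ∑ i ∈ Finset.range m, ∫ x in (i * δ)..((i+1 : ℕ) * δ), |Real.cos (θ - x)| = 2 := by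
    rw [intervalIntegral.sum_integral_adjacent_intervals (a := fun i : ℕ => (i:ℝ) * δ) (fun k _ => hintg _ _)]
    have : (m : ℝ) * δ = Real.pi := by rw [hδ]; field_simp
    rw [this]
    simp [integral_abs_cos]
  have hterm : ∀ i ∈ Finset.range m, abs ((∫ x in (i * δ)..((i+1 : ℕ) * δ), |Real.cos (θ - x)|) -
      δ * |Real.cos (θ - Real.pi * i / m)|) ≤ δ * δ := by
    intro i _
    have e1 : Real.pi * i / m = i * δ := by rw [hδ]; ring
    have e2 : δ * |Real.cos (θ - Real.pi * i / m)| =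
        ∫ x in (i * δ)..((i+1 : ℕ) * δ), |Real.cos (θ - Real.pi * i / m)| := by
      rw [intervalIntegral.integral_const, smul_eq_mul]; push_cast; ring
    rw [e2, ← intervalIntegral.integral_sub (hintg _ _) (by simp)]
    have := intervalIntegral.norm_integral_le_of_norm_le_const (a := (i:ℝ) * δ) (b := ((i+1 : ℕ):ℝ) * δ)
      (f := fun x => |Real.cos (θ - x)| - |Real.cos (θ - Real.pi * i / m)|) (C := δ) ?_
    · rw [Real.norm_eq_abs] at this
      refine this.trans (le_of_eq ?_)
      rw [show ((i+1 : ℕ):ℝ) * δ - i * δ = δ by push_cast; ring, abs_of_pos hδ0]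
    · intro x hx
      rw [uIoc_of_le (by push_cast; nlinarith)] at hx
      push_cast at hx
      rw [Real.norm_eq_abs, e1]
      refine (abs_abs_sub_abs_le _ _).trans ?_
      have h1 : |Real.cos (θ - x) - Real.cos (θ - i * δ)| ≤ |θ - x - (θ - i * δ)| := by
        have := Real.lipschitzWith_cos.dist_le_mul (θ - x) (θ - i * δ)
        rw [Real.dist_eq, Real.dist_eq] at this
        simpa only [NNReal.coe_one, one_mul] using this
      refine h1.trans ?_
      rw [abs_le]
      constructor <;> nlinarith [hx.1, hx.2]
  have htot : abs (2 - δ * ∑ i ∈ Finset.range m, |Real.cos (θ - Real.pi * i / m)|) ≤ m * (δ * δ) := by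
    rw [← hsum, Finset.mul_sum, ← Finset.sum_sub_distrib]
    refine (Finset.abs_sum_le_sum_abs _ _).trans ((Finset.sum_le_sum hterm).trans (le_of_eq ?_))
    simp
  have hmd : m * δ = Real.pi := by rw [hδ]; field_simp
  set Q := ∑ i ∈ Finset.range m, |Real.cos (θ - Real.pi * i / m)|
  have e3 : 2 * m / Real.pi = 2 / δ := by rw [hδ]; field_simp
  have e4 : Q - 2 / δ = - (2 - δ * Q) / δ := by field_simp; ring
  rw [e3, e4, abs_div, abs_neg, abs_of_pos hδ0, div_le_iff₀ hδ0]
  calc _ ≤ _ := htot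
    _ = _ := by rw [← mul_assoc, hmd]

/-- equidistributed directions -/
noncomputable def vd (m : ℕ) (i : ℕ) : E2 := !₂[Real.cos (Real.pi * i / m), Real.sin (Real.pi * i / m)]

@[simp] lemma vd_zero (m i : ℕ) : vd m i 0 = Real.cos (Real.pi * i / m) := rfl
@[simp] lemma vd_one (m i : ℕ) : vd m i 1 = Real.sin (Real.pi * i / m) := rfl

lemma vd_norm (m i : ℕ) : ‖vd m i‖ = 1 := by
  have : ‖vd m i‖ ^ 2 = 1 := by rw [norm_sq_E2]; simp
  exact (pow_eq_one_iff_of_nonneg (norm_nonneg _) two_ne_zero).1 this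

lemma vd_cross {m i j : ℕ} (hi : i < m) (hj : j < i) :
    vd m j 0 * vd m i 1 - vd m j 1 * vd m i 0 ≠ 0 := by
  have hpi := Real.pi_pos
  have hm : (0:ℝ) < m := by exact_mod_cast (by omega : 0 < m)
  have h1 : (j:ℝ) < i := by exact_mod_cast hj
  have h2 : (i:ℝ) < m := by exact_mod_cast hi
  have h3 : (0:ℝ) ≤ j := by positivity
  have : vd m j 0 * vd m i 1 - vd m j 1 * vd m i 0 = Real.sin (Real.pi * i / m - Real.pi * j / m) := by
    rw [Real.sin_sub]; simp; ring
  rw [this]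
  apply ne_of_gt
  apply Real.sin_pos_of_pos_of_lt_pi
  · rw [← sub_div]
    apply div_pos _ hm
    nlinarith
  · rw [← sub_div, div_lt_iff₀ hm]
    nlinarith

lemma polar (a b : ℝ) : ∃ θ : ℝ, a = Real.sqrt (a^2+b^2) * Real.cos θ ∧ b = Real.sqrt (a^2+b^2) * Real.sin θ := by
  have h : ‖(⟨a, b⟩ : ℂ)‖ = Real.sqrt (a^2+b^2) := by
    rw [Complex.norm_def, Complex.normSq_mk]; congr 1; ring
  refine ⟨Complex.arg ⟨a, b⟩, ?_, ?_⟩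
  · rw [← h, Complex.norm_mul_cos_arg]
  · rw [← h, Complex.norm_mul_sin_arg]

lemma polar_E2 (x : E2) : ∃ θ : ℝ, x 0 = ‖x‖ * Real.cos θ ∧ x 1 = ‖x‖ * Real.sin θ := by
  obtain ⟨θ, h⟩ := polar (x 0) (x 1)
  rw [← norm_sq_E2, Real.sqrt_sq (norm_nonneg _)] at h
  exact ⟨θ, h⟩

lemma zono_upper {m : ℕ} (hm : 0 < m) {s : ℝ} (a : ℕ → ℝ) (ha : ∀ i, |a i| ≤ s) :
    ‖∑ i ∈ Finset.range m, a i • vd m i‖ ≤ s * (2 * m / Real.pi + Real.pi) := by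
  set x := ∑ i ∈ Finset.range m, a i • vd m i with hx
  obtain ⟨θ, h0, h1⟩ := polar_E2 x
  have hs : 0 ≤ s := (abs_nonneg _).trans (ha 0)
  have e : ‖x‖ = ∑ i ∈ Finset.range m, a i * Real.cos (θ - Real.pi * i / m) := by
    have e1 : ‖x‖ = x 0 * Real.cos θ + x 1 * Real.sin θ := by
      rw [h0, h1]
      linear_combination (-‖x‖) * (Real.sin_sq_add_cos_sq θ)
    rw [e1, hx]
    simp only [WithLp.ofLp_sum, Finset.sum_apply, PiLp.smul_apply, smul_eq_mul, vd_zero, vd_one]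
    rw [Finset.sum_mul, Finset.sum_mul, ← Finset.sum_add_distrib]
    refine Finset.sum_congr rfl fun i _ => ?_
    rw [Real.cos_sub]; ring
  rw [e]
  calc _ ≤ ∑ i ∈ Finset.range m, s * |Real.cos (θ - Real.pi * i / m)| := by
        refine Finset.sum_le_sum fun i _ => ?_
        refine (le_abs_self _).trans ?_
        rw [abs_mul]
        exact mul_le_mul_of_nonneg_right (ha i) (abs_nonneg _)
    _ ≤ _ := by
        rw [← Finset.mul_sum]
        apply mul_le_mul_of_nonneg_left _ hs
        linarith [(abs_le.1 (riemann_cos θ hm)).2]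

lemma zono_contains {m : ℕ} (hm : 0 < m) {s t : ℝ} (hs : 0 ≤ s)
    (hst : t ≤ s * (2 * m / Real.pi - Real.pi)) (z : E2) (hz : ‖z‖ ≤ t) :
    ∃ a : ℕ → ℝ, (∀ i, |a i| ≤ s) ∧ z = ∑ i ∈ Finset.range m, a i • vd m i := by
  let L : (Fin m → ℝ) → E2 := fun a => ∑ i : Fin m, a i • vd m i
  let B : Set (Fin m → ℝ) := Set.pi univ fun _ => Icc (-s) s
  have hBc : IsCompact B := isCompact_univ_pi fun _ => isCompact_Icc
  have hBv : Convex ℝ B := convex_pi fun _ _ => convex_Icc _ _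
  have hLl : IsLinearMap ℝ L := by
    constructor
    · intro x y; simp only [L, Pi.add_apply, add_smul, Finset.sum_add_distrib]
    · intro c x; simp only [L, Pi.smul_apply, smul_eq_mul, mul_smul, Finset.smul_sum]
  have hLc : Continuous L := by fun_prop
  by_cases hzm : z ∈ L '' B
  · obtain ⟨a, ha, rfl⟩ := hzm
    refine ⟨fun i => if h : i < m then a ⟨i, h⟩ else 0, ?_, ?_⟩
    · intro i
      by_cases h : i < m
      · simp only [h, dif_pos]
        exact abs_le.2 (ha ⟨i, h⟩ (mem_univ _))
      · simpa [h] using hs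
    · rw [Finset.sum_range]
      simp [L]
  · exfalso
    obtain ⟨f, c, hf1, hf2⟩ := geometric_hahn_banach_closed_point (hBv.is_linear_image hLl)
      (hBc.image hLc).isClosed hzm
    set w : E2 := !₂[f (EuclideanSpace.single 0 1), f (EuclideanSpace.single 1 1)] with hw
    obtain ⟨θ, h0, h1⟩ := polar_E2 w
    have hfx : ∀ x : E2, f x = ‖w‖ * (x 0 * Real.cos θ + x 1 * Real.sin θ) := by
      intro x
      have hx : x = x 0 • EuclideanSpace.single 0 1 + x 1 • EuclideanSpace.single 1 1 := by
        ext i; fin_cases i <;> simp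
      conv_lhs => rw [hx]
      rw [map_add, map_smul, map_smul, smul_eq_mul, smul_eq_mul]
      have e0 : f (EuclideanSpace.single 0 1) = ‖w‖ * Real.cos θ := by rw [← h0]; rfl
      have e1 : f (EuclideanSpace.single 1 1) = ‖w‖ * Real.sin θ := by rw [← h1]; rfl
      rw [e0, e1]; ring
    have hfv : ∀ i, f (vd m i) = ‖w‖ * Real.cos (θ - Real.pi * i / m) := by
      intro i; rw [hfx, Real.cos_sub, vd_zero, vd_one]; ring
    let a : Fin m → ℝ := fun i => s * SignType.sign (Real.cos (θ - Real.pi * (i:ℕ) / m))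
    have ha : a ∈ B := by
      intro i _
      refine abs_le.1 ?_
      simp only [a, abs_mul, abs_of_nonneg hs]
      refine mul_le_of_le_one_right hs ?_
      rcases SignType.trichotomy (SignType.sign (Real.cos (θ - Real.pi * (i:ℕ) / m))) with h | h | h <;> simp [h]
    have h2 := hf1 _ ⟨a, ha, rfl⟩
    have h3 : f (L a) = ‖w‖ * (s * ∑ i ∈ Finset.range m, |Real.cos (θ - Real.pi * i / m)|) := by
      simp only [L, map_sum, map_smul, hfv, smul_eq_mul, a]
      rw [Finset.sum_range, Finset.mul_sum, Finset.mul_sum]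
      refine Finset.sum_congr rfl fun i _ => ?_
      have := sign_mul_self (Real.cos (θ - Real.pi * (i:ℕ) / m))
      rw [← this]; ring
    have h4 : f z ≤ ‖w‖ * t := by
      rw [hfx]
      apply mul_le_mul_of_nonneg_left _ (norm_nonneg _)
      refine le_trans ?_ hz
      refine (le_abs_self _).trans (abs_le_of_sq_le_sq ?_ (norm_nonneg _))
      rw [norm_sq_E2]
      nlinarith [Real.sin_sq_add_cos_sq θ, sq_nonneg (z 0 * Real.sin θ - z 1 * Real.cos θ)]
    have h5 : ‖w‖ * t ≤ f (L a) := by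
      rw [h3]
      apply mul_le_mul_of_nonneg_left _ (norm_nonneg _)
      refine hst.trans (mul_le_mul_of_nonneg_left ?_ hs)
      linarith [(abs_le.1 (riemann_cos θ hm)).1]
    linarith

/-- the tube bound, from the Crofton-type bound -/
theorem tube_of_S3 {Ω : Set E2} (hΩ : IsOpen Ω) (hb : IsBounded Ω) (hQ : QProp Ωᶜ) {P : ℝ}
    (hS3 : ∀ (n : ℕ) (v : ℕ → E2) (s R : ℝ), 0 ≤ s → (∀ i, ‖v i‖ = 1) →
      (∀ a : ℕ → ℝ, (∀ i, |a i| ≤ s) → ‖∑ i ∈ Finset.range n, a i • v i‖ ≤ 2 * R) →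
      ∑ i ∈ Finset.range n, ENNReal.ofReal s * W Ω (v i) ≤ ENNReal.ofReal (P * R))
    {t : ℝ} (ht : 0 < t) :
    volume Ω ≤ volume {x | closedBall x t ⊆ Ω} + ENNReal.ofReal (P * t) := by
  have hpi := Real.pi_pos
  let qm : ℕ → ℝ := fun m => 2 * m / Real.pi - Real.pi
  let qp : ℕ → ℝ := fun m => 2 * m / Real.pi + Real.pi
  have key : ∀ᶠ m : ℕ in atTop, volume Ω ≤ volume {x | closedBall x t ⊆ Ω} +
      ENNReal.ofReal (P * (t * (qp m / qm m))) := by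
    have hev : ∀ᶠ m : ℕ in atTop, Real.pi ^ 2 / 2 < (m:ℝ) :=
      tendsto_natCast_atTop_atTop.eventually_gt_atTop _
    filter_upwards [hev, eventually_gt_atTop 0] with m hm hm0
    have hqm : 0 < qm m := by
      simp only [qm]
      rw [sub_pos, lt_div_iff₀ hpi]
      nlinarith
    set s := 2 * t / qm m with hs
    have hs0 : 0 < s := by positivity
    have h1 := volume_ErN hΩ hb hQ (vd m) (vd_norm m) hs0 m (fun i hi j hj => vd_cross hi hj)
    have h2 := hS3 m (vd m) s (t * (qp m / qm m)) hs0.le (vd_norm m) (by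
      intro a ha
      refine (zono_upper hm0 a ha).trans (le_of_eq ?_)
      rw [hs]; simp only [qp]; ring)
    refine h1.trans (add_le_add ?_ h2)
    set c : E2 := ∑ i ∈ Finset.range m, (s/2) • vd m i with hc
    have h3 : (fun x => x + c) '' (ErN Ω (fun i => s • vd m i) m) ⊆ {x | closedBall x t ⊆ Ω} := by
      rintro _ ⟨x, hx, rfl⟩ y hy
      rw [mem_closedBall, dist_eq_norm] at hy
      obtain ⟨a, ha, hya⟩ := zono_contains hm0 (s := s/2) (by positivity) (by
        have : s / 2 * qm m = t := by rw [hs]; field_simp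
        exact this.ge) _ hy
      have : y = x + ∑ i ∈ Finset.range m, ((a i + s/2)/s) • (s • vd m i) := by
        have e : ∀ i, ((a i + s/2)/s) • (s • vd m i) = a i • vd m i + (s/2) • vd m i := by
          intro i
          rw [smul_smul, div_mul_cancel₀ _ hs0.ne', add_smul]
        simp_rw [e]
        rw [Finset.sum_add_distrib, ← hya, ← hc]
        module
      rw [this]
      refine mem_ErN _ m hx _ fun i => ?_
      have := abs_le.1 (ha i)
      constructor
      · apply div_nonneg _ hs0.le; linarith
      · rw [div_le_one hs0]; linarith
    calc _ = volume ((fun x => x + c) '' (ErN Ω (fun i => s • vd m i) m)) := by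
            rw [image_add_right, measure_preimage_add_right]
      _ ≤ _ := measure_mono h3
  have hlim : Tendsto (fun m : ℕ => qp m / qm m) atTop (𝓝 1) := by
    have h1 : Tendsto (fun m : ℕ => (2 / Real.pi + Real.pi / m) / (2 / Real.pi - Real.pi / m)) atTop
        (𝓝 ((2 / Real.pi + 0) / (2 / Real.pi - 0))) := by
      apply Filter.Tendsto.div
      · exact tendsto_const_nhds.add (tendsto_const_div_atTop_nhds_zero_nat _)
      · exact tendsto_const_nhds.sub (tendsto_const_div_atTop_nhds_zero_nat _)
      · rw [sub_zero]; positivity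
    rw [add_zero, sub_zero, div_self (by positivity)] at h1
    refine h1.congr' ?_
    filter_upwards [eventually_gt_atTop 0] with m hm
    have hm' : (m:ℝ) ≠ 0 := by exact_mod_cast hm.ne'
    simp only [qp, qm]
    rw [← mul_div_mul_left _ _ hm']
    congr 1 <;> field_simp
  have hlim2 : Tendsto (fun m : ℕ => volume {x | closedBall x t ⊆ Ω} +
      ENNReal.ofReal (P * (t * (qp m / qm m)))) atTop
      (𝓝 (volume {x | closedBall x t ⊆ Ω} + ENNReal.ofReal (P * (t * 1)))) := by
    apply Tendsto.const_add
    apply ENNReal.tendsto_ofReal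
    exact (hlim.const_mul t).const_mul P
  rw [mul_one] at hlim2
  exact ge_of_tendsto hlim2 key

/-! ### Lower bound for the perimeter by component counts -/

lemma divg_smul_const {g : E2 → ℝ} {x : E2} (hg : DifferentiableAt ℝ g x) (v : E2) :
    divg (fun x => g x • v) x = fderiv ℝ g x v := by
  unfold divg
  have h : fderiv ℝ (fun x => g x • v) x = (fderiv ℝ g x).smulRight v :=
    (hg.hasFDerivAt.smul_const v).fderiv
  have hv : v = v 0 • EuclideanSpace.single 0 1 + v 1 • EuclideanSpace.single 1 (1:ℝ) := by
    ext i; fin_cases i <;> simp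
  rw [h]
  conv_rhs => rw [hv, map_add, map_smul, map_smul]
  simp [Fin.sum_univ_two, mul_comm]

lemma perim_bound {Ω : Set E2} (hP : BddAbove (perimSet Ω)) {φ : E2 → E2} (h1 : ContDiff ℝ 1 φ)
    (h2 : HasCompactSupport φ) {r : ℝ} (hr : 0 < r) (h3 : ∀ x, ‖φ x‖ ≤ r) :
    ∫ x in Ω, divg φ x ≤ r * perimeter Ω := by
  have hd : ∀ x, divg (fun x => r⁻¹ • φ x) x = r⁻¹ * divg φ x := by
    intro x
    unfold divg
    rw [fderiv_fun_const_smul (h1.differentiable one_ne_zero x)]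
    simp [mul_add]
  have : r⁻¹ * ∫ x in Ω, divg φ x ≤ perimeter Ω := by
    apply le_csSup hP
    refine ⟨fun x => r⁻¹ • φ x, h1.const_smul _, h2.smul_left (f := fun _ => r⁻¹), ?_, ?_⟩
    · intro x
      rw [norm_smul, norm_inv, Real.norm_eq_abs, abs_of_pos hr, inv_mul_le_iff₀ hr, mul_one]
      exact h3 x
    · simp_rw [hd]
      rw [integral_const_mul]
  rwa [inv_mul_le_iff₀ hr] at this

lemma perimeter_nonneg {Ω : Set E2} (hP : BddAbove (perimSet Ω)) : 0 ≤ perimeter Ω := by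
  apply le_csSup hP
  refine ⟨0, contDiff_const, HasCompactSupport.zero, by simp, ?_⟩
  simp [divg]

noncomputable def bmp (k : ℕ) : ContDiffBump (0 : E2) :=
  ⟨1 / (2 * ((k:ℝ) + 1)), 1 / ((k:ℝ) + 1), by positivity, by
    apply one_div_lt_one_div_of_lt <;> nlinarith [(Nat.cast_nonneg k : (0:ℝ) ≤ k)]⟩

noncomputable def rho (k : ℕ) : E2 → ℝ := (bmp k).normed volume

/-- mollified indicator -/
noncomputable def chi (Ω : Set E2) (k : ℕ) : E2 → ℝ :=
  convolution (rho k) (Ω.indicator (fun _ => (1:ℝ))) (ContinuousLinearMap.lsmul ℝ ℝ) volume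

lemma chi_eq (Ω : Set E2) (k : ℕ) (x : E2) :
    chi Ω k x = ∫ z, rho k z * Ω.indicator (fun _ => (1:ℝ)) (x - z) := by
  simp [chi, convolution]

lemma ind_integrable {Ω : Set E2} (hΩ : IsOpen Ω) (hb : IsBounded Ω) :
    Integrable (Ω.indicator (fun _ => (1:ℝ))) := by
  rw [integrable_indicator_iff hΩ.measurableSet]
  exact integrableOn_const hb.measure_lt_top.ne

lemma chi_contDiff {Ω : Set E2} (hΩ : IsOpen Ω) (hb : IsBounded Ω) (k : ℕ) : ContDiff ℝ 2 (chi Ω k) :=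
  HasCompactSupport.contDiff_convolution_left _ (bmp k).hasCompactSupport_normed
    ((bmp k).contDiff_normed) (ind_integrable hΩ hb).locallyIntegrable

lemma chi_compact {Ω : Set E2} (hb : IsBounded Ω) (k : ℕ) : HasCompactSupport (chi Ω k) := by
  apply HasCompactSupport.convolution _ (bmp k).hasCompactSupport_normed
  refine HasCompactSupport.of_support_subset_isCompact hb.isCompact_closure ?_
  exact (support_indicator_subset).trans subset_closure

lemma chi_local {Ω : Set E2} {k : ℕ} {x : E2} {r : ℝ} (hk : 1 / ((k:ℝ) + 1) < r) :
    (ball x r ⊆ Ω → chi Ω k x = 1) ∧ (ball x r ⊆ Ωᶜ → chi Ω k x = 0) := by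
  have h0 : 0 < r := lt_trans (by positivity) hk
  constructor
  · intro h
    have hx : Ω.indicator (fun _ => (1:ℝ)) x = 1 := indicator_of_mem (h (mem_ball_self h0)) _
    rw [← hx]
    apply ContDiffBump.normed_convolution_eq_right
    intro y hy
    rw [hx, indicator_of_mem (h (ball_subset_ball hk.le hy))]
  · intro h
    have hx : Ω.indicator (fun _ => (1:ℝ)) x = 0 := indicator_of_notMem (h (mem_ball_self h0)) _
    rw [← hx]
    apply ContDiffBump.normed_convolution_eq_right
    intro y hy
    rw [hx, indicator_of_notMem (h (ball_subset_ball hk.le hy))]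

/-- testing the mollified indicator against a divergence -/
lemma chi_div_bound {Ω : Set E2} (hΩ : IsOpen Ω) (hb : IsBounded Ω) (hP : BddAbove (perimSet Ω)) (k : ℕ)
    {Y : E2 → E2} (h1 : ContDiff ℝ 1 Y) (h2 : HasCompactSupport Y) {r : ℝ} (hr : 0 < r)
    (h3 : ∀ x, ‖Y x‖ ≤ r) : ∫ x, chi Ω k x * divg Y x ≤ r * perimeter Ω := by
  have hρi : Integrable (rho k) := (bmp k).integrable_normed
  have hDc : Continuous (divg Y) := by
    unfold divg
    have := h1.continuous_fderiv one_ne_zero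
    fun_prop
  have hDs : HasCompactSupport (divg Y) := by
    refine (h2.fderiv (𝕜 := ℝ)).mono ?_
    intro x hx
    contrapose! hx
    simp at hx
    simp [divg, hx]
  have hDi : Integrable (divg Y) := hDc.integrable_of_hasCompactSupport hDs
  have hz : ∀ z, ∫ w, Ω.indicator (fun _ => (1:ℝ)) (w - z) * divg Y w ≤ r * perimeter Ω := by
    intro z
    have hb' := perim_bound hP (φ := fun x => Y (x + z)) (h1.comp (contDiff_id.add contDiff_const))
      (h2.comp_homeomorph (Homeomorph.addRight z)) hr (fun x => h3 _)
    refine le_of_eq_of_le ?_ hb'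
    rw [← integral_indicator hΩ.measurableSet, ← integral_add_right_eq_self _ z]
    congr 1; ext w
    have : divg (fun x => Y (x + z)) w = divg Y (w + z) := by
      unfold divg
      rw [fderiv_comp_add_right]
    by_cases hw : w ∈ Ω <;> simp [hw, this]
  have hind : Measurable (Ω.indicator (fun _ => (1:ℝ))) := measurable_const.indicator hΩ.measurableSet
  have hintg : Integrable (fun p : E2 × E2 => rho k p.1 * (Ω.indicator (fun _ => (1:ℝ)) (p.2 - p.1) * divg Y p.2))
      (volume.prod volume) := by
    have h := (hρi.mul_prod hDi).bdd_mul (c := 1) (f := fun p : E2 × E2 => Ω.indicator (fun _ => (1:ℝ)) (p.2 - p.1))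
      (hind.comp (by fun_prop)).aestronglyMeasurable (by
        refine Eventually.of_forall fun p => ?_
        by_cases hw : p.2 - p.1 ∈ Ω <;> simp [hw])
    refine h.congr (Eventually.of_forall fun p => ?_)
    simp only; ring
  have hswap := integral_integral_swap
    (f := fun z w => rho k z * (Ω.indicator (fun _ => (1:ℝ)) (w - z) * divg Y w)) hintg
  have e1 : ∫ x, chi Ω k x * divg Y x = ∫ y, ∫ x, rho k x * (Ω.indicator (fun _ => (1:ℝ)) (y - x) * divg Y y) := by
    congr 1; ext y
    rw [chi_eq, ← integral_mul_const]
    congr 1; ext x; ring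
  rw [e1, ← hswap]
  have h1 : ∫ z, rho k z = 1 := (bmp k).integral_normed
  calc _ ≤ ∫ z, rho k z * (r * perimeter Ω) := by
        apply integral_mono
        · exact hintg.integral_prod_left
        · exact hρi.mul_const _
        · intro z
          simp only
          rw [integral_const_mul]
          exact mul_le_mul_of_nonneg_left (hz z) ((bmp k).nonneg_normed z)
    _ = _ := by rw [integral_mul_const, h1, one_mul]


lemma chi_variation {Ω : Set E2} (hΩ : IsOpen Ω) (hb : IsBounded Ω) (hP : BddAbove (perimSet Ω)) (k : ℕ)
    (n : ℕ) (v : ℕ → E2) (s R : ℝ) (hs : 0 ≤ s) (hR : 0 < R)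
    (hZ : ∀ a : ℕ → ℝ, (∀ i, |a i| ≤ s) → ‖∑ i ∈ Finset.range n, a i • v i‖ ≤ 2 * R) :
    ∑ i ∈ Finset.range n, s * ∫ x, |fderiv ℝ (chi Ω k) x (v i)| ≤ 2 * R * perimeter Ω := by
  set χ := chi Ω k with hχ
  have hχd : ContDiff ℝ 2 χ := chi_contDiff hΩ hb k
  have hχs : HasCompactSupport χ := chi_compact hb k
  have hDd : ∀ w : E2, ContDiff ℝ 1 (fun x => fderiv ℝ χ x w) := fun w =>
    (hχd.fderiv_right (by norm_num)).clm_apply contDiff_const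
  have hDs : HasCompactSupport (fderiv ℝ χ) := hχs.fderiv (𝕜 := ℝ)
  have hDs' : ∀ w : E2, HasCompactSupport (fun x => fderiv ℝ χ x w) := fun w => hχs.fderiv_apply (𝕜 := ℝ) w
  have hDi : ∀ w : E2, Integrable (fun x => fderiv ℝ χ x w) := fun w =>
    (hDd w).continuous.integrable_of_hasCompactSupport (hDs' w)
  set V : ℝ := (volume (tsupport (fderiv ℝ χ))).toReal with hV
  have hVfin : volume (tsupport (fderiv ℝ χ)) ≠ ∞ := hDs.isCompact.measure_lt_top.ne
  have key : ∀ η : ℝ, 0 < η → ∑ i ∈ Finset.range n, s * ∫ x, |fderiv ℝ χ x (v i)| ≤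
      2 * R * perimeter Ω + n * (s * (η * V)) := by
    intro η hη
    set g : ℕ → E2 → ℝ := fun i x => fderiv ℝ χ x (v i) / Real.sqrt ((fderiv ℝ χ x (v i)) ^ 2 + η ^ 2) with hg
    have hpos : ∀ i x, 0 < (fderiv ℝ χ x (v i)) ^ 2 + η ^ 2 := fun i x => by positivity
    have hgd : ∀ i, ContDiff ℝ 1 (g i) := fun i =>
      (hDd (v i)).div ((((hDd (v i)).pow 2).add contDiff_const).sqrt (fun x => (hpos i x).ne'))
        (fun x => (Real.sqrt_pos.2 (hpos i x)).ne')
    have hgs : ∀ i, HasCompactSupport (g i) := fun i => by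
      refine (hDs' (v i)).mono ?_
      intro x hx
      contrapose! hx
      simp at hx
      simp [g, hx]
    have hg1 : ∀ i x, |g i x| ≤ 1 := fun i x => by
      simp only [g]
      rw [abs_div, abs_of_pos (Real.sqrt_pos.2 (hpos i x)), div_le_one (Real.sqrt_pos.2 (hpos i x))]
      apply Real.abs_le_sqrt
      nlinarith [sq_nonneg η]
    set Y : E2 → E2 := fun x => ∑ i ∈ Finset.range n, (-s * g i x) • v i with hY
    have hYd : ContDiff ℝ 1 Y := ContDiff.sum fun i _ => (contDiff_const.mul (hgd i)).smul contDiff_const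
    have hYs : HasCompactSupport Y := by
      refine hDs.mono ?_
      intro x hx
      contrapose! hx
      simp at hx
      simp [Y, g, hx]
    have hY1 : ∀ x, ‖Y x‖ ≤ 2 * R := fun x => hZ _ fun i => by
      rw [abs_mul, abs_neg, abs_of_nonneg hs]
      exact mul_le_of_le_one_right hs (hg1 i x)
    have hb1 := chi_div_bound hΩ hb hP k hYd hYs (by positivity : (0:ℝ) < 2 * R) hY1
    have hdiv : ∀ x, divg Y x = ∑ i ∈ Finset.range n, -s * fderiv ℝ (g i) x (v i) := by
      intro x
      have : ∀ i ∈ Finset.range n, -s * fderiv ℝ (g i) x (v i) = divg (fun x => (-s * g i x) • v i) x := by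
        intro i _
        have hd := (hgd i).differentiable one_ne_zero x
        rw [divg_smul_const (hd.const_mul _), fderiv_const_mul hd]; simp
      rw [Finset.sum_congr rfl this]
      unfold divg
      rw [Finset.sum_comm]
      refine Finset.sum_congr rfl fun j _ => ?_
      have : fderiv ℝ Y x = ∑ i ∈ Finset.range n, fderiv ℝ (fun x => (-s * g i x) • v i) x := by
        simp only [Y]
        rw [fderiv_fun_sum]
        intro i _
        exact (((contDiff_const.mul (hgd i)).smul contDiff_const).differentiable one_ne_zero x)
      rw [this]
      simp
    have hχi : ∀ i, Integrable (fun x => χ x * fderiv ℝ (g i) x (v i)) := fun i =>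
      (hχd.continuous.mul (((hgd i).continuous_fderiv one_ne_zero).clm_apply continuous_const)).integrable_of_hasCompactSupport
        hχs.mul_right
    have hgi : ∀ i, Integrable (fun x => fderiv ℝ χ x (v i) * g i x) := fun i =>
      ((hDd (v i)).continuous.mul (hgd i).continuous).integrable_of_hasCompactSupport
        (hgs i).mul_left
    have hibp : ∀ i, ∫ x, χ x * fderiv ℝ (g i) x (v i) = - ∫ x, fderiv ℝ χ x (v i) * g i x := fun i =>
      integral_mul_fderiv_eq_neg_fderiv_mul_of_integrable (hgi i) (hχi i)
        ((hχd.continuous.mul (hgd i).continuous).integrable_of_hasCompactSupport hχs.mul_right)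
        (fun x _ => hχd.differentiable two_ne_zero x) (fun x _ => (hgd i).differentiable one_ne_zero x)
    have hsum : ∫ x, χ x * divg Y x = ∑ i ∈ Finset.range n, s * ∫ x, fderiv ℝ χ x (v i) * g i x := by
      simp_rw [hdiv, Finset.mul_sum]
      rw [integral_finsetSum]
      · refine Finset.sum_congr rfl fun i _ => ?_
        have : ∀ x, χ x * (-s * fderiv ℝ (g i) x (v i)) = -s * (χ x * fderiv ℝ (g i) x (v i)) := fun x => by ring
        simp_rw [this]
        rw [integral_const_mul, hibp]; ring
      · intro i _
        refine ((hχi i).const_mul (-s)).congr (Eventually.of_forall fun x => ?_)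
        simp only; ring
    rw [hsum] at hb1
    have hlow : ∀ i, ∫ x, |fderiv ℝ χ x (v i)| ≤ (∫ x, fderiv ℝ χ x (v i) * g i x) + η * V := by
      intro i
      have hc : η * V = ∫ x, (tsupport (fderiv ℝ χ)).indicator (fun _ => η) x := by
        rw [integral_indicator (isClosed_tsupport _).measurableSet, setIntegral_const, smul_eq_mul, mul_comm]
        rfl
      have hci : Integrable ((tsupport (fderiv ℝ χ)).indicator (fun _ => η)) := by
        rw [integrable_indicator_iff (isClosed_tsupport _).measurableSet]
        exact integrableOn_const hVfin
      rw [hc, ← integral_add (hgi i) hci]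
      apply integral_mono (hDi _).abs ((hgi i).add hci)
      intro x
      simp only [Pi.add_apply]
      by_cases hx : x ∈ tsupport (fderiv ℝ χ)
      · rw [indicator_of_mem hx]
        simp only [g]
        set d := fderiv ℝ χ x (v i) with hd
        have hq : 0 < Real.sqrt (d ^ 2 + η ^ 2) := Real.sqrt_pos.2 (by positivity)
        have hq2 := Real.sq_sqrt (by positivity : 0 ≤ d ^ 2 + η ^ 2)
        have h1 : |d| ≤ Real.sqrt (d ^ 2 + η ^ 2) := Real.abs_le_sqrt (by nlinarith [sq_nonneg η])
        have h2 : Real.sqrt (d ^ 2 + η ^ 2) ≤ |d| + η := by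
          rw [Real.sqrt_le_left (by positivity)]
          nlinarith [sq_abs d, mul_nonneg (abs_nonneg d) hη.le]
        have h4 : d * (d / Real.sqrt (d ^ 2 + η ^ 2)) = Real.sqrt (d ^ 2 + η ^ 2) - η * (η / Real.sqrt (d ^ 2 + η ^ 2)) := by
          field_simp
          linarith
        have h5 : η / Real.sqrt (d ^ 2 + η ^ 2) ≤ 1 := by
          rw [div_le_one hq]
          exact Real.le_sqrt_of_sq_le (by nlinarith [sq_nonneg d])
        rw [h4]
        nlinarith
      · rw [indicator_of_notMem hx]
        have : fderiv ℝ χ x = 0 := image_eq_zero_of_notMem_tsupport hx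
        simp [this]
    calc _ ≤ ∑ i ∈ Finset.range n, (s * (∫ x, fderiv ℝ χ x (v i) * g i x) + s * (η * V)) := by
          apply Finset.sum_le_sum
          intro i _
          rw [← mul_add]
          exact mul_le_mul_of_nonneg_left (hlow i) hs
      _ ≤ _ := by
          rw [Finset.sum_add_distrib]
          simp only [Finset.sum_const, Finset.card_range, nsmul_eq_mul]
          linarith
  have hlim : Tendsto (fun η : ℝ => 2 * R * perimeter Ω + n * (s * (η * V))) (𝓝[>] 0) (𝓝 (2 * R * perimeter Ω + n * (s * (0 * V)))) := by
    apply Tendsto.mono_left _ nhdsWithin_le_nhds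
    exact Continuous.tendsto (by fun_prop) 0
  have := ge_of_tendsto hlim (eventually_nhdsWithin_of_forall fun η hη => key η hη)
  simpa using this

lemma lint_deriv_ge {F : ℝ → ℝ} (hF : ContDiff ℝ 1 F) {a b : ℝ} (hab : a ≤ b) (h : |F b - F a| = 1) :
    1 ≤ ∫⁻ y in Ioc a b, ‖deriv F y‖ₑ := by
  have h1 : ∫ y in Ioc a b, deriv F y = F b - F a := by
    rw [← intervalIntegral.integral_of_le hab]
    apply intervalIntegral.integral_deriv_eq_sub
    · intro x _; exact hF.differentiable one_ne_zero x
    · exact (hF.continuous_deriv le_rfl).intervalIntegrable _ _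
  have h2 := enorm_integral_le_lintegral_enorm (μ := volume.restrict (Ioc a b)) (deriv F)
  rw [h1] at h2
  refine le_trans (le_of_eq ?_) h2
  rw [Real.enorm_eq_ofReal_abs, h, ENNReal.ofReal_one]

lemma slice_count {F : ℝ → ℝ} (hF : ContDiff ℝ 1 F) (hFs : HasCompactSupport F) (S : Finset ℝ)
    (h1 : ∀ y ∈ S, F y = 1) (h0 : ∀ y ∈ S, ∀ y' ∈ S, y < y' → ∃ z, y < z ∧ z < y' ∧ F z = 0) :
    2 * (S.card : ℝ≥0∞) ≤ ∫⁻ y, ‖deriv F y‖ₑ := by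
  have hbd : ∃ B : ℝ, ∀ y, B ≤ |y| → F y = 0 := by
    obtain ⟨B, hB⟩ := hFs.isCompact.isBounded.exists_norm_le
    refine ⟨B + 1, fun y hy => image_eq_zero_of_notMem_tsupport fun h => ?_⟩
    have := hB y h
    rw [Real.norm_eq_abs] at this
    linarith
  obtain ⟨B, hB⟩ := hbd
  have key : ∀ S : Finset ℝ, (∀ y ∈ S, F y = 1) → (∀ y ∈ S, ∀ y' ∈ S, y < y' → ∃ z, y < z ∧ z < y' ∧ F z = 0) →
      ∀ b, F b = 0 → (∀ y ∈ S, y < b) → 2 * (S.card : ℝ≥0∞) ≤ ∫⁻ y in Iic b, ‖deriv F y‖ₑ := by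
    intro S
    induction S using Finset.induction_on_max with
    | empty => intro _ _ _ _ _; simp
    | insert a S hmax ih =>
      intro g1 g0 b hb hlt
      have haS : a ∉ S := fun h => lt_irrefl _ (hmax a h)
      have hz : ∃ z, z < a ∧ F z = 0 ∧ ∀ y ∈ S, y < z := by
        rcases S.eq_empty_or_nonempty with rfl | hne
        · refine ⟨min (a - 1) (-|B|), ?_, ?_, by simp⟩
          · exact (min_le_left _ _).trans_lt (by linarith)
          · apply hB
            have : min (a - 1) (-|B|) ≤ - |B| := min_le_right _ _
            rw [abs_of_nonpos (this.trans (by simp))]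
            linarith [le_abs_self B]
        · obtain ⟨z, z1, z2, z3⟩ := g0 (S.max' hne) (Finset.mem_insert_of_mem (S.max'_mem hne)) a
            (Finset.mem_insert_self _ _) (hmax _ (S.max'_mem hne))
          exact ⟨z, z2, z3, fun y hy => (S.le_max' y hy).trans_lt z1⟩
      obtain ⟨z, hza, hFz, hzS⟩ := hz
      have hab : a < b := hlt a (Finset.mem_insert_self _ _)
      have hFa : F a = 1 := g1 a (Finset.mem_insert_self _ _)
      have i1 := ih (fun y hy => g1 y (Finset.mem_insert_of_mem hy))
        (fun y hy y' hy' => g0 y (Finset.mem_insert_of_mem hy) y' (Finset.mem_insert_of_mem hy')) z hFz hzS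
      have i2 := lint_deriv_ge hF hza.le (by rw [hFz, hFa]; simp)
      have i3 := lint_deriv_ge hF hab.le (by rw [hb, hFa]; simp)
      have e1 : Iic b = (Iic z ∪ Ioc z a) ∪ Ioc a b := by
        rw [Iic_union_Ioc_eq_Iic hza.le, Iic_union_Ioc_eq_Iic hab.le]
      rw [e1, lintegral_union measurableSet_Ioc, lintegral_union measurableSet_Ioc, Finset.card_insert_of_notMem haS]
      · push_cast
        calc _ = 2 * (S.card : ℝ≥0∞) + 1 + 1 := by rw [mul_add, mul_one, add_assoc, one_add_one_eq_two]
          _ ≤ _ := by gcongr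
      · rw [Set.disjoint_left]; intro x hx hx'; exact not_lt.2 hx hx'.1
      · rw [Iic_union_Ioc_eq_Iic hza.le, Set.disjoint_left]; intro x hx hx'; exact not_lt.2 hx hx'.1
  obtain ⟨M, hM⟩ := S.bddAbove
  have hb : |B| + |M| + 1 ≤ |(|B| + |M| + 1)| := le_abs_self _
  refine (key S h1 h0 (|B| + |M| + 1) (hB _ ?_) ?_).trans (setLIntegral_le_lintegral _ _)
  · linarith [le_abs_self B, abs_nonneg M]
  · intro y hy
    linarith [hM hy, le_abs_self M, abs_nonneg B]

/-- for almost every line in direction `v`, two points of the slice which are separated in the slice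
are separated by an exterior point -/
def GoodSlices (Ω : Set E2) (v : E2) : Prop :=
  ∀ᵐ p : ℝ, ∀ y y' : ℝ, y < y' → p • perp v + y • v ∈ Ω → p • perp v + y' • v ∈ Ω →
    (∃ z, y < z ∧ z < y' ∧ p • perp v + z • v ∉ Ω) →
    ∃ z, y < z ∧ z < y' ∧ p • perp v + z • v ∈ interior Ωᶜ

lemma eventually_chi {Ω : Set E2} (hΩ : IsOpen Ω) (x : E2) :
    (x ∈ Ω → ∀ᶠ k : ℕ in atTop, chi Ω k x = 1) ∧ (x ∈ interior Ωᶜ → ∀ᶠ k : ℕ in atTop, chi Ω k x = 0) := by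
  have hlim := tendsto_one_div_add_atTop_nhds_zero_nat (𝕜 := ℝ)
  constructor
  · intro h
    obtain ⟨r, hr, hb⟩ := Metric.isOpen_iff.1 hΩ x h
    filter_upwards [hlim.eventually_lt_const hr] with k hk
    exact (chi_local hk).1 hb
  · intro h
    obtain ⟨r, hr, hb⟩ := Metric.isOpen_iff.1 isOpen_interior x h
    filter_upwards [hlim.eventually_lt_const hr] with k hk
    exact (chi_local hk).2 (hb.trans interior_subset)

lemma W_le_liminf {Ω : Set E2} (hΩ : IsOpen Ω) (hb : IsBounded Ω) {v : E2} (hv : ‖v‖ = 1)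
    (hG : GoodSlices Ω v) :
    2 * W Ω v ≤ liminf (fun k => ∫⁻ x, ‖fderiv ℝ (chi Ω k) x v‖ₑ) atTop := by
  have hcont : ∀ k, Continuous (fun x => fderiv ℝ (chi Ω k) x v) := fun k =>
    ((chi_contDiff hΩ hb k).continuous_fderiv two_ne_zero).clm_apply continuous_const
  have hmeas : ∀ k, Measurable (fun z : ℝ × ℝ => ‖fderiv ℝ (chi Ω k) (phi v z) v‖ₑ) := fun k =>
    ((hcont k).comp (continuous_phi v)).enorm.measurable
  have e1 : ∀ k, ∫⁻ x, ‖fderiv ℝ (chi Ω k) x v‖ₑ =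
      ∫⁻ p : ℝ, ∫⁻ y : ℝ, ‖fderiv ℝ (chi Ω k) (p • perp v + y • v) v‖ₑ := by
    intro k
    rw [← (phi_mp v hv).lintegral_comp_emb (phi_emb v hv), Measure.volume_eq_prod, lintegral_prod _ (hmeas k).aemeasurable]
    rfl
  simp_rw [e1]
  refine le_trans ?_ (lintegral_liminf_le fun k => (hmeas k).lintegral_prod_right')
  rw [W, ← lintegral_const_mul' _ _ ENNReal.ofNat_ne_top]
  apply lintegral_mono_ae
  filter_upwards [hG] with p hp
  unfold ncomp
  rw [ENNReal.mul_iSup]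
  apply iSup_le; intro S
  rw [ENNReal.mul_iSup]
  apply iSup_le; intro hS
  apply le_liminf_of_le (by isBoundedDefault)
  have ev1 : ∀ᶠ k : ℕ in atTop, ∀ y ∈ S, chi Ω k (p • perp v + y • v) = 1 := by
    rw [Filter.eventually_all_finset]
    exact fun y hy => (eventually_chi hΩ _).1 (hS.1 y hy)
  have ev2 : ∀ᶠ k : ℕ in atTop, ∀ y ∈ S, ∀ y' ∈ S, y < y' → ∃ z, y < z ∧ z < y' ∧ chi Ω k (p • perp v + z • v) = 0 := by
    rw [Filter.eventually_all_finset]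
    intro y hy
    rw [Filter.eventually_all_finset]
    intro y' hy'
    by_cases hlt : y < y'
    · obtain ⟨z, z1, z2, z3⟩ := hp y y' hlt (hS.1 y hy) (hS.1 y' hy') (hS.2 y hy y' hy' hlt)
      filter_upwards [(eventually_chi hΩ _).2 z3] with k hk _
      exact ⟨z, z1, z2, hk⟩
    · exact Eventually.of_forall fun k h => absurd h hlt
  filter_upwards [ev1, ev2] with k h1 h2
  have hd : ∀ y, deriv (fun y : ℝ => chi Ω k (p • perp v + y • v)) y = fderiv ℝ (chi Ω k) (p • perp v + y • v) v := by
    intro y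
    have hl : HasDerivAt (fun y : ℝ => p • perp v + y • v) v y := by
      simpa using ((hasDerivAt_id y).smul_const v).const_add (p • perp v)
    exact (((chi_contDiff hΩ hb k).differentiable two_ne_zero _).hasFDerivAt.comp_hasDerivAt y hl).deriv
  have := slice_count (F := fun y : ℝ => chi Ω k (p • perp v + y • v)) ?_ ?_ S h1 h2
  · simp_rw [hd] at this
    exact this
  · exact ((chi_contDiff hΩ hb k).of_le (by norm_num)).comp (contDiff_const.add (contDiff_id.smul contDiff_const))
  · obtain ⟨B, hB⟩ := (chi_compact (Ω := Ω) hb k).isCompact.isBounded.exists_norm_le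
    refine HasCompactSupport.intro (isCompact_closedBall (0:ℝ) B) fun y hy => ?_
    apply image_eq_zero_of_notMem_tsupport
    intro h
    apply hy
    rw [mem_closedBall_zero_iff]
    exact (norm_le_phi_snd hv p y).trans (hB _ h)

theorem S3 {Ω : Set E2} (hΩ : IsOpen Ω) (hb : IsBounded Ω) (hP : BddAbove (perimSet Ω))
    (hG : ∀ v : E2, ‖v‖ = 1 → GoodSlices Ω v) (n : ℕ) (v : ℕ → E2) (s R : ℝ) (hs : 0 ≤ s)
    (hv : ∀ i, ‖v i‖ = 1)
    (hZ : ∀ a : ℕ → ℝ, (∀ i, |a i| ≤ s) → ‖∑ i ∈ Finset.range n, a i • v i‖ ≤ 2 * R) :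
    ∑ i ∈ Finset.range n, ENNReal.ofReal s * W Ω (v i) ≤ ENNReal.ofReal (perimeter Ω * R) := by
  have hR0 : 0 ≤ R := by
    have := hZ 0 (by simpa using hs)
    simp at this; exact this
  rcases hR0.eq_or_lt with hR | hR
  · have hz : ∀ i ∈ Finset.range n, ENNReal.ofReal s * W Ω (v i) = 0 := by
      intro i hi
      have := hZ (fun j => if j = i then s else 0) (fun j => by split_ifs <;> simp [abs_of_nonneg, hs])
      simp only [ite_smul, zero_smul, Finset.sum_ite_eq', hi, if_true] at this
      rw [norm_smul, hv, ← hR] at this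
      have h0 : s = 0 := by
        rw [Real.norm_eq_abs, abs_of_nonneg hs] at this; linarith
      simp [h0]
    rw [Finset.sum_eq_zero hz]; exact zero_le
  have hvar : ∀ k, ∑ i ∈ Finset.range n, ENNReal.ofReal s * ∫⁻ x, ‖fderiv ℝ (chi Ω k) x (v i)‖ₑ ≤ ENNReal.ofReal (2 * R * perimeter Ω) := by
    intro k
    refine le_trans (le_of_eq ?_) (ENNReal.ofReal_le_ofReal (chi_variation hΩ hb hP k n v s R hs hR hZ))
    rw [ENNReal.ofReal_sum_of_nonneg]
    · refine Finset.sum_congr rfl fun i _ => ?_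
      rw [ENNReal.ofReal_mul hs]
      congr 1
      have hi : Integrable (fun x => fderiv ℝ (chi Ω k) x (v i)) :=
        (((chi_contDiff hΩ hb k).continuous_fderiv two_ne_zero).clm_apply continuous_const).integrable_of_hasCompactSupport
          ((chi_compact hb k).fderiv_apply (𝕜 := ℝ) _)
      exact (ofReal_integral_norm_eq_lintegral_enorm hi).symm
    · intro i _
      exact mul_nonneg hs (integral_nonneg fun x => abs_nonneg _)
  have hsum : ∑ i ∈ Finset.range n, ENNReal.ofReal s * (2 * W Ω (v i)) ≤ ENNReal.ofReal (2 * R * perimeter Ω) := by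
    calc _ ≤ ∑ i ∈ Finset.range n, ENNReal.ofReal s * liminf (fun k => ∫⁻ x, ‖fderiv ℝ (chi Ω k) x (v i)‖ₑ) atTop := by
          gcongr with i _
          exact W_le_liminf hΩ hb (hv i) (hG _ (hv i))
      _ = ∑ i ∈ Finset.range n, ⨆ m, ENNReal.ofReal s * ⨅ k, ⨅ _ : k ≥ m, ∫⁻ x, ‖fderiv ℝ (chi Ω k) x (v i)‖ₑ := by
          refine Finset.sum_congr rfl fun i _ => ?_
          rw [liminf_eq_iSup_iInf_of_nat, ENNReal.mul_iSup]
      _ = ⨆ m, ∑ i ∈ Finset.range n, ENNReal.ofReal s * ⨅ k, ⨅ _ : k ≥ m, ∫⁻ x, ‖fderiv ℝ (chi Ω k) x (v i)‖ₑ := by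
          apply ENNReal.finsetSum_iSup_of_monotone
          intro i a b hab
          apply mul_le_mul_right
          exact le_iInf₂ fun k hk => iInf₂_le k (hab.trans hk)
      _ ≤ _ := by
          apply iSup_le; intro m
          refine le_trans ?_ (hvar m)
          gcongr with i _
          exact iInf₂_le m le_rfl
  have e2 : ∑ i ∈ Finset.range n, ENNReal.ofReal s * (2 * W Ω (v i)) = 2 * ∑ i ∈ Finset.range n, ENNReal.ofReal s * W Ω (v i) := by
    rw [Finset.mul_sum]
    refine Finset.sum_congr rfl fun i _ => by ring
  have e3 : ENNReal.ofReal (2 * R * perimeter Ω) = 2 * ENNReal.ofReal (perimeter Ω * R) := by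
    rw [show 2 * R * perimeter Ω = 2 * (perimeter Ω * R) by ring, ENNReal.ofReal_mul (by norm_num)]
    simp
  rw [e2, e3] at hsum
  exact (ENNReal.mul_le_mul_iff_right (by norm_num) (by norm_num)).1 hsum

theorem tube {Ω : Set E2} (hΩ : IsOpen Ω) (hb : IsBounded Ω) (hQ : QProp Ωᶜ) (hP : BddAbove (perimSet Ω))
    (hG : ∀ v : E2, ‖v‖ = 1 → GoodSlices Ω v) {t : ℝ} (ht : 0 < t) :
    volume Ω ≤ volume {x | closedBall x t ⊆ Ω} + ENNReal.ofReal (perimeter Ω * t) :=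
  tube_of_S3 hΩ hb hQ (fun n v s R => S3 hΩ hb hP hG n v s R) ht

/-! ### Torsional rigidity -/

lemma cauchy_schwarz_int {α : Type*} [MeasurableSpace α] {μ : Measure α} {f g : α → ℝ}
    (hf : Integrable (fun x => f x ^ 2) μ) (hg : Integrable (fun x => g x ^ 2) μ)
    (hfg : Integrable (fun x => f x * g x) μ) :
    (∫ x, f x * g x ∂μ) ^ 2 ≤ (∫ x, f x ^ 2 ∂μ) * ∫ x, g x ^ 2 ∂μ := by
  have h : ∀ t : ℝ, 0 ≤ (∫ x, g x ^ 2 ∂μ) * (t * t) + (2 * ∫ x, f x * g x ∂μ) * t + ∫ x, f x ^ 2 ∂μ := by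
    intro t
    have h0 : 0 ≤ ∫ x, (f x + t * g x) ^ 2 ∂μ := integral_nonneg fun x => sq_nonneg _
    have e : ∀ x, (f x + t * g x) ^ 2 = f x ^ 2 + (2 * t) * (f x * g x) + (t * t) * g x ^ 2 := fun x => by ring
    simp_rw [e] at h0
    have e1 : ∫ x, (f x ^ 2 + (2 * t) * (f x * g x) + (t * t) * g x ^ 2) ∂μ =
        (∫ x, f x ^ 2 ∂μ) + (2 * t) * (∫ x, f x * g x ∂μ) + (t * t) * ∫ x, g x ^ 2 ∂μ := by
      rw [integral_add (by exact hf.add (hfg.const_mul _)) (hg.const_mul _), integral_add hf (hfg.const_mul _),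
        integral_const_mul, integral_const_mul]
    rw [e1] at h0
    linarith
  have := discrim_le_zero h
  unfold discrim at this
  nlinarith

lemma intOn_bdd {Ω : Set E2} (hb : IsBounded Ω) {f : E2 → ℝ} (hf : Continuous f) : IntegrableOn f Ω :=
  (hf.continuousOn.integrableOn_compact hb.isCompact_closure).mono_set subset_closure

lemma poincare {Ω : Set E2} (hb : IsBounded Ω) {u : E2 → ℝ} (h1 : ContDiff ℝ 1 u)
    (h2 : HasCompactSupport u) (h3 : tsupport u ⊆ Ω) (i : Fin 2) (c : ℝ) :
    (∫ x in Ω, u x) ^ 2 ≤ (∫ x in Ω, (x i - c) ^ 2) * ∫ x in Ω, ‖fderiv ℝ u x‖ ^ 2 := by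
  set e : E2 := EuclideanSpace.single i 1 with he
  have hen : ‖e‖ = 1 := by simp [e]
  have hu0 : ∀ x, x ∉ Ω → u x = 0 := fun x hx => image_eq_zero_of_notMem_tsupport fun h => hx (h3 h)
  have hd0 : ∀ x, x ∉ Ω → fderiv ℝ u x = 0 := fun x hx =>
    image_eq_zero_of_notMem_tsupport fun h => hx (h3 (tsupport_fderiv_subset ℝ h))
  have hlin : ∀ x : E2, HasFDerivAt (fun x : E2 => x i - c) (EuclideanSpace.proj i : E2 →L[ℝ] ℝ) x := fun x =>
    (EuclideanSpace.proj i : E2 →L[ℝ] ℝ).hasFDerivAt.sub_const c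
  have hlc : Continuous (fun x : E2 => x i - c) := by fun_prop
  have hdc : Continuous (fderiv ℝ u) := h1.continuous_fderiv one_ne_zero
  have hdec : Continuous (fun x => fderiv ℝ u x e) := hdc.clm_apply continuous_const
  have hibp := integral_mul_fderiv_eq_neg_fderiv_mul_of_integrable (μ := (volume : Measure E2))
    (f := fun x : E2 => x i - c) (g := u) (v := e)
    ?_ ?_ ?_ (fun x _ => (hlin x).differentiableAt) (fun x _ => h1.differentiable one_ne_zero x)
  · have e1 : ∫ x in Ω, u x = - ∫ x in Ω, (x i - c) * fderiv ℝ u x e := by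
      rw [setIntegral_eq_integral_of_forall_compl_eq_zero hu0,
        setIntegral_eq_integral_of_forall_compl_eq_zero (fun x hx => by rw [hd0 x hx]; simp), hibp, neg_neg]
      congr 1; ext x
      rw [(hlin x).fderiv]
      simp [e]
    rw [e1, neg_sq]
    refine (cauchy_schwarz_int ?_ ?_ ?_).trans ?_
    · exact intOn_bdd hb (hlc.pow 2)
    · exact intOn_bdd hb (hdec.pow 2)
    · exact intOn_bdd hb (hlc.mul hdec)
    · apply mul_le_mul_of_nonneg_left
      · apply integral_mono (intOn_bdd hb (hdec.pow 2)) (intOn_bdd hb (hdc.norm.pow 2))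
        intro x
        show (fderiv ℝ u x e) ^ 2 ≤ ‖fderiv ℝ u x‖ ^ 2
        have := (fderiv ℝ u x).le_opNorm e
        rw [hen, mul_one] at this
        rw [← sq_abs]
        exact pow_le_pow_left₀ (abs_nonneg _) this 2
      · exact integral_nonneg fun x => sq_nonneg _
  · refine Continuous.integrable_of_hasCompactSupport ?_ h2.mul_left
    simp_rw [fun x => (hlin x).fderiv]
    exact continuous_const.mul h1.continuous
  · exact (hlc.mul hdec).integrable_of_hasCompactSupport (h2.fderiv_apply (𝕜 := ℝ) e).mul_left
  · exact (hlc.mul h1.continuous).integrable_of_hasCompactSupport h2.mul_left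

lemma torsion_mem_le {Ω : Set E2} (hb : IsBounded Ω) (i : Fin 2) (c : ℝ) :
    ∀ r ∈ ({0} ∪ {r | ∃ u : E2 → ℝ, ContDiff ℝ 1 u ∧ HasCompactSupport u ∧ tsupport u ⊆ Ω ∧
      (∫ x in Ω, ‖fderiv ℝ u x‖ ^ 2) ≠ 0 ∧
      r = (∫ x in Ω, u x) ^ 2 / ∫ x in Ω, ‖fderiv ℝ u x‖ ^ 2} : Set ℝ), r ≤ ∫ x in Ω, (x i - c) ^ 2 := by
  rintro r (h | ⟨u, h1, h2, h3, h4, rfl⟩)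
  · rw [mem_singleton_iff.1 h]; exact integral_nonneg fun x => sq_nonneg _
  · have hpos : 0 < ∫ x in Ω, ‖fderiv ℝ u x‖ ^ 2 :=
      lt_of_le_of_ne (integral_nonneg fun x => sq_nonneg _) h4.symm
    rw [div_le_iff₀ hpos]
    exact poincare hb h1 h2 h3 i c

lemma torsion_le {Ω : Set E2} (hb : IsBounded Ω) (i : Fin 2) (c : ℝ) :
    torsion Ω ≤ ∫ x in Ω, (x i - c) ^ 2 :=
  csSup_le ⟨0, Or.inl rfl⟩ (torsion_mem_le hb i c)

lemma torsion_nonneg {Ω : Set E2} (hb : IsBounded Ω) : 0 ≤ torsion Ω :=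
  le_csSup ⟨_, torsion_mem_le hb 0 0⟩ (Or.inl rfl)

lemma torsion_ineq {Ω : Set E2} (hb : IsBounded Ω) {u : E2 → ℝ} (h1 : ContDiff ℝ 1 u)
    (h2 : HasCompactSupport u) (h3 : tsupport u ⊆ Ω) :
    (∫ x in Ω, u x) ^ 2 ≤ torsion Ω * ∫ x in Ω, ‖fderiv ℝ u x‖ ^ 2 := by
  by_cases h0 : (∫ x in Ω, ‖fderiv ℝ u x‖ ^ 2) = 0
  · have := poincare hb h1 h2 h3 0 0
    rw [h0, mul_zero] at this ⊢
    exact this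
  · have hpos : 0 < ∫ x in Ω, ‖fderiv ℝ u x‖ ^ 2 :=
      lt_of_le_of_ne (integral_nonneg fun x => sq_nonneg _) (Ne.symm h0)
    rw [← div_le_iff₀ hpos]
    exact le_csSup ⟨_, torsion_mem_le hb 0 0⟩ (Or.inr ⟨u, h1, h2, h3, h0, rfl⟩)

section profile
variable (M P : ℝ)

noncomputable def gf (t : ℝ) : ℝ := max (M - P * t) 0
noncomputable def Ph (t : ℝ) : ℝ := (M ^ 2 - gf M P t ^ 2) / (2 * P)

variable {M P}

lemma gf_cont : Continuous (gf M P) := by unfold gf; fun_prop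
lemma Ph_cont : Continuous (Ph M P) := by unfold Ph; have := gf_cont (M := M) (P := P); fun_prop
lemma gf_nonneg (t : ℝ) : 0 ≤ gf M P t := le_max_right _ _
lemma gf_le (hM : 0 ≤ M) (hP : 0 < P) {t : ℝ} (ht : 0 ≤ t) : gf M P t ≤ M :=
  max_le (by nlinarith) hM
lemma gf_anti (hP : 0 < P) {a b : ℝ} (h : a ≤ b) : gf M P b ≤ gf M P a :=
  max_le_max (by nlinarith) le_rfl
lemma gf_lip (hP : 0 < P) {a b : ℝ} (h : a ≤ b) : gf M P a ≤ gf M P b + P * (b - a) := by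
  unfold gf
  apply max_le
  · have := le_max_left (M - P * b) 0; linarith
  · have := le_max_right (M - P * b) 0; nlinarith
lemma Ph_zero (hM : 0 ≤ M) : Ph M P 0 = 0 := by simp [Ph, gf, hM]
lemma Ph_mono (hP : 0 < P) {a b : ℝ} (h : a ≤ b) : Ph M P a ≤ Ph M P b := by
  unfold Ph
  have h1 := gf_anti (M := M) hP h
  have h2 := gf_nonneg (M := M) (P := P) b
  gcongr
lemma Ph_sub (hP : 0 < P) {a b : ℝ} (h : a ≤ b) : Ph M P b - Ph M P a ≤ gf M P a * (b - a) := by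
  unfold Ph
  have h1 := gf_anti (M := M) hP h
  have h2 := gf_nonneg (M := M) (P := P) b
  have h3 := gf_lip (M := M) hP h
  rw [← sub_div, div_le_iff₀ (by positivity)]
  nlinarith
lemma Ph_lip (hP : 0 < P) {a b c : ℝ} (ha : c ≤ a) (hb : c ≤ b) :
    |Ph M P a - Ph M P b| ≤ gf M P c * |a - b| := by
  rcases le_total a b with h | h
  · rw [abs_of_nonpos (by linarith [Ph_mono (M := M) hP h]), abs_of_nonpos (by linarith)]
    have := Ph_sub (M := M) hP h
    nlinarith [gf_anti (M := M) hP ha]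
  · rw [abs_of_nonneg (by linarith [Ph_mono (M := M) hP h]), abs_of_nonneg (by linarith)]
    have := Ph_sub (M := M) hP h
    nlinarith [gf_anti (M := M) hP hb]
lemma Ph_integral (hM : 0 ≤ M) (hP : 0 < P) {t : ℝ} (ht : 0 ≤ t) : ∫ s in (0:ℝ)..t, gf M P s = Ph M P t := by
  have h := integral_eq_of_hasDerivAt_off_countable (E := ℝ) (Ph M P) (gf M P) (a := 0) (b := t) (s := {M / P}) (countable_singleton _)
    Ph_cont.continuousOn ?_ (gf_cont.intervalIntegrable _ _)
  · rw [h, Ph_zero hM, sub_zero]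
  · rintro x ⟨_, hx⟩
    rcases lt_or_gt_of_ne (show x ≠ M / P from hx) with h | h
    · rw [lt_div_iff₀ hP] at h
      have hev : Ph M P =ᶠ[𝓝 x] fun s => (M ^ 2 - (M - P * s) ^ 2) / (2 * P) := by
        have : ∀ᶠ s in 𝓝 x, 0 < M - P * s := (Continuous.tendsto (by fun_prop) x).eventually_const_lt (by linarith)
        filter_upwards [this] with s hs
        simp [Ph, gf, max_eq_left hs.le]
      have hg : gf M P x = M - P * x := max_eq_left (by linarith)
      rw [hg]
      refine HasDerivAt.congr_of_eventuallyEq ?_ hev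
      have := ((((hasDerivAt_id x).const_mul P).const_sub M).pow 2 |>.const_sub (M ^ 2)).div_const (2 * P)
      refine this.congr_deriv ?_
      simp; field_simp
    · rw [div_lt_iff₀ hP] at h
      have hev : Ph M P =ᶠ[𝓝 x] fun s => M ^ 2 / (2 * P) := by
        have : ∀ᶠ s in 𝓝 x, M - P * s < 0 := (Continuous.tendsto (by fun_prop) x).eventually_lt_const (by linarith)
        filter_upwards [this] with s hs
        simp [Ph, gf, max_eq_right hs.le]
      have hg : gf M P x = 0 := max_eq_right (by linarith)
      rw [hg]
      exact (hasDerivAt_const _ _).congr_of_eventuallyEq hev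

lemma int_sq (hM : 0 ≤ M) (hP : 0 < P) : ∫ t in (0:ℝ)..(M / P), (M - P * t) ^ 2 = M ^ 3 / (3 * P) := by
  have h : ∀ x ∈ uIcc 0 (M / P), HasDerivAt (fun t => -(M - P * t) ^ 3 / (3 * P)) ((M - P * x) ^ 2) x := by
    intro x _
    have := (((((hasDerivAt_id x).const_mul P).const_sub M).pow 3).neg).div_const (3 * P)
    refine this.congr_deriv ?_
    simp; field_simp
  rw [intervalIntegral.integral_eq_sub_of_hasDerivAt h (Continuous.intervalIntegrable (by fun_prop) _ _)]
  field_simp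
  ring
end profile

lemma perimeter_pos_of_tube {Ω : Set E2} (hΩ : IsOpen Ω) (hb : IsBounded Ω) (hne : Ω.Nonempty) {P : ℝ}
    (ht : ∀ t : ℝ, 0 < t → volume Ω ≤ volume {x | closedBall x t ⊆ Ω} + ENNReal.ofReal (P * t)) : 0 < P := by
  by_contra hP
  push Not at hP
  obtain ⟨B, hB⟩ := hb.exists_norm_le
  have hB0 : 0 ≤ B := by
    obtain ⟨x, hx⟩ := hne
    exact (norm_nonneg x).trans (hB x hx)
  have h := ht (2 * B + 1) (by linarith)
  have he : {x : E2 | closedBall x (2 * B + 1) ⊆ Ω} = ∅ := by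
    rw [eq_empty_iff_forall_notMem]
    intro x hx
    have hxn := hB x (hx (mem_closedBall_self (by linarith)))
    set e : E2 := EuclideanSpace.single 0 1
    have hen : ‖e‖ = 1 := by simp [e]
    have hy : x + (2 * B + 1) • e ∈ Ω := hx (by
      rw [mem_closedBall, dist_eq_norm, add_sub_cancel_left, norm_smul, hen, mul_one, Real.norm_eq_abs, abs_of_pos (by linarith)])
    have h1 := hB _ hy
    have h2 : ‖(2 * B + 1) • e‖ ≤ ‖x + (2 * B + 1) • e‖ + ‖x‖ := by
      have := norm_sub_le (x + (2 * B + 1) • e) x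
      rwa [add_sub_cancel_left] at this
    rw [norm_smul, hen, mul_one, Real.norm_eq_abs, abs_of_pos (by linarith)] at h2
    linarith
  rw [he, measure_empty, zero_add, ENNReal.ofReal_of_nonpos (mul_nonpos_of_nonpos_of_nonneg hP (by linarith))] at h
  exact (hΩ.measure_pos volume hne).not_ge h

lemma X_lower {Ω : Set E2} (hΩ : IsOpen Ω) (hb : IsBounded Ω) (hKne : Ωᶜ.Nonempty) {M P : ℝ} (hM : volume Ω = ENNReal.ofReal M)
    (hM0 : 0 ≤ M) (hP : 0 < P)
    (ht : ∀ t : ℝ, 0 < t → volume Ω ≤ volume {x | closedBall x t ⊆ Ω} + ENNReal.ofReal (P * t)) :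
    M ^ 3 / (3 * P) ≤ ∫ x in Ω, Ph M P (infDist x Ωᶜ) := by
  have hlc := lintegral_comp_eq_lintegral_meas_le_mul_of_measurable (f := fun x : E2 => infDist x Ωᶜ) (g := gf M P)
    (volume.restrict Ω) (fun x => infDist_nonneg) (continuous_infDist_pt _).measurable
    (fun t _ => gf_cont.intervalIntegrable _ _) gf_cont.measurable (fun t _ => gf_nonneg t)
  simp_rw [fun x : E2 => Ph_integral (M := M) (P := P) hM0 hP (infDist_nonneg (x := x) (s := Ωᶜ))] at hlc
  have hPn : ∀ x : E2, 0 ≤ Ph M P (infDist x Ωᶜ) := fun x => by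
    rw [← Ph_zero (M := M) (P := P) hM0]; exact Ph_mono hP infDist_nonneg
  have hintg : IntegrableOn (fun x => Ph M P (infDist x Ωᶜ)) Ω := intOn_bdd hb (Ph_cont.comp (continuous_infDist_pt _))
  rw [← ofReal_integral_eq_lintegral_ofReal hintg (Eventually.of_forall hPn)] at hlc
  have hX : 0 ≤ ∫ x in Ω, Ph M P (infDist x Ωᶜ) := integral_nonneg hPn
  rw [← ENNReal.ofReal_le_ofReal_iff hX, hlc, ← int_sq hM0 hP,
    intervalIntegral.integral_of_le (by positivity), ofReal_integral_eq_lintegral_ofReal]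
  · calc _ ≤ ∫⁻ t in Ioc 0 (M / P), (volume.restrict Ω) {a | t ≤ infDist a Ωᶜ} * ENNReal.ofReal (gf M P t) := by
          apply setLIntegral_mono' measurableSet_Ioc
          intro t htt
          have h1 : 0 ≤ M - P * t := by
            have := htt.2
            rw [le_div_iff₀ hP] at this
            linarith
          rw [sq, ENNReal.ofReal_mul h1]
          apply mul_le_mul'
          · have h2 := ht t htt.1
            rw [ENNReal.ofReal_sub _ (by have := htt.1; positivity), ← hM, tsub_le_iff_right]
            refine h2.trans (add_le_add ?_ le_rfl)
            rw [Measure.restrict_apply (measurableSet_le measurable_const (continuous_infDist_pt _).measurable)]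
            apply measure_mono
            intro x hx
            refine ⟨?_, hx (mem_closedBall_self htt.1.le)⟩
            rw [mem_ofPred_eq, le_infDist hKne]
            intro y hy
            by_contra hlt
            push Not at hlt
            exact hy (hx (by rw [mem_closedBall']; exact hlt.le))
          · exact ENNReal.ofReal_le_ofReal (le_max_left _ _)
      _ ≤ _ := lintegral_mono_set Ioc_subset_Ioi_self
  · exact (Continuous.integrableOn_Ioc (by fun_prop))
  · exact Eventually.of_forall fun t => sq_nonneg _

/-- the mollified web function -/
lemma test_function {Ω : Set E2} (hΩ : IsOpen Ω) (hb : IsBounded Ω) (hKne : Ωᶜ.Nonempty) {M P : ℝ}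
    (hM0 : 0 ≤ M) (hP : 0 < P) (k : ℕ) :
    ∃ u : E2 → ℝ, ContDiff ℝ 1 u ∧ HasCompactSupport u ∧ tsupport u ⊆ Ω ∧
      (∀ x, ‖fderiv ℝ u x‖ ≤ gf M P (infDist x Ωᶜ) + 4 * P * (1 / ((k:ℝ) + 1))) ∧
      ∫ x in Ω, (Ph M P (infDist x Ωᶜ) - 2 * M * (1 / ((k:ℝ) + 1))) ≤ ∫ x in Ω, u x := by
  set η : ℝ := 1 / ((k:ℝ) + 1) with hη
  have hη0 : 0 < η := by positivity
  set D : E2 → ℝ := fun x => infDist x Ωᶜ with hD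
  have hDlip : ∀ x y, |D x - D y| ≤ dist x y := fun x y => by
    have := (lipschitz_infDist_pt (Ωᶜ : Set E2)).dist_le_mul x y
    simpa [Real.dist_eq] using this
  have hDc : Continuous D := continuous_infDist_pt _
  have hDz : ∀ x, x ∉ Ω → D x = 0 := fun x hx => infDist_zero_of_mem hx
  have hDn : ∀ x, 0 ≤ D x := fun x => infDist_nonneg
  set m : E2 → ℝ := fun x => max (D x - 2 * η) 0 with hm
  set w : E2 → ℝ := fun x => Ph M P (m x) with hw
  have hwc : Continuous w := Ph_cont.comp ((hDc.sub continuous_const).max continuous_const)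
  have hw0 : ∀ x, D x ≤ 2 * η → w x = 0 := fun x hx => by
    simp only [w, m]; rw [max_eq_right (by linarith), Ph_zero hM0]
  have hws : HasCompactSupport w := by
    refine HasCompactSupport.of_support_subset_isCompact hb.isCompact_closure ?_
    intro x hx
    apply subset_closure
    by_contra h
    exact hx (hw0 x (by rw [hDz x h]; positivity))
  have hwi : Integrable w := hwc.integrable_of_hasCompactSupport hws
  set u : E2 → ℝ := convolution (rho k) w (ContinuousLinearMap.lsmul ℝ ℝ) volume with hu
  have hρi : Integrable (rho k) := (bmp k).integrable_normed
  have hρ1 : ∫ z, rho k z = 1 := (bmp k).integral_normed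
  have hud : ContDiff ℝ 1 u :=
    HasCompactSupport.contDiff_convolution_left _ (bmp k).hasCompactSupport_normed
      ((bmp k).contDiff_normed) hwi.locallyIntegrable
  have hus : HasCompactSupport u := HasCompactSupport.convolution _ (bmp k).hasCompactSupport_normed hws
  have hux : ∀ x, u x = ∫ z, rho k z * w (x - z) := fun x => by simp [u, convolution]
  have hρ0 : ∀ z, η ≤ ‖z‖ → rho k z = 0 := by
    intro z hz
    have : z ∉ Function.support (rho k) := by
      have hsup : Function.support (rho k) = ball 0 (bmp k).rOut := (bmp k).support_normed_eq
      rw [hsup, mem_ball_zero_iff, not_lt]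
      exact hz
    simpa using this
  have hu0 : ∀ x, D x ≤ η → u x = 0 := by
    intro x hx
    rw [hux]
    rw [integral_eq_zero_of_ae]
    refine Eventually.of_forall fun z => ?_
    by_cases hz : η ≤ ‖z‖
    · simp [hρ0 z hz]
    · have := hDlip (x - z) x
      rw [dist_eq_norm, sub_sub_cancel_left, norm_neg] at this
      have h2 := (abs_le.1 this).2
      simp [hw0 (x - z) (by linarith)]
  have hut : tsupport u ⊆ Ω := by
    have h1 : tsupport u ⊆ {x | η ≤ D x} := by
      apply closure_minimal _ (isClosed_le continuous_const hDc)
      intro x hx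
      by_contra h
      rw [mem_ofPred_eq] at h
      exact hx (hu0 x (by linarith))
    intro x hx
    by_contra h
    have h2 : η ≤ D x := h1 hx
    rw [hDz x h] at h2
    linarith
  refine ⟨u, hud, hus, hut, ?_, ?_⟩
  · intro x
    set c : ℝ := max (D x - 4 * η) 0 with hc
    have hwl : ∀ a b : E2, dist a x ≤ 2 * η → dist b x ≤ 2 * η → |w a - w b| ≤ gf M P c * dist a b := by
      intro a b ha hb'
      have ha' := (abs_le.1 (hDlip a x)).1
      have hb'' := (abs_le.1 (hDlip b x)).1
      refine (Ph_lip hP (c := c) (max_le_max (by linarith) le_rfl) (max_le_max (by linarith) le_rfl)).trans ?_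
      apply mul_le_mul_of_nonneg_left _ (gf_nonneg _)
      refine (abs_max_sub_max_le_abs _ _ _).trans ?_
      rw [sub_sub_sub_cancel_right]
      exact hDlip a b
    have hcont : ∀ a : E2, Integrable (fun z => rho k z * w (a - z)) := fun a => by
      refine Continuous.integrable_of_hasCompactSupport ?_ (bmp k).hasCompactSupport_normed.mul_right
      exact (bmp k).continuous_normed.mul (hwc.comp (by fun_prop))
    have hul : ∀ a ∈ ball x η, |u a - u x| ≤ gf M P c * dist a x := by
      intro a ha
      rw [hux, hux, ← integral_sub (hcont a) (hcont x)]
      calc _ ≤ ∫ z, rho k z * (gf M P c * dist a x) := by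
            rw [← Real.norm_eq_abs]
            refine (norm_integral_le_integral_norm (fun z => rho k z * w (a - z) - rho k z * w (x - z))).trans ?_
            apply integral_mono ((hcont a).sub (hcont x)).norm (hρi.mul_const _)
            intro z
            show ‖rho k z * w (a - z) - rho k z * w (x - z)‖ ≤ rho k z * (gf M P c * dist a x)
            have hρn : 0 ≤ rho k z := (bmp k).nonneg_normed z
            rw [← mul_sub, norm_mul, Real.norm_eq_abs, Real.norm_eq_abs, abs_of_nonneg hρn]
            by_cases hz : η ≤ ‖z‖
            · simp [hρ0 z hz]
            · apply mul_le_mul_of_nonneg_left _ hρn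
              push Not at hz
              rw [mem_ball] at ha
              have e1 : dist (a - z) x ≤ 2 * η := by
                rw [dist_eq_norm] at ha ⊢
                have := norm_sub_le (a - x) z
                rw [show a - z - x = a - x - z by abel]
                linarith
              have e2 : dist (x - z) x ≤ 2 * η := by
                rw [dist_eq_norm, sub_sub_cancel_left, norm_neg]; linarith
              have := hwl (a - z) (x - z) e1 e2
              rwa [dist_sub_right] at this
        _ = _ := by rw [integral_mul_const, hρ1, one_mul]
    have h1 : ‖fderiv ℝ u x‖ ≤ gf M P c := by
      apply norm_fderiv_le_of_lip' ℝ (gf_nonneg _)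
      filter_upwards [ball_mem_nhds x hη0] with a ha
      have := hul a ha
      rwa [dist_eq_norm] at this
    refine h1.trans ?_
    rcases le_total (D x) (4 * η) with h | h
    · have e : c = 0 := max_eq_right (by linarith)
      have := gf_lip (M := M) hP (hDn x)
      rw [e]
      nlinarith
    · have e : c = D x - 4 * η := max_eq_left (by linarith)
      have := gf_lip (M := M) hP (show D x - 4 * η ≤ D x by linarith)
      rw [e]
      nlinarith
  · have e1 : ∫ x in Ω, u x = ∫ x in Ω, w x := by
      rw [setIntegral_eq_integral_of_forall_compl_eq_zero (fun x hx => hu0 x (by rw [hDz x hx]; exact hη0.le)),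
        setIntegral_eq_integral_of_forall_compl_eq_zero (fun x hx => hw0 x (by rw [hDz x hx]; positivity)),
        hu, integral_convolution _ hρi hwi, hρ1]
      simp
    rw [e1]
    apply integral_mono (intOn_bdd hb ((Ph_cont.comp hDc).sub continuous_const)) (intOn_bdd hb hwc)
    intro x
    show Ph M P (D x) - 2 * M * η ≤ Ph M P (m x)
    have hle : m x ≤ D x := max_le (by linarith) (hDn x)
    have h1 := Ph_sub (M := M) hP hle
    have h2 : D x - m x ≤ 2 * η := by
      have := le_max_left (D x - 2 * η) 0
      simp only [m]; linarith
    have h3 : gf M P (m x) ≤ M := gf_le hM0 hP (le_max_right _ _)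
    have h4 : gf M P (m x) * (D x - m x) ≤ M * (2 * η) := mul_le_mul h3 h2 (by linarith) hM0
    linarith

lemma torsion_lower {Ω : Set E2} (hΩ : IsOpen Ω) (hb : IsBounded Ω) (hne : Ω.Nonempty) {P : ℝ}
    (ht : ∀ t : ℝ, 0 < t → volume Ω ≤ volume {x | closedBall x t ⊆ Ω} + ENNReal.ofReal (P * t)) :
    (volume Ω).toReal ^ 3 / (3 * P ^ 2) ≤ torsion Ω := by
  have hP := perimeter_pos_of_tube hΩ hb hne ht
  have hKne : Ωᶜ.Nonempty := by
    rw [nonempty_compl]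
    rintro rfl
    exact NormedSpace.unbounded_univ ℝ E2 hb
  set M := (volume Ω).toReal with hMd
  have hMv : volume Ω = ENNReal.ofReal M := (ENNReal.ofReal_toReal hb.measure_lt_top.ne).symm
  have hM : 0 < M := ENNReal.toReal_pos (hΩ.measure_pos volume hne).ne' hb.measure_lt_top.ne
  set X := ∫ x in Ω, Ph M P (infDist x Ωᶜ) with hXd
  have hX := X_lower hΩ hb hKne hMv hM.le hP ht
  rw [← hXd] at hX
  have hX0 : 0 < X := lt_of_lt_of_le (by positivity) hX
  set T := torsion Ω with hT
  have hT0 : 0 ≤ T := torsion_nonneg hb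
  have hDc : Continuous (fun x : E2 => infDist x Ωᶜ) := continuous_infDist_pt _
  have hPDc : Continuous (fun x : E2 => Ph M P (infDist x Ωᶜ)) := Ph_cont.comp hDc
  have hconst : ∀ c : ℝ, ∫ _x in Ω, c = M * c := fun c => by
    rw [setIntegral_const, smul_eq_mul]; rfl
  have hstep : ∀ k : ℕ, X ^ 2 - 4 * X * M ^ 2 * (1 / ((k:ℝ) + 1)) ≤
      T * (M ^ 3 - 2 * P * X + M * (8 * M * P * (1 / ((k:ℝ) + 1)) + 16 * P ^ 2 * (1 / ((k:ℝ) + 1)) ^ 2)) := by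
    intro k
    obtain ⟨u, h1, h2, h3, h4, h5⟩ := test_function hΩ hb hKne hM.le hP k
    set η : ℝ := 1 / ((k:ℝ) + 1) with hη
    have hη0 : 0 < η := by positivity
    rw [integral_sub (intOn_bdd hb hPDc) (intOn_bdd hb continuous_const), hconst] at h5
    have hti := torsion_ineq hb h1 h2 h3
    have hgrad : ∫ x in Ω, ‖fderiv ℝ u x‖ ^ 2 ≤ M ^ 3 - 2 * P * X + M * (8 * M * P * η + 16 * P ^ 2 * η ^ 2) := by
      have hle : ∫ x in Ω, ‖fderiv ℝ u x‖ ^ 2 ≤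
          ∫ x in Ω, ((M ^ 2 + (8 * M * P * η + 16 * P ^ 2 * η ^ 2)) - 2 * P * Ph M P (infDist x Ωᶜ)) := by
        apply integral_mono (intOn_bdd hb ((h1.continuous_fderiv one_ne_zero).norm.pow 2))
          (intOn_bdd hb (continuous_const.sub (continuous_const.mul hPDc)))
        intro x
        show ‖fderiv ℝ u x‖ ^ 2 ≤ (M ^ 2 + (8 * M * P * η + 16 * P ^ 2 * η ^ 2)) - 2 * P * Ph M P (infDist x Ωᶜ)
        have hg := gf_nonneg (M := M) (P := P) (infDist x Ωᶜ)
        have hg' := gf_le hM.le hP (infDist_nonneg (x := x) (s := Ωᶜ))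
        have e : 2 * P * Ph M P (infDist x Ωᶜ) = M ^ 2 - gf M P (infDist x Ωᶜ) ^ 2 := by
          unfold Ph; field_simp
        rw [e]
        have := pow_le_pow_left₀ (norm_nonneg _) (h4 x) 2
        have h6 : gf M P (infDist x Ωᶜ) * (8 * P * η) ≤ M * (8 * P * η) := mul_le_mul_of_nonneg_right hg' (by positivity)
        nlinarith
      rw [integral_sub (intOn_bdd hb continuous_const) (Integrable.const_mul (intOn_bdd hb hPDc) (2 * P)), hconst,
        integral_const_mul] at hle
      refine hle.trans (le_of_eq ?_)
      rw [← hXd]; ring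
    have hlow : X ^ 2 - 4 * X * M ^ 2 * η ≤ (∫ x in Ω, u x) ^ 2 := by
      rw [← hXd] at h5
      set a := ∫ x in Ω, u x
      have hc : 0 < M * (2 * M * η) := by positivity
      nlinarith [sq_nonneg (a - X)]
    exact hlow.trans (hti.trans (mul_le_mul_of_nonneg_left hgrad hT0))
  have hlim : X ^ 2 ≤ T * (M ^ 3 - 2 * P * X) := by
    have h0 := tendsto_one_div_add_atTop_nhds_zero_nat (𝕜 := ℝ)
    have hl : Tendsto (fun k : ℕ => X ^ 2 - 4 * X * M ^ 2 * (1 / ((k:ℝ) + 1))) atTop (𝓝 (X ^ 2 - 4 * X * M ^ 2 * 0)) :=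
      tendsto_const_nhds.sub (tendsto_const_nhds.mul h0)
    have hr : Tendsto (fun k : ℕ => T * (M ^ 3 - 2 * P * X + M * (8 * M * P * (1 / ((k:ℝ) + 1)) + 16 * P ^ 2 * (1 / ((k:ℝ) + 1)) ^ 2)))
        atTop (𝓝 (T * (M ^ 3 - 2 * P * X + M * (8 * M * P * 0 + 16 * P ^ 2 * 0 ^ 2)))) :=
      tendsto_const_nhds.mul (tendsto_const_nhds.add (tendsto_const_nhds.mul
        ((tendsto_const_nhds.mul h0).add (tendsto_const_nhds.mul (h0.pow 2)))))
    have := le_of_tendsto_of_tendsto' hl hr hstep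
    simpa using this
  have hX' : M ^ 3 ≤ X * (3 * P) := by rwa [div_le_iff₀ (by positivity)] at hX
  have h1 : X ^ 2 ≤ T * (M ^ 3 / 3) := hlim.trans (mul_le_mul_of_nonneg_left (by linarith) hT0)
  rw [div_le_iff₀ (by positivity)]
  have hM3 : 0 < M ^ 3 := by positivity
  have h2 : (M ^ 3) ^ 2 ≤ (X * (3 * P)) ^ 2 := pow_le_pow_left₀ hM3.le hX' 2
  have h3 : (M ^ 3) * M ^ 3 ≤ (T * (3 * P ^ 2)) * M ^ 3 := by
    have : X ^ 2 * (9 * P ^ 2) ≤ T * (M ^ 3 / 3) * (9 * P ^ 2) := mul_le_mul_of_nonneg_right h1 (by positivity)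
    nlinarith
  exact le_of_mul_le_mul_right h3 hM3

theorem core_bound {Ω : Set E2} (hΩ : IsOpen Ω) (hb : IsBounded Ω) (hne : Ω.Nonempty) (hQ : QProp Ωᶜ)
    (hP : BddAbove (perimSet Ω)) (hG : ∀ v : E2, ‖v‖ = 1 → GoodSlices Ω v) :
    Fq (1/2) Ω ≥ (Real.sqrt 3)⁻¹ := by
  have ht := fun t (h : 0 < t) => tube hΩ hb hQ hP hG h
  have hP0 := perimeter_pos_of_tube hΩ hb hne ht
  have hT := torsion_lower hΩ hb hne ht
  set M := (volume Ω).toReal with hMd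
  have hM : 0 < M := ENNReal.toReal_pos (hΩ.measure_pos volume hne).ne' hb.measure_lt_top.ne
  unfold Fq
  rw [← hMd, ge_iff_le, le_div_iff₀ (by positivity), ← Real.sqrt_eq_rpow]
  have e1 : M ^ (2 * (1/2:ℝ) + 1/2) = Real.sqrt (M ^ 3) := by
    rw [Real.sqrt_eq_rpow, ← Real.rpow_natCast, ← Real.rpow_mul hM.le]; norm_num
  rw [e1]
  have h2 : Real.sqrt (M ^ 3 / (3 * perimeter Ω ^ 2)) ≤ Real.sqrt (torsion Ω) := Real.sqrt_le_sqrt hT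
  have e2 : Real.sqrt (M ^ 3 / (3 * perimeter Ω ^ 2)) = Real.sqrt (M ^ 3) / (Real.sqrt 3 * perimeter Ω) := by
    rw [Real.sqrt_div (by positivity), Real.sqrt_mul (by norm_num), Real.sqrt_sq hP0.le]
  rw [e2] at h2
  calc _ = perimeter Ω * (Real.sqrt (M ^ 3) / (Real.sqrt 3 * perimeter Ω)) := by field_simp
    _ ≤ _ := mul_le_mul_of_nonneg_left h2 hP0.le

/-! ### Lipschitz domains -/

lemma QProp_of_memA {Ω : Set E2} (h : memA 1 Ω) : QProp Ωᶜ := by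
  obtain ⟨_, _, _, hfin, hcard⟩ := h
  have hsub : (boundedComponents Ωᶜ).Subsingleton := by
    intro A hA B hB
    exact (ncard_le_one hfin).1 hcard A hA B hB
  have hconst : ∀ F : E2 → ℝ, (∀ z ∈ Ωᶜ, ∀ᶠ z' in 𝓝[Ωᶜ] z, F z' = F z) → ∀ z ∈ Ωᶜ,
      ∀ w ∈ connectedComponentIn Ωᶜ z, F w = F z := by
    intro F hF z hz w hw
    refine const_of_preconn (isPreconnected_connectedComponentIn (x := z) (F := Ωᶜ)) ?_ hw (mem_connectedComponentIn hz)
    intro a ha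
    have hs := connectedComponentIn_subset Ωᶜ z
    exact (hF a (hs ha)).filter_mono (nhdsWithin_mono _ hs)
  have hbdd : ∀ F : E2 → ℝ, (∀ z ∈ Ωᶜ, ∀ᶠ z' in 𝓝[Ωᶜ] z, F z' = F z) →
      (∃ M : ℝ, ∀ z ∈ Ωᶜ, M < ‖z‖ → F z = 0) → ∀ z ∈ Ωᶜ, F z ≠ 0 → IsBounded (connectedComponentIn Ωᶜ z) := by
    rintro F hF ⟨M, hM⟩ z hz hz0
    rw [isBounded_iff_forall_norm_le]
    refine ⟨M, fun w hw => ?_⟩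
    by_contra hlt
    push Not at hlt
    apply hz0
    rw [← hconst F hF z hz w hw]
    exact hM w (connectedComponentIn_subset _ _ hw) hlt
  by_cases hne : ∃ x ∈ Ωᶜ, IsBounded (connectedComponentIn Ωᶜ x)
  · obtain ⟨h, hh, hhb⟩ := hne
    refine ⟨h, fun F hF hM hFh z hz => ?_⟩
    by_contra hz0
    have e := hsub ⟨z, hz, rfl, hbdd F hF hM z hz hz0⟩ ⟨h, hh, rfl, hhb⟩
    apply hz0
    have := mem_connectedComponentIn hz
    rw [e] at this
    rw [hconst F hF h hh z this, hFh]
  · refine ⟨0, fun F hF hM _ z hz => ?_⟩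
    by_contra hz0
    exact hne ⟨z, hz, hbdd F hF hM z hz hz0⟩

lemma countable_localMax_values (h : ℝ → ℝ) : {c | ∃ x, IsLocalMax h x ∧ h x = c}.Countable := by
  have : {c | ∃ x, IsLocalMax h x ∧ h x = c} ⊆
      ⋃ q : ℚ × ℚ, {c | ∃ x, x ∈ Ioo (q.1:ℝ) q.2 ∧ (∀ y ∈ Ioo (q.1:ℝ) q.2, h y ≤ h x) ∧ h x = c} := by
    rintro c ⟨x, hx, rfl⟩
    obtain ⟨l, u, ⟨hl, hu⟩, hsub⟩ := mem_nhds_iff_exists_Ioo_subset.1 hx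
    obtain ⟨q, q1, q2⟩ := exists_rat_btwn hl
    obtain ⟨r, r1, r2⟩ := exists_rat_btwn hu
    refine mem_iUnion.2 ⟨(q, r), x, ⟨q2, r1⟩, fun y hy => ?_, rfl⟩
    exact hsub ⟨q1.trans hy.1, hy.2.trans r2⟩
  refine Countable.mono this (countable_iUnion fun q => Subsingleton.countable ?_)
  rintro _ ⟨x, hx, hx', rfl⟩ _ ⟨y, hy, hy', rfl⟩
  exact le_antisymm (hy' x hx) (hx' y hy)

section chart
variable {Ω : Set E2} {x : E2} {g : E2 ≃ₗᵢ[ℝ] E2} {f : ℝ → ℝ} {K : NNReal} {ε : ℝ}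

lemma chart_mem (h : Ω ∩ ball x ε = {y ∈ ball x ε | f ((g (y - x)) 0) < (g (y - x)) 1}) {w : E2}
    (hw : w ∈ ball x ε) : w ∈ Ω ↔ f ((g (w - x)) 0) < (g (w - x)) 1 := by
  have := Set.ext_iff.1 h w
  rw [mem_inter_iff] at this
  exact ⟨fun h => (this.1 ⟨h, hw⟩).2, fun h => (this.2 ⟨hw, h⟩).1⟩

lemma chart_ext (hf : LipschitzWith K f)
    (h : Ω ∩ ball x ε = {y ∈ ball x ε | f ((g (y - x)) 0) < (g (y - x)) 1}) {w : E2}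
    (hw : w ∈ ball x ε) (hlt : (g (w - x)) 1 < f ((g (w - x)) 0)) : w ∈ interior Ωᶜ := by
  have hc := hf.continuous
  rw [mem_interior]
  refine ⟨ball x ε ∩ {w | (g (w - x)) 1 < f ((g (w - x)) 0)}, ?_, isOpen_ball.inter ?_, hw, hlt⟩
  · rintro z ⟨hz, hz'⟩ hzΩ
    have := (chart_mem h hz).1 hzΩ
    rw [mem_ofPred_eq] at hz'
    linarith
  · exact isOpen_lt (by fun_prop) (by fun_prop)

lemma bad_countable (hf : LipschitzWith K f)
    (h : Ω ∩ ball x ε = {y ∈ ball x ε | f ((g (y - x)) 0) < (g (y - x)) 1}) {v : E2} (hv : ‖v‖ = 1) :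
    {p : ℝ | ∃ z : ℝ, p • perp v + z • v ∈ ball x ε ∧ p • perp v + z • v ∉ Ω ∧
      ∀ᶠ s : ℝ in 𝓝 z, p • perp v + s • v ∉ interior Ωᶜ}.Countable := by
  set a := (g v) 0 with ha
  set b := (g v) 1 with hb
  set a' := (g (perp v)) 0 with ha'
  set b' := (g (perp v)) 1 with hb'
  set X0 := (g x) 0 with hX0
  set Y0 := (g x) 1 with hY0
  have hab : a ^ 2 + b ^ 2 = 1 := unit_sq (by rw [g.norm_map, hv])
  have hcoord : ∀ p z : ℝ, (g (p • perp v + z • v - x)) 0 = p * a' + z * a - X0 ∧ (g (p • perp v + z • v - x)) 1 = p * b' + z * b - Y0 := by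
    intro p z
    simp [map_sub, map_add, map_smul, a, b, a', b', X0, Y0]
  have hdet : a * b' - b * a' ≠ 0 := by
    intro h0
    have hperp : ‖perp v‖ = 1 := by
      have h1 := norm_sq_E2 (perp v)
      have h2 := unit_sq hv
      simp only [perp_zero, perp_one] at h1
      have h3 : ‖perp v‖ ^ 2 = 1 := by rw [h1]; linarith
      nlinarith [norm_nonneg (perp v), sq_nonneg (‖perp v‖ - 1)]
    have h4 : a' ^ 2 + b' ^ 2 = 1 := unit_sq (by rw [g.norm_map, hperp])
    have h5 : inner ℝ (g v) (g (perp v)) = 0 := by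
      rw [g.inner_map_map]
      simp [PiLp.inner_apply, Fin.sum_univ_two]; ring
    have h6 : a * a' + b * b' = 0 := by
      simp only [PiLp.inner_apply, Fin.sum_univ_two, RCLike.inner_apply, conj_trivial] at h5
      linear_combination h5
    have : (a * b' - b * a') ^ 2 + (a * a' + b * b') ^ 2 = (a ^ 2 + b ^ 2) * (a' ^ 2 + b' ^ 2) := by ring
    rw [h0, h6, hab, h4] at this
    norm_num at this
  have hfacts : ∀ p z : ℝ, p • perp v + z • v ∈ ball x ε → p • perp v + z • v ∉ Ω →
      (∀ᶠ s : ℝ in 𝓝 z, p • perp v + s • v ∉ interior Ωᶜ) →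
      f (p * a' + z * a - X0) = p * b' + z * b - Y0 ∧ ∀ᶠ s : ℝ in 𝓝 z, f (p * a' + s * a - X0) ≤ p * b' + s * b - Y0 := by
    intro p z h1 h2 h3
    have hnear : ∀ᶠ s : ℝ in 𝓝 z, p • perp v + s • v ∈ ball x ε :=
      (Continuous.tendsto (by fun_prop : Continuous fun s : ℝ => p • perp v + s • v) z).eventually (isOpen_ball.mem_nhds h1)
    have hev : ∀ᶠ s : ℝ in 𝓝 z, f (p * a' + s * a - X0) ≤ p * b' + s * b - Y0 := by
      filter_upwards [h3, hnear] with s hs hs'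
      by_contra hlt
      push Not at hlt
      apply hs
      apply chart_ext hf h hs'
      rw [(hcoord p s).1, (hcoord p s).2]
      exact hlt
    refine ⟨le_antisymm hev.self_of_nhds ?_, hev⟩
    rw [chart_mem h h1, (hcoord p z).1, (hcoord p z).2] at h2
    linarith
  by_cases ha0 : a = 0
  · convert countable_empty
    rw [eq_empty_iff_forall_notMem]
    rintro p ⟨z, h1, h2, h3⟩
    obtain ⟨e1, e2⟩ := hfacts p z h1 h2 h3
    simp only [ha0, mul_zero, add_zero] at e1 e2
    have hb0 : b ≠ 0 := by
      rintro h0; rw [ha0, h0] at hab; norm_num at hab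
    obtain ⟨δ, hδ, hball⟩ := Metric.eventually_nhds_iff.1 e2
    have h5 := hball (y := z - (δ / 2) * SignType.sign b) (by
      rw [Real.dist_eq, sub_sub_cancel_left, abs_neg, abs_mul]
      have : |((SignType.sign b : SignType) : ℝ)| = 1 := by
        rcases lt_or_gt_of_ne hb0 with hlt | hlt
        · simp [sign_neg hlt]
        · simp [sign_pos hlt]
      rw [this, abs_of_pos (by linarith)]; linarith)
    rw [e1] at h5
    have h6 : 0 < (SignType.sign b : ℝ) * b := by
      rw [sign_mul_self]; exact abs_pos.2 hb0
    nlinarith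
  · have hsub : {p : ℝ | ∃ z : ℝ, p • perp v + z • v ∈ ball x ε ∧ p • perp v + z • v ∉ Ω ∧
      ∀ᶠ s : ℝ in 𝓝 z, p • perp v + s • v ∉ interior Ωᶜ} ⊆
      (fun p : ℝ => (p * b' - Y0) - b / a * (p * a' - X0)) ⁻¹' {c | ∃ X, IsLocalMax (fun X => f X - b / a * X) X ∧ f X - b / a * X = c} := by
      rintro p ⟨z, h1, h2, h3⟩
      obtain ⟨e1, e2⟩ := hfacts p z h1 h2 h3
      refine ⟨p * a' + z * a - X0, ?_, ?_⟩
      · have hc : Tendsto (fun X : ℝ => (X - (p * a' - X0)) / a) (𝓝 (p * a' + z * a - X0)) (𝓝 z) := by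
          have := (Continuous.tendsto (by fun_prop : Continuous fun X : ℝ => (X - (p * a' - X0)) / a) (p * a' + z * a - X0))
          have e : (p * a' + z * a - X0 - (p * a' - X0)) / a = z := by field_simp; ring
          rwa [e] at this
        filter_upwards [hc.eventually e2] with X hX
        rw [e1]
        have e : p * a' + (X - (p * a' - X0)) / a * a - X0 = X := by field_simp; ring
        rw [e] at hX
        have e' : p * b' + (X - (p * a' - X0)) / a * b - Y0 - b / a * X = p * b' + z * b - Y0 - b / a * (p * a' + z * a - X0) := by
          field_simp; ring
        linarith
      · rw [e1]; field_simp; ring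
    refine Countable.mono hsub ((countable_localMax_values _).preimage_of_injOn ?_)
    intro p _ q _ hpq
    simp only at hpq
    have : (p - q) * (a * b' - b * a') = 0 := by
      field_simp at hpq
      linear_combination hpq
    rcases mul_eq_zero.1 this with h0 | h0
    · linarith
    · exact absurd h0 hdet
end chart

lemma goodSlices_of_lipschitz {Ω : Set E2} (hΩ : IsOpen Ω) (hb : IsBounded Ω) (hL : IsLipschitzDomain Ω) {v : E2}
    (hv : ‖v‖ = 1) : GoodSlices Ω v := by
  have hcomp : IsCompact (frontier Ω) := hb.isCompact_closure.of_isClosed_subset isClosed_frontier frontier_subset_closure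
  choose! g f K ε hε hf hch using hL
  obtain ⟨t, htf, hcov⟩ := hcomp.elim_nhds_subcover (fun x => ball x (ε x)) (fun x hx => ball_mem_nhds x (hε x hx))
  have hcount : (⋃ x ∈ t, {p : ℝ | ∃ z : ℝ, p • perp v + z • v ∈ ball x (ε x) ∧ p • perp v + z • v ∉ Ω ∧
      ∀ᶠ s : ℝ in 𝓝 z, p • perp v + s • v ∉ interior Ωᶜ}).Countable :=
    t.countable_toSet.biUnion fun x hx => bad_countable (hf x (htf x hx)) (hch x (htf x hx)) hv
  have hnull := hcount.ae_notMem volume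
  unfold GoodSlices
  filter_upwards [hnull] with p hp y y' hyy' hy hy' hz
  by_contra hcon
  push Not at hcon
  obtain ⟨z, z1, z2, z3⟩ := hz
  apply hp
  have hfr : p • perp v + z • v ∈ frontier Ω := by
    rw [hΩ.frontier_eq]
    refine ⟨?_, z3⟩
    have := hcon z z1 z2
    rw [interior_compl] at this
    simpa using this
  obtain ⟨x, hx, hxb⟩ := mem_iUnion₂.1 (hcov hfr)
  refine mem_iUnion₂.2 ⟨x, hx, z, hxb, z3, ?_⟩
  filter_upwards [Ioo_mem_nhds z1 z2] with s hs
  exact hcon s hs.1 hs.2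

/-! ### Finite perimeter -/

lemma norm_le_phi_fst {v : E2} (hv : ‖v‖ = 1) (p y : ℝ) : |p| ≤ ‖p • perp v + y • v‖ := by
  have h := unit_sq hv
  rw [← sq_le_sq₀ (abs_nonneg _) (norm_nonneg _), norm_sq_E2, sq_abs]
  simp only [PiLp.add_apply, PiLp.smul_apply, perp_zero, perp_one, smul_eq_mul]
  nlinarith [sq_nonneg y]

lemma fderiv_integrable {ψ : E2 → ℝ} (h1 : ContDiff ℝ 1 ψ) (h2 : HasCompactSupport ψ) (v : E2) :
    Integrable (fun x => fderiv ℝ ψ x v) := by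
  have hc : Continuous (fun x => fderiv ℝ ψ x v) := (h1.continuous_fderiv one_ne_zero).clm_apply continuous_const
  exact hc.integrable_of_hasCompactSupport (h2.fderiv_apply (𝕜 := ℝ) v)

lemma slice_hasDeriv {ψ : E2 → ℝ} (h1 : ContDiff ℝ 1 ψ) (v : E2) (p y : ℝ) :
    HasDerivAt (fun y : ℝ => ψ (p • perp v + y • v)) (fderiv ℝ ψ (p • perp v + y • v) v) y := by
  have h := (h1.differentiable one_ne_zero (p • perp v + y • v)).hasFDerivAt
  have h' : HasDerivAt (fun y : ℝ => p • perp v + y • v) v y := by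
    simpa using ((hasDerivAt_id y).smul_const v).const_add (p • perp v)
  exact h.comp_hasDerivAt y h'

lemma slice_compact {ψ : E2 → ℝ} (h2 : HasCompactSupport ψ) {v : E2} (hv : ‖v‖ = 1) (p : ℝ) :
    HasCompactSupport (fun y : ℝ => ψ (p • perp v + y • v)) := by
  obtain ⟨R, hR⟩ := h2.isCompact.isBounded.exists_norm_le
  refine HasCompactSupport.intro (isCompact_Icc (a := -R) (b := R)) fun y hy => ?_
  by_contra h
  have := hR _ (subset_tsupport _ (Function.mem_support.2 h))
  exact hy (abs_le.1 ((norm_le_phi_snd hv p y).trans this))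

lemma slice_contDiff {ψ : E2 → ℝ} (h1 : ContDiff ℝ 1 ψ) (v : E2) (p : ℝ) :
    ContDiff ℝ 1 (fun y : ℝ => ψ (p • perp v + y • v)) :=
  h1.comp (contDiff_const.add (contDiff_id.smul contDiff_const))

lemma slice_int {Ω : Set E2} (hΩ : IsOpen Ω) {v : E2} (hv : ‖v‖ = 1) {ψ : E2 → ℝ} (h1 : ContDiff ℝ 1 ψ)
    (h2 : HasCompactSupport ψ) {N : ℝ → ℝ} (hN : Integrable N)
    (h : ∀ p : ℝ, |∫ y in {y : ℝ | p • perp v + y • v ∈ Ω}, deriv (fun y : ℝ => ψ (p • perp v + y • v)) y| ≤ N p) :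
    |∫ x in Ω, fderiv ℝ ψ x v| ≤ ∫ p, N p := by
  set G := Ω.indicator (fun x => fderiv ℝ ψ x v) with hG
  have hGi : Integrable G := (fderiv_integrable h1 h2 v).indicator hΩ.measurableSet
  have e0 := (phi_mp v hv).integral_comp (phi_emb v hv) G
  rw [← integral_indicator hΩ.measurableSet, ← hG, ← e0]
  have hGi' : Integrable (fun z => G (phi v z)) := (phi_mp v hv).integrable_comp_emb (phi_emb v hv) |>.2 hGi
  rw [Measure.volume_eq_prod] at hGi' ⊢
  rw [integral_prod _ hGi']
  rw [← Real.norm_eq_abs]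
  refine (norm_integral_le_of_norm_le hN (Eventually.of_forall fun p => ?_))
  refine le_of_eq_of_le ?_ (h p)
  rw [Real.norm_eq_abs]
  congr 1
  have hm : MeasurableSet {y : ℝ | p • perp v + y • v ∈ Ω} :=
    hΩ.measurableSet.preimage (by fun_prop : Measurable fun y : ℝ => p • perp v + y • v)
  rw [← integral_indicator hm]
  congr 1
  ext y
  by_cases hy : p • perp v + y • v ∈ Ω
  · rw [hG, indicator_of_mem (by exact hy), indicator_of_mem (by exact hy), (slice_hasDeriv h1 v p y).deriv]; rfl
  · rw [hG, indicator_of_notMem (by exact hy), indicator_of_notMem (by exact hy)]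

lemma upper_int {h : ℝ → ℝ} (h1 : ContDiff ℝ 1 h) (h2 : HasCompactSupport h) (h3 : ∀ y, |h y| ≤ 1) {A : Set ℝ}
    (hA : ∀ a ∈ A, ∀ b, a ≤ b → b ∈ A) : |∫ y in A, deriv h y| ≤ 1 := by
  rcases A.eq_empty_or_nonempty with rfl | hne
  · simp
  by_cases hb : BddBelow A
  · have hae : A =ᵐ[volume] Ioi (sInf A) := by
      have h4 : Ioi (sInf A) ⊆ A := by
        intro y hy
        obtain ⟨a, ha, hay⟩ := exists_lt_of_csInf_lt hne hy
        exact hA a ha y hay.le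
      have h5 : A ⊆ Ici (sInf A) := fun a ha => csInf_le hb ha
      refine (LE.le.eventuallyLE h5).antisymm ?_ |>.trans Ioi_ae_eq_Ici.symm
      exact (Ioi_ae_eq_Ici (μ := (volume : Measure ℝ)) (a := sInf A)).symm.le.trans (LE.le.eventuallyLE h4)
    rw [setIntegral_congr_set hae, h2.integral_Ioi_deriv_eq h1, abs_neg]
    exact h3 _
  · have : A = univ := by
      rw [eq_univ_iff_forall]
      intro y
      rw [not_bddBelow_iff] at hb
      obtain ⟨a, ha, hay⟩ := hb y
      exact hA a ha y hay.le
    rw [this, Measure.restrict_univ, integral_eq_zero_of_hasDerivAt_of_integrable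
      (fun y => (h1.differentiable one_ne_zero y).hasDerivAt)
      ((h1.continuous_deriv le_rfl).integrable_of_hasCompactSupport h2.deriv) (h1.continuous.integrable_of_hasCompactSupport h2)]
    simp

/-- bounded variation of `Ω` in `B` in the direction `e` -/
def DirBd (Ω B : Set E2) (e : E2) : Prop :=
  ∃ C : ℝ, ∀ ψ : E2 → ℝ, ContDiff ℝ 1 ψ → HasCompactSupport ψ → tsupport ψ ⊆ B → (∀ x, |ψ x| ≤ 1) →
    |∫ x in Ω, fderiv ℝ ψ x e| ≤ C

lemma DirBd.add {Ω B : Set E2} {e e' : E2} (h : DirBd Ω B e) (h' : DirBd Ω B e') : DirBd Ω B (e + e') := by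
  obtain ⟨C, hC⟩ := h
  obtain ⟨C', hC'⟩ := h'
  refine ⟨C + C', fun ψ a b c d => ?_⟩
  simp only [map_add]
  rw [integral_add (fderiv_integrable a b _).integrableOn (fderiv_integrable a b _).integrableOn]
  exact (abs_add_le _ _).trans (add_le_add (hC ψ a b c d) (hC' ψ a b c d))

lemma DirBd.smul {Ω B : Set E2} {e : E2} (h : DirBd Ω B e) (r : ℝ) : DirBd Ω B (r • e) := by
  obtain ⟨C, hC⟩ := h
  refine ⟨|r| * C, fun ψ a b c d => ?_⟩
  simp only [map_smul, smul_eq_mul]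
  rw [integral_const_mul, abs_mul]
  exact mul_le_mul_of_nonneg_left (hC ψ a b c d) (abs_nonneg r)

lemma dirBd_of_up {Ω B : Set E2} (hΩ : IsOpen Ω) (hB : IsBounded B) {v : E2} (hv : ‖v‖ = 1)
    (hup : ∀ w ∈ Ω, w ∈ B → ∀ τ : ℝ, 0 ≤ τ → w + τ • v ∈ B → w + τ • v ∈ Ω) : DirBd Ω B v := by
  classical
  obtain ⟨R, hR⟩ := hB.exists_norm_le
  refine ⟨∫ p, (Icc (-R) R).indicator (fun _ => (1:ℝ)) p, fun ψ h1 h2 h3 h4 => ?_⟩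
  refine slice_int hΩ hv h1 h2 ?_ fun p => ?_
  · exact (integrable_indicator_iff measurableSet_Icc).2 (integrableOn_const (by simp))
  have hsupp : ∀ y : ℝ, deriv (fun y : ℝ => ψ (p • perp v + y • v)) y ≠ 0 → p • perp v + y • v ∈ B := by
    intro y hy
    apply h3
    by_contra hn
    apply hy
    rw [(slice_hasDeriv h1 v p y).deriv]
    have : fderiv ℝ ψ (p • perp v + y • v) = 0 := by
      by_contra h0
      exact hn (support_fderiv_subset ℝ (Function.mem_support.2 h0))
    rw [this]; simp
  by_cases hp : p ∈ Icc (-R) R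
  · rw [indicator_of_mem hp]
    have hm : MeasurableSet {y : ℝ | p • perp v + y • v ∈ Ω} :=
      hΩ.measurableSet.preimage (by fun_prop : Measurable fun y : ℝ => p • perp v + y • v)
    set A' : Set ℝ := {y | ∃ y1 ≤ y, p • perp v + y1 • v ∈ Ω ∧ p • perp v + y1 • v ∈ B} with hA'
    have hup' : ∀ a ∈ A', ∀ b, a ≤ b → b ∈ A' := by
      rintro a ⟨y1, h, h'⟩ b hab
      exact ⟨y1, h.trans hab, h'⟩
    have hA'm : MeasurableSet A' := by
      have : A'.OrdConnected := ⟨fun a ha b _ y hy => hup' a ha y hy.1⟩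
      exact this.measurableSet
    have : ∫ y in {y : ℝ | p • perp v + y • v ∈ Ω}, deriv (fun y : ℝ => ψ (p • perp v + y • v)) y =
        ∫ y in A', deriv (fun y : ℝ => ψ (p • perp v + y • v)) y := by
      rw [← integral_indicator hm, ← integral_indicator hA'm]
      refine integral_congr_ae (Eventually.of_forall fun y => ?_)
      show indicator _ _ y = indicator _ _ y
      by_cases h0 : deriv (fun y : ℝ => ψ (p • perp v + y • v)) y = 0
      · rw [Set.indicator_apply, Set.indicator_apply, h0, ite_self, ite_self]
      have hyB := hsupp y h0
      have : y ∈ {y : ℝ | p • perp v + y • v ∈ Ω} ↔ y ∈ A' := by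
        constructor
        · intro hy; exact ⟨y, le_rfl, hy, hyB⟩
        · rintro ⟨y1, hy1, h5, h6⟩
          have e : p • perp v + y • v = (p • perp v + y1 • v) + (y - y1) • v := by module
          rw [mem_ofPred_eq, e]
          rw [e] at hyB
          exact hup _ h5 h6 _ (by linarith) hyB
      simp only [Set.indicator_apply, this]
    rw [this]
    exact upper_int (slice_contDiff h1 v p) (slice_compact h2 hv p) (fun y => h4 _) hup'
  · rw [indicator_of_notMem hp]
    have : ∀ y : ℝ, deriv (fun y : ℝ => ψ (p • perp v + y • v)) y = 0 := by
      intro y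
      by_contra h0
      exact hp (abs_le.1 ((norm_le_phi_fst hv p y).trans (hR _ (hsupp y h0))))
    simp [this]

lemma dirBd_of_up' {Ω B : Set E2} (hΩ : IsOpen Ω) (hB : IsBounded B) {v : E2}
    (hup : ∀ w ∈ Ω, w ∈ B → ∀ τ : ℝ, 0 ≤ τ → w + τ • v ∈ B → w + τ • v ∈ Ω) : DirBd Ω B v := by
  by_cases hv : v = 0
  · exact ⟨0, fun ψ _ _ _ _ => by simp [hv]⟩
  have hn : ‖v‖ ≠ 0 := norm_ne_zero_iff.2 hv
  have e : v = ‖v‖ • (‖v‖⁻¹ • v) := by rw [smul_smul, mul_inv_cancel₀ hn, one_smul]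
  rw [e]
  refine (dirBd_of_up hΩ hB (by rw [norm_smul, norm_inv, norm_norm, inv_mul_cancel₀ hn]) ?_).smul _
  intro w hw hwB τ hτ
  rw [smul_smul]
  exact hup w hw hwB _ (by positivity)

lemma exists_dirBd {Ω : Set E2} (hΩ : IsOpen Ω) (hL : IsLipschitzDomain Ω) (x : E2) :
    ∃ ε > 0, ∀ e : E2, DirBd Ω (ball x ε) e := by
  by_cases hx : x ∈ frontier Ω
  · obtain ⟨g, f, K, ε, hε, hf, hch⟩ := hL x hx
    refine ⟨ε, hε, fun e => ?_⟩
    have key : ∀ u : E2, K * |(g u) 0| ≤ (g u) 1 → DirBd Ω (ball x ε) u := by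
      intro u hu
      refine dirBd_of_up' hΩ isBounded_ball ?_
      intro w hw hwB τ hτ hwB'
      rw [chart_mem hch hwB']
      rw [chart_mem hch hwB] at hw
      have e0 : g (w + τ • u - x) = g (w - x) + τ • g u := by
        rw [← map_smul, ← map_add]; congr 1; module
      rw [e0]
      simp only [PiLp.add_apply, PiLp.smul_apply, smul_eq_mul]
      have h5 := hf.dist_le_mul ((g (w - x)) 0 + τ * (g u) 0) ((g (w - x)) 0)
      rw [Real.dist_eq, Real.dist_eq, add_sub_cancel_left, abs_mul, abs_of_nonneg hτ] at h5
      have h6 := le_abs_self (f ((g (w - x)) 0 + τ * (g u) 0) - f ((g (w - x)) 0))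
      nlinarith
    have h1 := key (g.symm !₂[0, 1]) (by simp)
    have h2 := key (g.symm !₂[1, (K:ℝ)]) (by simp)
    have e1 : e = ((g e) 0) • g.symm !₂[1, (K:ℝ)] + ((g e) 1 - (g e) 0 * K) • g.symm !₂[0, 1] := by
      apply g.injective
      rw [map_add, map_smul, map_smul, g.apply_symm_apply, g.apply_symm_apply]
      ext i
      fin_cases i <;> simp
    rw [e1]
    exact (h2.smul _).add (h1.smul _)
  · have : x ∈ Ω ∨ x ∈ (closure Ω)ᶜ := by
      rw [hΩ.frontier_eq] at hx
      by_contra hcon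
      push Not at hcon
      exact hx ⟨by simpa using hcon.2, hcon.1⟩
    rcases this with h | h
    · obtain ⟨ε, hε, hs⟩ := Metric.isOpen_iff.1 hΩ x h
      exact ⟨ε, hε, fun e => dirBd_of_up' hΩ isBounded_ball fun w _ _ τ _ h' => hs h'⟩
    · obtain ⟨ε, hε, hs⟩ := Metric.isOpen_iff.1 isClosed_closure.isOpen_compl x h
      exact ⟨ε, hε, fun e => dirBd_of_up' hΩ isBounded_ball fun w hw hwB τ _ h' => absurd (subset_closure hw) (hs hwB)⟩

lemma coord_contDiff {φ : E2 → E2} (h1 : ContDiff ℝ 1 φ) (i : Fin 2) : ContDiff ℝ 1 (fun x => φ x i) :=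
  (EuclideanSpace.proj (𝕜 := ℝ) i).contDiff.comp h1

lemma coord_compact {φ : E2 → E2} (h2 : HasCompactSupport φ) (i : Fin 2) : HasCompactSupport (fun x => φ x i) :=
  h2.comp_left (g := fun x : E2 => x i) (by simp)

lemma coord_tsupport (φ : E2 → E2) (i : Fin 2) : tsupport (fun x => φ x i) ⊆ tsupport φ := by
  apply closure_mono
  intro x hx h0
  apply hx
  simp [h0]

lemma coord_abs_le (w : E2) (i : Fin 2) : |w i| ≤ ‖w‖ := by
  simpa using PiLp.norm_apply_le w i

lemma divg_eq_coord {φ : E2 → E2} (h1 : ContDiff ℝ 1 φ) (x : E2) :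
    divg φ x = fderiv ℝ (fun x => φ x 0) x (EuclideanSpace.single 0 1) + fderiv ℝ (fun x => φ x 1) x (EuclideanSpace.single 1 1) := by
  have key : ∀ i : Fin 2, ∀ w, fderiv ℝ (fun x => φ x i) x w = fderiv ℝ φ x w i := by
    intro i w
    have h := (EuclideanSpace.proj (𝕜 := ℝ) i).hasFDerivAt.comp x (h1.differentiable one_ne_zero x).hasFDerivAt
    have h' := h.fderiv
    have e : (⇑(EuclideanSpace.proj (𝕜 := ℝ) i) ∘ φ) = fun x => φ x i := rfl
    rw [e] at h'
    rw [h']; rfl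
  unfold divg
  rw [Fin.sum_univ_two, key, key]

lemma divg_int_eq {Ω : Set E2} {φ : E2 → E2} (h1 : ContDiff ℝ 1 φ) (h2 : HasCompactSupport φ) :
    ∫ x in Ω, divg φ x = (∫ x in Ω, fderiv ℝ (fun x => φ x 0) x (EuclideanSpace.single 0 1)) +
      ∫ x in Ω, fderiv ℝ (fun x => φ x 1) x (EuclideanSpace.single 1 1) := by
  simp only [divg_eq_coord h1]
  exact integral_add (fderiv_integrable (coord_contDiff h1 0) (coord_compact h2 0) _).integrableOn
    (fderiv_integrable (coord_contDiff h1 1) (coord_compact h2 1) _).integrableOn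

lemma divg_integrable {φ : E2 → E2} (h1 : ContDiff ℝ 1 φ) (h2 : HasCompactSupport φ) : Integrable (divg φ) := by
  have : divg φ = fun x => fderiv ℝ (fun x => φ x 0) x (EuclideanSpace.single 0 1) + fderiv ℝ (fun x => φ x 1) x (EuclideanSpace.single 1 1) :=
    funext fun x => divg_eq_coord h1 x
  rw [this]
  exact (fderiv_integrable (coord_contDiff h1 0) (coord_compact h2 0) _).add
    (fderiv_integrable (coord_contDiff h1 1) (coord_compact h2 1) _)

lemma divBd_of_dirBd {Ω B : Set E2} (h : ∀ e, DirBd Ω B e) : ∃ C : ℝ, ∀ φ : E2 → E2, ContDiff ℝ 1 φ →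
    HasCompactSupport φ → tsupport φ ⊆ B → (∀ x, ‖φ x‖ ≤ 1) → ∫ x in Ω, divg φ x ≤ C := by
  obtain ⟨C0, h0⟩ := h (EuclideanSpace.single 0 1)
  obtain ⟨C1, h1⟩ := h (EuclideanSpace.single 1 1)
  refine ⟨C0 + C1, fun φ a b c d => ?_⟩
  rw [divg_int_eq a b]
  refine add_le_add ((le_abs_self _).trans (h0 _ (coord_contDiff a 0) (coord_compact b 0) ((coord_tsupport φ 0).trans c) fun x => (coord_abs_le _ _).trans (d x)))
    ((le_abs_self _).trans (h1 _ (coord_contDiff a 1) (coord_compact b 1) ((coord_tsupport φ 1).trans c) fun x => (coord_abs_le _ _).trans (d x)))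

open scoped Manifold in
theorem perim_bdd_of_lipschitz {Ω : Set E2} (hΩ : IsOpen Ω) (hb : IsBounded Ω) (hL : IsLipschitzDomain Ω) :
    BddAbove (perimSet Ω) := by
  choose ε hε hdir using exists_dirBd hΩ hL
  have hd := fun x => divBd_of_dirBd (hdir x)
  choose C hC using hd
  obtain ⟨t, _, ht⟩ := hb.isCompact_closure.elim_nhds_subcover (fun x => ball x (ε x)) (fun x _ => ball_mem_nhds x (hε x))
  obtain ⟨F, hF⟩ := SmoothPartitionOfUnity.exists_isSubordinate 𝓘(ℝ, E2) (isClosed_closure (s := Ω))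
    (fun i : t => ball (i : E2) (ε i)) (fun _ => isOpen_ball) (by
      intro x hx
      obtain ⟨i, hi, hx'⟩ := mem_iUnion₂.1 (ht hx)
      exact mem_iUnion.2 ⟨⟨i, hi⟩, hx'⟩)
  have hFc : ∀ i, ContDiff ℝ 1 (fun x => F i x) := by
    intro i
    have h : ContMDiff 𝓘(ℝ, E2) 𝓘(ℝ, ℝ) (↑(⊤ : ℕ∞)) (fun x => F i x) := (F i).contMDiff
    rw [contMDiff_iff_contDiff] at h
    exact h.of_le (by norm_num)
  refine ⟨∑ i : t, C i, ?_⟩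
  rintro r ⟨φ, h1, h2, h3, rfl⟩
  have hc1 : ∀ i, ContDiff ℝ 1 (fun x => F i x • φ x) := fun i => (hFc i).smul h1
  have hc2 : ∀ i, HasCompactSupport (fun x => F i x • φ x) := fun i => HasCompactSupport.smul_left (f := fun x => F i x) h2
  have hsum : ∀ x ∈ Ω, divg φ x = ∑ i, divg (fun x => F i x • φ x) x := by
    intro x hx
    have hev : φ =ᶠ[𝓝 x] fun x => ∑ i, F i x • φ x := by
      filter_upwards [hΩ.mem_nhds hx] with y hy
      rw [← Finset.sum_smul, ← finsum_eq_sum_of_fintype, F.sum_eq_one (subset_closure hy), one_smul]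
    unfold divg
    rw [hev.fderiv_eq, fderiv_fun_sum (fun i _ => (hc1 i).differentiable one_ne_zero x), Finset.sum_comm]
    simp
  rw [setIntegral_congr_fun hΩ.measurableSet hsum, integral_finsetSum _ fun i _ => (divg_integrable (hc1 i) (hc2 i)).integrableOn]
  refine Finset.sum_le_sum fun i _ => hC i _ (hc1 i) (hc2 i) ?_ ?_
  · exact (closure_mono (Function.support_smul_subset_left _ _)).trans (hF i)
  · intro x
    rw [norm_smul, Real.norm_eq_abs, abs_of_nonneg (F.nonneg i x)]
    exact mul_le_one₀ (F.le_one i x) (norm_nonneg _) (h3 x)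

/-! ### Rectangles -/

/-- the rectangle `(0,a) × (0,b)` -/
def Rct (a b : ℝ) : Set E2 := {x : E2 | x 0 ∈ Ioo (0:ℝ) a ∧ x 1 ∈ Ioo (0:ℝ) b}

lemma rct_open (a b : ℝ) : IsOpen (Rct a b) := by
  have h0 : Continuous fun x : E2 => x 0 := by fun_prop
  have h1 : Continuous fun x : E2 => x 1 := by fun_prop
  exact (isOpen_Ioo.preimage h0).inter (isOpen_Ioo.preimage h1)

lemma rct_bdd (a b : ℝ) : IsBounded (Rct a b) := by
  rw [isBounded_iff_forall_norm_le]
  refine ⟨|a| + |b|, ?_⟩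
  rintro x ⟨⟨h1, h2⟩, h3, h4⟩
  have ha := le_abs_self a
  have hb := le_abs_self b
  rw [← sq_le_sq₀ (norm_nonneg _) (by positivity), norm_sq_E2]
  nlinarith

lemma rct_convex (a b : ℝ) : Convex ℝ (Rct a b) := by
  have h0 : Convex ℝ ((fun x : E2 => x 0) ⁻¹' Ioo (0:ℝ) a) :=
    (convex_Ioo (0:ℝ) a).linear_preimage (EuclideanSpace.proj (𝕜 := ℝ) (0 : Fin 2) : E2 →L[ℝ] ℝ).toLinearMap
  have h1 : Convex ℝ ((fun x : E2 => x 1) ⁻¹' Ioo (0:ℝ) b) :=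
    (convex_Ioo (0:ℝ) b).linear_preimage (EuclideanSpace.proj (𝕜 := ℝ) (1 : Fin 2) : E2 →L[ℝ] ℝ).toLinearMap
  exact h0.inter h1

lemma goodSlices_of_convex {Ω : Set E2} (h : Convex ℝ Ω) (v : E2) : GoodSlices Ω v := by
  refine Eventually.of_forall fun p y y' hyy' hy hy' hz => ?_
  obtain ⟨z, z1, z2, z3⟩ := hz
  exfalso
  apply z3
  have hd : 0 < y' - y := by linarith
  have := h hy hy' (a := (y' - z) / (y' - y)) (b := (z - y) / (y' - y)) (div_nonneg (by linarith) hd.le)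
    (div_nonneg (by linarith) hd.le) (by field_simp; ring)
  convert this using 1
  ext i
  simp only [PiLp.add_apply, PiLp.smul_apply, smul_eq_mul]
  field_simp
  ring

lemma rct_ray {a b : ℝ} {z : E2} (hz : z ∉ Rct a b) : ∃ e : E2, ‖e‖ = 1 ∧ ∀ t : ℝ, 0 ≤ t → z + t • e ∉ Rct a b := by
  by_cases h1 : z 0 ≤ 0
  · refine ⟨-EuclideanSpace.single 0 1, by simp, ?_⟩
    rintro t ht ⟨⟨h, _⟩, _⟩
    simp at h
    linarith
  by_cases h2 : a ≤ z 0
  · refine ⟨EuclideanSpace.single 0 1, by simp, ?_⟩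
    rintro t ht ⟨⟨_, h⟩, _⟩
    simp at h
    linarith
  by_cases h3 : z 1 ≤ 0
  · refine ⟨-EuclideanSpace.single 1 1, by simp, ?_⟩
    rintro t ht ⟨_, h, _⟩
    simp at h
    linarith
  by_cases h4 : b ≤ z 1
  · refine ⟨EuclideanSpace.single 1 1, by simp, ?_⟩
    rintro t ht ⟨_, _, h⟩
    simp at h
    linarith
  push Not at h1 h2 h3 h4
  exact absurd ⟨⟨h1, h2⟩, h3, h4⟩ hz

lemma rct_QProp (a b : ℝ) : QProp (Rct a b)ᶜ := by
  refine ⟨0, ?_⟩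
  rintro F hF ⟨M, hM⟩ _ z hz
  obtain ⟨e, he, hray⟩ := rct_ray hz
  have hpre : IsPreconnected ((fun t : ℝ => z + t • e) '' Ici 0) :=
    isPreconnected_Ici.image _ (by fun_prop)
  have hsub : (fun t : ℝ => z + t • e) '' Ici 0 ⊆ (Rct a b)ᶜ := by
    rintro _ ⟨t, ht, rfl⟩
    exact hray t ht
  set T := |M| + ‖z‖ + 1 with hT
  have hT0 : 0 ≤ T := by positivity
  have h1 : F z = F (z + T • e) := by
    refine const_of_preconn hpre (fun w hw => (hF w (hsub hw)).filter_mono (nhdsWithin_mono _ hsub)) ⟨0, self_mem_Ici, by simp⟩ ⟨T, hT0, rfl⟩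
  rw [h1]
  refine hM _ (hray T hT0) ?_
  have h2 : ‖T • e‖ ≤ ‖z + T • e‖ + ‖z‖ := by
    have := norm_sub_le (z + T • e) z
    rwa [add_sub_cancel_left] at this
  rw [norm_smul, he, mul_one, Real.norm_eq_abs, abs_of_nonneg hT0] at h2
  have := le_abs_self M
  linarith

lemma Ioo_int {h : ℝ → ℝ} (h1 : ContDiff ℝ 1 h) (h3 : ∀ y, |h y| ≤ 1) {c d : ℝ} (hcd : c ≤ d) :
    |∫ y in Ioo c d, deriv h y| ≤ 2 := by
  rw [← integral_Ioc_eq_integral_Ioo, ← intervalIntegral.integral_of_le hcd,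
    intervalIntegral.integral_deriv_eq_sub (fun y _ => h1.differentiable one_ne_zero y)
      ((h1.continuous_deriv le_rfl).intervalIntegrable _ _)]
  have := abs_sub (h d) (h c)
  have := h3 d
  have := h3 c
  linarith

lemma rct_perim_aux {a b : ℝ} (ha : 0 < a) (hb : 0 < b) : ∀ r ∈ perimSet (Rct a b), r ≤ 2 * a + 2 * b := by
  rintro r ⟨φ, h1, h2, h3, hr⟩
  rw [hr, divg_int_eq h1 h2]
  have hintg : ∀ c d : ℝ, Integrable ((Ioo c d).indicator fun _ => (2:ℝ)) := fun c d =>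
    (integrable_indicator_iff measurableSet_Ioo).2 (integrableOn_const (by simp))
  have hval : ∀ c d : ℝ, c ≤ d → ∫ p, (Ioo c d).indicator (fun _ => (2:ℝ)) p = 2 * (d - c) := by
    intro c d hcd
    rw [integral_indicator measurableSet_Ioo]
    simp [hcd, mul_comm]
  have hA : |∫ x in Rct a b, fderiv ℝ (fun x => φ x 0) x (EuclideanSpace.single 0 1)| ≤ 2 * b := by
    have := slice_int (rct_open a b) (v := EuclideanSpace.single 0 1) (by simp) (coord_contDiff h1 0) (coord_compact h2 0)
      (hintg 0 b) (fun p => by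
        by_cases hp : p ∈ Ioo 0 b
        · have e : {y : ℝ | p • perp (EuclideanSpace.single 0 1) + y • (EuclideanSpace.single 0 1 : E2) ∈ Rct a b} = Ioo 0 a := by
            ext y
            have hp1 := hp.1
            have hp2 := hp.2
            simp [Rct, hp1, hp2]
          rw [indicator_of_mem hp, e]
          exact Ioo_int (slice_contDiff (coord_contDiff h1 0) _ p) (fun y => (coord_abs_le _ _).trans (h3 _)) ha.le
        · have e : {y : ℝ | p • perp (EuclideanSpace.single 0 1) + y • (EuclideanSpace.single 0 1 : E2) ∈ Rct a b} = ∅ := by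
            rw [eq_empty_iff_forall_notMem]
            rintro y ⟨_, hy⟩
            apply hp
            simpa using hy
          rw [indicator_of_notMem hp, e]
          simp)
    rwa [hval 0 b hb.le, sub_zero] at this
  have hB : |∫ x in Rct a b, fderiv ℝ (fun x => φ x 1) x (EuclideanSpace.single 1 1)| ≤ 2 * a := by
    have := slice_int (rct_open a b) (v := EuclideanSpace.single 1 1) (by simp) (coord_contDiff h1 1) (coord_compact h2 1)
      (hintg (-a) 0) (fun p => by
        by_cases hp : p ∈ Ioo (-a) 0
        · have e : {y : ℝ | p • perp (EuclideanSpace.single 1 1) + y • (EuclideanSpace.single 1 1 : E2) ∈ Rct a b} = Ioo 0 b := by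
            ext y
            have hp1 : -p < a := by linarith [hp.1]
            have hp2 := hp.2
            simp [Rct, hp1, hp2]
          rw [indicator_of_mem hp, e]
          exact Ioo_int (slice_contDiff (coord_contDiff h1 1) _ p) (fun y => (coord_abs_le _ _).trans (h3 _)) hb.le
        · have e : {y : ℝ | p • perp (EuclideanSpace.single 1 1) + y • (EuclideanSpace.single 1 1 : E2) ∈ Rct a b} = ∅ := by
            rw [eq_empty_iff_forall_notMem]
            rintro y ⟨hy, _⟩
            apply hp
            simp at hy
            exact ⟨by linarith [hy.2], hy.1⟩
          rw [indicator_of_notMem hp, e]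
          simp)
    rwa [hval (-a) 0 (by linarith), zero_sub, neg_neg] at this
  linarith [le_abs_self (∫ x in Rct a b, fderiv ℝ (fun x => φ x 0) x (EuclideanSpace.single 0 1)),
    le_abs_self (∫ x in Rct a b, fderiv ℝ (fun x => φ x 1) x (EuclideanSpace.single 1 1))]

lemma rct_preimage (a b : ℝ) : phi (EuclideanSpace.single 0 1) ⁻¹' (Rct a b) = Ioo 0 b ×ˢ Ioo 0 a := by
  ext ⟨p, y⟩
  simp [Rct, phi, and_comm]

lemma rct_volume {a b : ℝ} (ha : 0 < a) (hb : 0 < b) : (volume (Rct a b)).toReal = a * b := by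
  rw [← (phi_mp (EuclideanSpace.single 0 1) (by simp)).measure_preimage (rct_open a b).measurableSet.nullMeasurableSet,
    rct_preimage, Measure.volume_eq_prod, Measure.prod_prod]
  simp [ha.le, hb.le, mul_comm]

lemma rct_torsion {a b : ℝ} (ha : 0 < a) (hb : 0 < b) : torsion (Rct a b) ≤ a * b ^ 3 / 12 := by
  refine (torsion_le (rct_bdd a b) 1 (b / 2)).trans (le_of_eq ?_)
  rw [← (phi_mp (EuclideanSpace.single 0 1) (by simp)).setIntegral_preimage_emb (phi_emb _ (by simp)), rct_preimage]
  have e : ∀ z : ℝ × ℝ, (phi (EuclideanSpace.single 0 1) z 1 - b / 2) ^ 2 = (z.1 - b / 2) ^ 2 * 1 := by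
    intro z; simp [phi]
  simp_rw [e]
  rw [Measure.volume_eq_prod]
  have := setIntegral_prod_mul (μ := (volume : Measure ℝ)) (ν := (volume : Measure ℝ)) (fun p : ℝ => (p - b / 2) ^ 2) (fun _ : ℝ => (1:ℝ)) (Ioo 0 b) (Ioo 0 a)
  refine this.trans ?_
  rw [← integral_Ioc_eq_integral_Ioo, ← intervalIntegral.integral_of_le hb.le,
    intervalIntegral.integral_comp_sub_right (fun x => x ^ 2), integral_pow]
  simp [ha.le]
  ring

lemma rct_lower {a b : ℝ} (ha : 0 < a) (hb : 0 < b) : Fq (1/2) (Rct a b) ≥ (Real.sqrt 3)⁻¹ :=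
  core_bound (rct_open a b) (rct_bdd a b) ⟨!₂[a / 2, b / 2], by
      refine ⟨⟨?_, ?_⟩, ?_, ?_⟩ <;> simp <;> linarith⟩ (rct_QProp a b)
    ⟨2 * a + 2 * b, rct_perim_aux ha hb⟩ fun v _ => goodSlices_of_convex (rct_convex a b) v

lemma rct_upper {n : ℝ} (hn : 0 < n) : Fq (1/2) (Rct n (1 / n)) ≤ (Real.sqrt 3)⁻¹ * (1 + 1 / n ^ 2) := by
  have hi : 0 < 1 / n := by positivity
  have hP : BddAbove (perimSet (Rct n (1 / n))) := ⟨_, rct_perim_aux hn hi⟩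
  have hp : perimeter (Rct n (1 / n)) ≤ 2 * n + 2 * (1 / n) := by
    refine csSup_le ⟨0, fun _ => 0, contDiff_const, HasCompactSupport.zero, by simp, ?_⟩ (rct_perim_aux hn hi)
    simp [divg]
  have ht := rct_torsion hn hi
  have ht0 : 0 ≤ torsion (Rct n (1 / n)) := torsion_nonneg (rct_bdd _ _)
  unfold Fq
  rw [rct_volume hn hi, mul_one_div_cancel hn.ne', Real.one_rpow, div_one, ← Real.sqrt_eq_rpow]
  have hs : Real.sqrt (torsion (Rct n (1 / n))) ≤ (Real.sqrt 3)⁻¹ * (1 / (2 * n)) := by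
    apply Real.sqrt_le_iff.2 ⟨by positivity, ht.trans (le_of_eq ?_)⟩
    rw [mul_pow, inv_pow, Real.sq_sqrt (by norm_num)]
    field_simp
    norm_num
  calc perimeter (Rct n (1 / n)) * Real.sqrt (torsion (Rct n (1 / n)))
      ≤ (2 * n + 2 * (1 / n)) * ((Real.sqrt 3)⁻¹ * (1 / (2 * n))) :=
        mul_le_mul hp hs (Real.sqrt_nonneg _) (by positivity)
    _ = _ := by field_simp

theorem F_half_lower_bound_and_sharp :
    (∀ Ω : Set E2, memA 1 Ω → IsLipschitzDomain Ω → Fq (1/2) Ω ≥ (Real.sqrt 3)⁻¹) ∧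
    Tendsto (fun n : ℕ => Fq (1/2) {x : E2 | x 0 ∈ Ioo (0:ℝ) (n:ℝ) ∧ x 1 ∈ Ioo (0:ℝ) (1/(n:ℝ))}) atTop (𝓝 ((Real.sqrt 3)⁻¹)) := by
  constructor
  · intro Ω hA hL
    exact core_bound hA.2.1 hA.2.2.1 hA.1 (QProp_of_memA hA) (perim_bdd_of_lipschitz hA.2.1 hA.2.2.1 hL)
      fun v hv => goodSlices_of_lipschitz hA.2.1 hA.2.2.1 hL hv
  · have hlim : Tendsto (fun n : ℕ => (Real.sqrt 3)⁻¹ * (1 + 1 / (n:ℝ) ^ 2)) atTop (𝓝 ((Real.sqrt 3)⁻¹)) := by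
      have h0 : Tendsto (fun n : ℕ => (1:ℝ) / (n:ℝ)) atTop (𝓝 0) := tendsto_one_div_atTop_nhds_zero_nat
      have h1 := ((h0.pow 2).const_add 1).const_mul (Real.sqrt 3)⁻¹
      simpa using h1
    refine tendsto_of_tendsto_of_tendsto_of_le_of_le' tendsto_const_nhds hlim ?_ ?_
    · filter_upwards [eventually_gt_atTop 0] with n hn
      have hn' : (0:ℝ) < n := by exact_mod_cast hn
      exact rct_lower hn' (by positivity)
    · filter_upwards [eventually_gt_atTop 0] with n hn
      have hn' : (0:ℝ) < n := by exact_mod_cast hn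
      exact rct_upper hn'
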